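/- arXiv:math/0504547 — 2 statements merged into one kernel-verified Lean document; each statement's English description precedes it below -/
import Mathlib

section
/- Let (Q,I) and (Q',I') be gentle quivers over a field K, and let A = KQ/I and A' = KQ'/I' be the corresponding gentle algebras. If A and A' are derived equivalent, then ec(Q,I) = ec(Q',I') and oc(Q,I) = oc(Q',I'). -/
/-! Combinatorial model of a finite quiver with (quadratic monomial) relations.

For a monomial algebra `A = KQ/I` (with `I` generated by paths of length 2),
a basis of `e_i A e_j` is given by the paths from `i` to `j` avoiding the
relations, so all Cartan-type invariants are encoded combinatorially. -/

/-- A finite quiver together with a set of quadratic (length two) monomial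
relations: `rel a b` means that the length-two path `ab` belongs to the
relation ideal `I`. -/
structure QuivRel where
  /-- vertices -/
  V : Type
  /-- arrows -/
  A : Type
  [instVFin : Fintype V]
  [instVDec : DecidableEq V]
  [instAFin : Fintype A]
  [instADec : DecidableEq A]
  /-- start vertex of an arrow -/
  src : A → V
  /-- end vertex of an arrow -/
  tgt : A → V
  /-- the set of length-two zero relations -/
  rel : A → A → Prop
  rel_comp : ∀ a b, rel a b → tgt a = src b

attribute [instance] QuivRel.instVFin QuivRel.instVDec QuivRel.instAFin QuivRel.instADec

namespace QuivRel

variable (G : QuivRel)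

/-- Condition (i) and (ii): `(Q,I)` is special biserial (the relation ideal `I`
being generated by the paths of length two recorded in `rel`). -/
def SpecialBiserial : Prop :=
  (∀ v : G.V, Nat.card {a : G.A // G.src a = v} ≤ 2) ∧
  (∀ v : G.V, Nat.card {a : G.A // G.tgt a = v} ≤ 2) ∧
  (∀ a b c : G.A, G.tgt a = G.src b → ¬ G.rel a b → G.tgt a = G.src c → ¬ G.rel a c → b = c) ∧
  (∀ a b c : G.A, G.tgt b = G.src a → ¬ G.rel b a → G.tgt c = G.src a → ¬ G.rel c a → b = c)

/-- `(Q,I)` is a gentle quiver: special biserial, `I` generated by paths of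
length two (built into the data), and conditions (iv). -/
def Gentle : Prop :=
  G.SpecialBiserial ∧
  (∀ a b c : G.A, G.rel a b → G.rel a c → b = c) ∧
  (∀ a b c : G.A, G.rel b a → G.rel c a → b = c)

/-- A (composable) path all of whose length-two subpaths avoid the relations;
these are exactly the paths which are nonzero in the monomial algebra `KQ/I`. -/
def IsNonzeroPath (p : List G.A) : Prop :=
  p.Chain' (fun a b => G.tgt a = G.src b ∧ ¬ G.rel a b)

/-- Nonzero paths from `i` to `j`; the empty list is the trivial path `e_i`
(so we require `i = j` for it). -/
def IsNonzeroPathFrom (i j : G.V) (p : List G.A) : Prop :=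
  G.IsNonzeroPath p ∧ (∀ a ∈ p.head?, G.src a = i) ∧
    (∀ a ∈ p.getLast?, G.tgt a = j) ∧ (p = [] → i = j)

/-- Finite-dimensionality of `KQ/I`: nonzero paths have bounded length. -/
def FinDim : Prop := ∃ N, ∀ p : List G.A, G.IsNonzeroPath p → p.length ≤ N

/-- The `q`-Cartan matrix of `A = KQ/I`: the `(i,j)`-entry is the Poincaré
polynomial `∑_n dim_K (e_i A e_j)_n qⁿ`, i.e. each nonzero path from `i` to `j`
contributes `q^(its length)`. -/
noncomputable def qCartan : Matrix G.V G.V (Polynomial ℤ) := fun i j =>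
  ∑ᶠ n : ℕ,
    (Nat.card {p : List G.A // p.length = n ∧ G.IsNonzeroPathFrom i j p} : Polynomial ℤ) *
      Polynomial.X ^ n

/-- The ordinary Cartan matrix of `A = KQ/I`: the `(i,j)`-entry is
`dim_K e_i A e_j`, the number of nonzero paths from `i` to `j`. -/
noncomputable def cartan : Matrix G.V G.V ℤ := fun i j =>
  (Nat.card {p : List G.A // G.IsNonzeroPathFrom i j p} : ℤ)

/-- An oriented cycle with full zero relations, recorded as the (nonempty) list
of its arrows: any two cyclically consecutive arrows form a relation (this in
particular forces consecutive arrows to be composable, and the start and end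
points to agree). -/
def IsZeroCycle (p : List G.A) : Prop :=
  p ≠ [] ∧ ∀ i : Fin p.length,
    G.rel (p.get i) (p.get ⟨(i.1 + 1) % p.length,
      Nat.mod_lt _ (Nat.lt_of_le_of_lt (Nat.zero_le _) i.2)⟩)

/-- A minimal oriented cycle with full zero relations: its arrows are pairwise
distinct. -/
def IsMinZeroCycle (p : List G.A) : Prop := G.IsZeroCycle p ∧ p.Nodup

/-- Lists satisfying a property, up to cyclic rotation. Oriented cycles are
sequences of arrows up to cyclic rotation. -/
def cycleSetoid (P : List G.A → Prop) : Setoid {p : List G.A // P p} :=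
  Setoid.comap Subtype.val (List.IsRotated.setoid G.A)

/-- `c_k`, the number of minimal oriented `k`-cycles in `Q` with full zero
relations (cycles being counted up to cyclic rotation). -/
noncomputable def numCycles (k : ℕ) : ℕ :=
  Nat.card (Quotient (G.cycleSetoid (fun p => G.IsMinZeroCycle p ∧ p.length = k)))

/-- The total number of minimal oriented cycles in `Q` with full zero relations. -/
noncomputable def totalCycles : ℕ :=
  Nat.card (Quotient (G.cycleSetoid (fun p => G.IsMinZeroCycle p)))

/-- `ec(Q,I)`, the number of minimal oriented cycles with full zero relations
of even length. -/
noncomputable def ec : ℕ :=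
  Nat.card (Quotient (G.cycleSetoid (fun p => G.IsMinZeroCycle p ∧ Even p.length)))

/-- `oc(Q,I)`, the number of minimal oriented cycles with full zero relations
of odd length. -/
noncomputable def oc : ℕ :=
  Nat.card (Quotient (G.cycleSetoid (fun p => G.IsMinZeroCycle p ∧ Odd p.length)))

end QuivRel

/-- Two square matrices over a commutative ring are unimodularly equivalent if
they differ by multiplication by matrices of determinant `1` on either side. -/
def UnimodEquiv {n : Type} [Fintype n] [DecidableEq n] {R : Type} [CommRing R]
    (C D : Matrix n n R) : Prop :=
  ∃ P Q : Matrix n n R, P.det = 1 ∧ Q.det = 1 ∧ D = P * C * Q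

open CategoryTheory

/-- The defining relations of the quotient `KQ/I` of the path algebra of the
quiver `Q` by the ideal `I` generated by the recorded zero relations, as a
quotient of the free `K`-algebra on the vertices and arrows of `Q`: the trivial
paths `e_v` are orthogonal idempotents summing to `1`, an arrow `a` satisfies
`e_{s(a)} a = a = a e_{t(a)}`, and `ab = 0` for each relation `ab ∈ I`. -/
inductive PathAlgRel (K : Type) [CommRing K] (G : QuivRel) :
    FreeAlgebra K (G.V ⊕ G.A) → FreeAlgebra K (G.V ⊕ G.A) → Prop
  | vertex_idem (v : G.V) :
      PathAlgRel K G
        (FreeAlgebra.ι K (Sum.inl v) * FreeAlgebra.ι K (Sum.inl v))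
        (FreeAlgebra.ι K (Sum.inl v))
  | vertex_orth (v w : G.V) (h : v ≠ w) :
      PathAlgRel K G
        (FreeAlgebra.ι K (Sum.inl v) * FreeAlgebra.ι K (Sum.inl w)) 0
  | sum_vertices :
      PathAlgRel K G (∑ v : G.V, FreeAlgebra.ι K (Sum.inl v)) 1
  | src_mul (a : G.A) :
      PathAlgRel K G
        (FreeAlgebra.ι K (Sum.inl (G.src a)) * FreeAlgebra.ι K (Sum.inr a))
        (FreeAlgebra.ι K (Sum.inr a))
  | mul_tgt (a : G.A) :
      PathAlgRel K G
        (FreeAlgebra.ι K (Sum.inr a) * FreeAlgebra.ι K (Sum.inl (G.tgt a)))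
        (FreeAlgebra.ι K (Sum.inr a))
  | rel (a b : G.A) (h : G.rel a b) :
      PathAlgRel K G
        (FreeAlgebra.ι K (Sum.inr a) * FreeAlgebra.ι K (Sum.inr b)) 0

/-- The algebra `A = KQ/I` associated to a quiver with (monomial, length two)
relations: the quotient of the path algebra `KQ` by the ideal `I`. -/
def PathAlgebra (K : Type) [CommRing K] (G : QuivRel) : Type :=
  RingQuot (PathAlgRel K G)

noncomputable instance (K : Type) [CommRing K] (G : QuivRel) :
    Ring (PathAlgebra K G) := by
  delta PathAlgebra; infer_instance

noncomputable instance (K : Type) [CommRing K] (G : QuivRel) :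
    Algebra K (PathAlgebra K G) := by
  delta PathAlgebra; infer_instance

/-- Two rings `A`, `B` are *derived equivalent* if their derived categories are
equivalent as triangulated categories, i.e. there is an equivalence of
categories between them whose functor commutes with the shift and sends
distinguished triangles to distinguished triangles.  (By theorems of Rickard,
for module-finite algebras over a field this is equivalent to the existence of
a triangulated equivalence between the bounded derived categories of finitely
generated modules.) -/
def DerivedEquivalent (A B : Type) [Ring A] [Ring B] : Prop :=
  letI : HasDerivedCategory.{1} (ModuleCat.{0} A) := HasDerivedCategory.standard _
  letI : HasDerivedCategory.{1} (ModuleCat.{0} B) := HasDerivedCategory.standard _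
  ∃ (e : DerivedCategory.{1} (ModuleCat.{0} A) ≌ DerivedCategory.{1} (ModuleCat.{0} B))
    (h : e.functor.CommShift ℤ),
      letI := h
      e.functor.IsTriangulated

namespace CochainComplex.Elements

open HomologicalComplex

variable {R : Type} [Ring R]

/-- The homology class of a cocycle in a complex of modules. -/
noncomputable def homologyClass (K : CochainComplex (ModuleCat.{0} R) ℤ) {n : ℤ} (x : K.X n)
    (hx : K.d n (n + 1) x = 0) : K.homology n :=
  K.homologyπ n (K.liftCycles (ModuleCat.ofHom (LinearMap.toSpanSingleton R (K.X n) x)) (n + 1)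
    (by simp) (by ext; simpa using hx) (1 : R))

lemma iCycles_liftCycles_toSpanSingleton (K : CochainComplex (ModuleCat.{0} R) ℤ) {n : ℤ}
    (x : K.X n) (hx : K.d n (n + 1) x = 0) :
    K.iCycles n (K.liftCycles (ModuleCat.ofHom (LinearMap.toSpanSingleton R (K.X n) x)) (n + 1)
      (by simp) (by ext; simpa using hx) (1 : R)) = x := by
  rw [← ConcreteCategory.comp_apply, liftCycles_i]
  simp

lemma iCycles_injective (K : CochainComplex (ModuleCat.{0} R) ℤ) (n : ℤ) :
    Function.Injective (K.iCycles n) :=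
  (ModuleCat.mono_iff_injective _).1 inferInstance

lemma homologyπ_surjective (K : CochainComplex (ModuleCat.{0} R) ℤ) (n : ℤ) :
    Function.Surjective (K.homologyπ n) :=
  (ModuleCat.epi_iff_surjective _).1 inferInstance

lemma homologyClass_eq (K : CochainComplex (ModuleCat.{0} R) ℤ) {n : ℤ} (c : K.cycles n)
    (x : K.X n) (hx : K.d n (n + 1) x = 0) (h : K.iCycles n c = x) :
    homologyClass K x hx = K.homologyπ n c := by
  refine congrArg (K.homologyπ n) (iCycles_injective K n ?_)
  rw [iCycles_liftCycles_toSpanSingleton _ _ hx, h]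

lemma exists_homologyClass_eq (K : CochainComplex (ModuleCat.{0} R) ℤ) {n : ℤ}
    (c : K.homology n) : ∃ (x : K.X n) (hx : K.d n (n + 1) x = 0), homologyClass K x hx = c := by
  obtain ⟨z, rfl⟩ := homologyπ_surjective K n c
  have h : K.d n (n + 1) (K.iCycles n z) = 0 := by
    rw [← ConcreteCategory.comp_apply, iCycles_d]; rfl
  exact ⟨K.iCycles n z, h, homologyClass_eq K z _ h rfl⟩

lemma homologyClass_eq_zero_iff (K : CochainComplex (ModuleCat.{0} R) ℤ) {n : ℤ} (x : K.X n)
    (hx : K.d n (n + 1) x = 0) :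
    homologyClass K x hx = 0 ↔ ∃ y : K.X (n - 1), K.d (n - 1) n y = x := by
  have hex : (ShortComplex.mk (K.toCycles (n - 1) n) (K.homologyπ n) (by simp)).Exact :=
    ShortComplex.exact_of_g_is_cokernel _ (K.homologyIsCokernel (n - 1) n (by simp))
  rw [ShortComplex.moduleCat_exact_iff] at hex
  constructor
  · intro h
    obtain ⟨y, hy⟩ := hex _ h
    refine ⟨y, ?_⟩
    rw [← toCycles_i K (n - 1) n, ConcreteCategory.comp_apply]
    erw [hy]
    exact iCycles_liftCycles_toSpanSingleton K x hx
  · rintro ⟨y, rfl⟩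
    rw [homologyClass_eq K (K.toCycles (n - 1) n y) _ hx
      (by rw [← ConcreteCategory.comp_apply, toCycles_i])]
    rw [← ConcreteCategory.comp_apply, toCycles_comp_homologyπ]; rfl

lemma map_d {K L : CochainComplex (ModuleCat.{0} R) ℤ} (φ : K ⟶ L) {i j : ℤ} (x : K.X i) :
    L.d i j (φ.f i x) = φ.f j (K.d i j x) := by
  rw [← ConcreteCategory.comp_apply, ← ConcreteCategory.comp_apply, φ.comm]

lemma homologyMap_homologyClass {K L : CochainComplex (ModuleCat.{0} R) ℤ} (φ : K ⟶ L) {n : ℤ}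
    (x : K.X n) (hx : K.d n (n + 1) x = 0) :
    homologyMap φ n (homologyClass K x hx) =
      homologyClass L (φ.f n x) (by rw [map_d, hx, map_zero]) := by
  symm
  unfold homologyClass
  rw [← ConcreteCategory.comp_apply (K.homologyπ n), homologyπ_naturality,
    ConcreteCategory.comp_apply]
  refine homologyClass_eq L _ _ (by rw [map_d, hx, map_zero]) ?_
  refine (ConcreteCategory.comp_apply (cyclesMap φ n) (L.iCycles n) _).symm.trans ?_
  rw [cyclesMap_i, ConcreteCategory.comp_apply, iCycles_liftCycles_toSpanSingleton _ _ hx]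

lemma homologyClass_sub (K : CochainComplex (ModuleCat.{0} R) ℤ) {n : ℤ} (x y : K.X n)
    (hx : K.d n (n + 1) x = 0) (hy : K.d n (n + 1) y = 0) :
    homologyClass K x hx - homologyClass K y hy =
      homologyClass K (x - y) (by rw [map_sub, hx, hy, sub_zero]) := by
  refine Eq.symm ((homologyClass_eq K (_ - _) (x - y) _ ?_).trans (map_sub _ _ _))
  refine (map_sub _ _ _).trans ?_
  rw [iCycles_liftCycles_toSpanSingleton _ _ hx, iCycles_liftCycles_toSpanSingleton _ _ hy]

lemma homologyClass_eq_iff (K : CochainComplex (ModuleCat.{0} R) ℤ) {n : ℤ} (x y : K.X n)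
    (hx : K.d n (n + 1) x = 0) (hy : K.d n (n + 1) y = 0) :
    homologyClass K x hx = homologyClass K y hy ↔
      ∃ z : K.X (n - 1), K.d (n - 1) n z = x - y := by
  rw [← sub_eq_zero, homologyClass_sub, homologyClass_eq_zero_iff]

lemma injective_homologyMap_iff {K L : CochainComplex (ModuleCat.{0} R) ℤ} (φ : K ⟶ L) (n : ℤ) :
    Function.Injective (homologyMap φ n) ↔ ∀ x : K.X n, K.d n (n + 1) x = 0 →
      (∃ y : L.X (n - 1), L.d (n - 1) n y = φ.f n x) → ∃ z : K.X (n - 1), K.d (n - 1) n z = x := by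
  rw [injective_iff_map_eq_zero]
  constructor
  · intro h x hx hy
    rw [← homologyClass_eq_zero_iff K x hx]
    apply h
    rw [homologyMap_homologyClass, homologyClass_eq_zero_iff]
    exact hy
  · intro h c hc
    obtain ⟨x, hx, rfl⟩ := exists_homologyClass_eq K c
    rw [homologyMap_homologyClass, homologyClass_eq_zero_iff] at hc
    rw [homologyClass_eq_zero_iff]
    exact h x hx hc

lemma surjective_homologyMap_iff {K L : CochainComplex (ModuleCat.{0} R) ℤ} (φ : K ⟶ L) (n : ℤ) :
    Function.Surjective (homologyMap φ n) ↔ ∀ y : L.X n, L.d n (n + 1) y = 0 →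
      ∃ x : K.X n, K.d n (n + 1) x = 0 ∧ ∃ z : L.X (n - 1), L.d (n - 1) n z = φ.f n x - y := by
  constructor
  · intro h y hy
    obtain ⟨c, hc⟩ := h (homologyClass L y hy)
    obtain ⟨x, hx, rfl⟩ := exists_homologyClass_eq K c
    rw [homologyMap_homologyClass, homologyClass_eq_iff] at hc
    exact ⟨x, hx, hc⟩
  · intro h c
    obtain ⟨y, hy, rfl⟩ := exists_homologyClass_eq L c
    obtain ⟨x, hx, hz⟩ := h y hy
    refine ⟨homologyClass K x hx, ?_⟩
    rw [homologyMap_homologyClass, homologyClass_eq_iff]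
    exact hz

lemma quasiIso_iff_bijective {K L : CochainComplex (ModuleCat.{0} R) ℤ} (φ : K ⟶ L) :
    QuasiIso φ ↔ ∀ n, Function.Bijective (homologyMap φ n) := by
  rw [quasiIso_iff]
  refine forall_congr' fun n => ?_
  rw [quasiIsoAt_iff_isIso_homologyMap]
  exact ConcreteCategory.isIso_iff_bijective _

lemma d_d (K : CochainComplex (ModuleCat.{0} R) ℤ) (i j k : ℤ) (a : K.X i) :
    K.d j k (K.d i j a) = 0 := by
  rw [← ConcreteCategory.comp_apply, K.d_comp_d]; rfl

section

variable {J : Type}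

/-- The coproduct of a family of complexes of modules. -/
noncomputable def coprod (x : J → CochainComplex (ModuleCat.{0} R) ℤ) :
    CochainComplex (ModuleCat.{0} R) ℤ where
  X n := ModuleCat.of R (Π₀ j, (x j).X n)
  d n m := ModuleCat.ofHom (DFinsupp.mapRange.linearMap fun j => ((x j).d n m).hom)
  shape n m h := by
    refine ModuleCat.hom_ext (LinearMap.ext fun f => DFinsupp.ext fun j => ?_)
    change (x j).d n m (f j) = 0
    rw [(x j).shape n m h]; rfl
  d_comp_d' i j k _ _ :=
    ModuleCat.hom_ext (LinearMap.ext fun f => DFinsupp.ext fun l => d_d (x l) i j k (f l))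

/-- The product of a family of complexes of modules. -/
noncomputable def prod (x : J → CochainComplex (ModuleCat.{0} R) ℤ) :
    CochainComplex (ModuleCat.{0} R) ℤ where
  X n := ModuleCat.of R (Π j, (x j).X n)
  d n m := ModuleCat.ofHom (LinearMap.pi fun j => ((x j).d n m).hom.comp (LinearMap.proj j))
  shape n m h := by
    refine ModuleCat.hom_ext (LinearMap.ext fun f => funext fun j => ?_)
    change (x j).d n m (f j) = 0
    rw [(x j).shape n m h]; rfl
  d_comp_d' i j k _ _ :=
    ModuleCat.hom_ext (LinearMap.ext fun f => funext fun l => d_d (x l) i j k (f l))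

variable (x y : J → CochainComplex (ModuleCat.{0} R) ℤ)

/-- Projection from a coproduct of complexes. -/
noncomputable def coprodπ (j : J) : coprod x ⟶ x j where
  f n := ModuleCat.ofHom (DFinsupp.lapply (R := R) (M := fun j => (x j).X n) j)
  comm' _ _ _ := rfl

/-- Projection from a product of complexes. -/
noncomputable def prodπ (j : J) : prod x ⟶ x j where
  f _ := ModuleCat.ofHom (LinearMap.proj j)
  comm' _ _ _ := rfl

/-- The universal map to a product of complexes. -/
noncomputable def prodLift {z : CochainComplex (ModuleCat.{0} R) ℤ}
    (g : ∀ j, z ⟶ x j) : z ⟶ prod x where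
  f n := ModuleCat.ofHom (LinearMap.pi fun j => ((g j).f n).hom)
  comm' _ _ _ := ModuleCat.hom_ext (LinearMap.ext fun a => funext fun l => map_d (g l) a)

lemma prodLift_π {z : CochainComplex (ModuleCat.{0} R) ℤ} (g : ∀ j, z ⟶ x j) (j : J) :
    prodLift x g ≫ prodπ x j = g j := rfl

variable {x} in
lemma coprod_ext {n : ℤ} {a b : (coprod x).X n}
    (h : ∀ j, (coprodπ x j).f n a = (coprodπ x j).f n b) : a = b :=
  DFinsupp.ext (β := fun j => (x j).X n) h

variable {x} in
lemma exists_support {n : ℤ} (a : (coprod x).X n) :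
    ∃ s : Finset J, ∀ j ∉ s, (coprodπ x j).f n a = 0 := by
  classical
  exact ⟨DFinsupp.support (β := fun j => (x j).X n) a,
    fun j hj => DFinsupp.notMem_support_iff (β := fun j => (x j).X n) (f := a).1 hj⟩

/-- The element of a coproduct with given components on a finite set. -/
noncomputable def coprodMk [DecidableEq J] (s : Finset J) {n : ℤ} (z : ∀ j, (x j).X n) :
    (coprod x).X n :=
  DFinsupp.mk (β := fun j => (x j).X n) s fun j => z j

lemma coprodπ_mk [DecidableEq J] (s : Finset J) {n : ℤ} (z : ∀ j, (x j).X n) (j : J) :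
    (coprodπ x j).f n (coprodMk x s z) = if j ∈ s then z j else 0 := by
  refine (DFinsupp.mk_apply (β := fun j => (x j).X n) (s := s) (x := fun j => z j)
    (i := j)).trans ?_
  split_ifs <;> rfl

/-- Inclusion in a coproduct of complexes. -/
noncomputable def coprodι [DecidableEq J] (j : J) : x j ⟶ coprod x where
  f n := ModuleCat.ofHom (DFinsupp.lsingle (R := R) (M := fun j => (x j).X n) j)
  comm' n m _ := by
    refine ModuleCat.hom_ext (LinearMap.ext fun a => DFinsupp.ext fun l => ?_)
    change (x l).d n m ((DFinsupp.single j a : Π₀ j, (x j).X n) l) =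
      (DFinsupp.single j ((x j).d n m a) : Π₀ j, (x j).X m) l
    by_cases h : j = l
    · subst h; simp
    · rw [DFinsupp.single_eq_of_ne (Ne.symm h), DFinsupp.single_eq_of_ne (Ne.symm h), map_zero]

lemma coprod_hom_ext_f [DecidableEq J] {n : ℤ} {M : ModuleCat.{0} R} {f g : (coprod x).X n ⟶ M}
    (h : ∀ j, (coprodι x j).f n ≫ f = (coprodι x j).f n ≫ g) : f = g :=
  ModuleCat.hom_ext (DFinsupp.lhom_ext' (M := fun j => (x j).X n)
    fun j => congrArg ModuleCat.Hom.hom (h j))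

/-- The universal map out of a coproduct of complexes. -/
noncomputable def coprodDesc [DecidableEq J] {z : CochainComplex (ModuleCat.{0} R) ℤ}
    (g : ∀ j, x j ⟶ z) : coprod x ⟶ z :=
  let f (n : ℤ) : (coprod x).X n ⟶ z.X n :=
    ModuleCat.ofHom (DFinsupp.lsum ℕ (fun j => ((g j).f n).hom))
  have key (n : ℤ) (j : J) : (coprodι x j).f n ≫ f n = (g j).f n :=
    ModuleCat.hom_ext (LinearMap.ext fun a =>
      DFinsupp.lsum_single ℕ (fun j => ((g j).f n).hom) j a)
  { f := f
    comm' n m _ := by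
      refine coprod_hom_ext_f x fun j => ?_
      have h2 := (coprodι x j).comm n m
      rw [← Category.assoc, ← Category.assoc, key, h2, Category.assoc, key]
      exact (g j).comm n m }

lemma coprodι_desc [DecidableEq J] {z : CochainComplex (ModuleCat.{0} R) ℤ} (g : ∀ j, x j ⟶ z)
    (j : J) : coprodι x j ≫ coprodDesc x g = g j := by
  ext n a
  exact DFinsupp.lsum_single ℕ (fun j => ((g j).f n).hom) j a

lemma coprodι_π [DecidableEq J] (j : J) {n : ℤ} (a : (x j).X n) :
    (coprodπ x j).f n ((coprodι x j).f n a) = a :=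
  DFinsupp.single_eq_same

lemma coprodι_π_ne [DecidableEq J] {j l : J} (h : j ≠ l) {n : ℤ} (a : (x j).X n) :
    (coprodπ x l).f n ((coprodι x j).f n a) = 0 :=
  DFinsupp.single_eq_of_ne (Ne.symm h)

variable {x y}

/-- The map between coproducts of complexes induced by a family of maps. -/
noncomputable def coprodMap (g : ∀ j, x j ⟶ y j) : coprod x ⟶ coprod y where
  f n := ModuleCat.ofHom (DFinsupp.mapRange.linearMap fun j => ((g j).f n).hom)
  comm' n _ _ := ModuleCat.hom_ext (LinearMap.ext fun a =>
    coprod_ext fun l => map_d (g l) ((coprodπ x l).f n a))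

lemma coprodι_map [DecidableEq J] (g : ∀ j, x j ⟶ y j) (j : J) :
    coprodι x j ≫ coprodMap g = g j ≫ coprodι y j := by
  ext n a
  refine coprod_ext fun l => ?_
  change (g l).f n ((coprodπ x l).f n ((coprodι x j).f n a)) =
    (coprodπ y l).f n ((coprodι y j).f n ((g j).f n a))
  by_cases h : j = l
  · subst h
    rw [coprodι_π, coprodι_π]
  · rw [coprodι_π_ne _ h, coprodι_π_ne _ h, map_zero]

/-- The map between products of complexes induced by a family of maps. -/
noncomputable def prodMap (g : ∀ j, x j ⟶ y j) : prod x ⟶ prod y :=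
  prodLift y fun j => prodπ x j ≫ g j

lemma quasiIso_prodMap (g : ∀ j, x j ⟶ y j) [∀ j, QuasiIso (g j)] : QuasiIso (prodMap g) := by
  rw [quasiIso_iff_bijective]
  intro n
  have h := fun j => (quasiIso_iff_bijective (g j)).1 inferInstance n
  constructor
  · rw [injective_homologyMap_iff]
    intro a ha ⟨b, hb⟩
    have := fun j => (injective_homologyMap_iff (g j) n).1 (h j).1 ((prodπ x j).f n a)
      (by rw [map_d, ha, map_zero]) ⟨(prodπ y j).f _ b, congrFun hb j⟩
    choose z hz using this
    exact ⟨(z : Π j, (x j).X (n - 1)), funext hz⟩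
  · rw [surjective_homologyMap_iff]
    intro b hb
    have := fun j => (surjective_homologyMap_iff (g j) n).1 (h j).2 ((prodπ y j).f n b)
      (by rw [map_d, hb, map_zero])
    choose a ha z hz using this
    exact ⟨(a : Π j, (x j).X n), funext ha, (z : Π j, (y j).X (n - 1)), funext hz⟩

lemma quasiIso_coprodMap (g : ∀ j, x j ⟶ y j) [∀ j, QuasiIso (g j)] :
    QuasiIso (coprodMap g) := by
  classical
  rw [quasiIso_iff_bijective]
  intro n
  have h := fun j => (quasiIso_iff_bijective (g j)).1 inferInstance n
  constructor
  · rw [injective_homologyMap_iff]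
    intro a ha ⟨b, hb⟩
    have := fun j => (injective_homologyMap_iff (g j) n).1 (h j).1 ((coprodπ x j).f n a)
      (by rw [map_d, ha, map_zero]) ⟨(coprodπ y j).f _ b, by rw [map_d, hb]; rfl⟩
    choose z hz using this
    obtain ⟨s, hs⟩ := exists_support a
    refine ⟨coprodMk x s z, coprod_ext fun j => ?_⟩
    rw [← map_d, coprodπ_mk]
    split_ifs with hj
    · exact hz j
    · rw [map_zero, hs j hj]
  · rw [surjective_homologyMap_iff]
    intro b hb
    have := fun j => (surjective_homologyMap_iff (g j) n).1 (h j).2 ((coprodπ y j).f n b)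
      (by rw [map_d, hb, map_zero])
    choose a ha z hz using this
    obtain ⟨s, hs⟩ := exists_support b
    refine ⟨coprodMk x s a, coprod_ext fun j => ?_, coprodMk y s z, coprod_ext fun j => ?_⟩
    · rw [← map_d, coprodπ_mk, map_zero]
      split_ifs with hj
      · exact ha j
      · rw [map_zero]
    · rw [← map_d, coprodπ_mk, map_sub]
      change _ = (g j).f n ((coprodπ x j).f n (coprodMk x s a)) - _
      rw [coprodπ_mk]
      split_ifs with hj
      · exact hz j
      · rw [map_zero, map_zero, hs j hj, sub_zero]

end

end CochainComplex.Elements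

/-- An object is small if morphisms to (weak) coproducts have finite support. -/
def CategoryTheory.IsSmall {T : Type*} [Category* T] [Preadditive T] (P : T) : Prop :=
  ∀ (J : Type) (X : J → T), ∃ (S : T) (ι : ∀ j, X j ⟶ S),
    (∀ (Y : T) (g : ∀ j, X j ⟶ Y), ∃ u : S ⟶ Y, ∀ j, ι j ≫ u = g j) ∧
    ∀ h : P ⟶ S, ∃ (s : Finset J) (g : ∀ j, P ⟶ X j), h = ∑ j ∈ s, g j ≫ ι j

namespace CochainComplex.Elements

open HomologicalComplex

variable {R : Type} [Ring R] {J : Type}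
  (x : J → CochainComplex (ModuleCat.{0} R) ℤ)

lemma sum_hom_apply {M N : ModuleCat.{0} R} (s : Finset J) (f : J → (M ⟶ N)) (a : M) :
    (∑ j ∈ s, f j) a = ∑ j ∈ s, f j a :=
  (congrArg (fun l : M →ₗ[R] N => l a) (ModuleCat.hom_sum f s)).trans (LinearMap.sum_apply _ _ _)

variable [DecidableEq J]

lemma sum_π_ι_apply (s : Finset J) {n : ℤ} (a : (coprod x).X n)
    (hs : ∀ j ∉ s, (coprodπ x j).f n a = 0) :
    (∑ j ∈ s, coprodπ x j ≫ coprodι x j).f n a = a := by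
  refine coprod_ext fun l => ?_
  have h1 : (∑ j ∈ s, coprodπ x j ≫ coprodι x j).f n a =
      ∑ j ∈ s, (coprodι x j).f n ((coprodπ x j).f n a) := by
    have h0 := (eval (ModuleCat.{0} R) (ComplexShape.up ℤ) n).map_sum
      (fun j => coprodπ x j ≫ coprodι x j) s
    exact (ConcreteCategory.congr_hom h0 a).trans (sum_hom_apply _ _ _)
  rw [h1, map_sum]
  by_cases hl : l ∈ s
  · rw [Finset.sum_eq_single_of_mem l hl, coprodι_π]
    intro j _ hj
    rw [coprodι_π_ne _ hj]
  · rw [hs l hl]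
    refine Finset.sum_eq_zero fun j hj => ?_
    rw [coprodι_π_ne]
    rintro rfl
    exact hl hj

lemma homology_coprod_hom_ext {n : ℤ} {M : ModuleCat.{0} R} {f g : (coprod x).homology n ⟶ M}
    (h : ∀ j, homologyMap (coprodι x j) n ≫ f = homologyMap (coprodι x j) n ≫ g) : f = g := by
  ext c
  obtain ⟨a, ha, rfl⟩ := exists_homologyClass_eq _ c
  obtain ⟨s, hs⟩ := exists_support a
  have key : homologyClass _ a ha =
      ∑ j ∈ s, homologyMap (coprodι x j) n
        (homologyMap (coprodπ x j) n (homologyClass _ a ha)) := by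
    have h1 : homologyMap (∑ j ∈ s, coprodπ x j ≫ coprodι x j) n (homologyClass _ a ha) =
        homologyClass _ a ha := by
      rw [homologyMap_homologyClass]
      congr 1
      exact sum_π_ι_apply x s a hs
    have h2 := (homologyFunctor (ModuleCat.{0} R) (ComplexShape.up ℤ) n).map_sum
      (fun j => coprodπ x j ≫ coprodι x j) s
    simp only [homologyFunctor_map] at h2
    refine h1.symm.trans ((ConcreteCategory.congr_hom h2 _).trans ?_)
    refine (sum_hom_apply _ _ _).trans ?_
    refine Finset.sum_congr rfl fun j _ => ?_
    rw [homologyMap_comp]; rfl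
  rw [key, map_sum, map_sum]
  refine Finset.sum_congr rfl fun j _ => ?_
  exact ConcreteCategory.congr_hom (h j) _

end CochainComplex.Elements

namespace DerivedCategory

open CochainComplex.Elements HomologicalComplex

universe w

variable {R : Type} [Ring R] [HasDerivedCategory.{w} (ModuleCat.{0} R)] {J : Type}
  (x : J → CochainComplex (ModuleCat.{0} R) ℤ)

/-- The homology of a complex computes the homology of its image in the derived category. -/
noncomputable def homologyQIso (K : CochainComplex (ModuleCat.{0} R) ℤ) (n : ℤ) :
    (homologyFunctor (ModuleCat.{0} R) n).obj (Q.obj K) ≅ K.homology n :=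
  (homologyFunctorFactors (ModuleCat.{0} R) n).app K

lemma homologyQIso_naturality {K L : CochainComplex (ModuleCat.{0} R) ℤ} (f : K ⟶ L) (n : ℤ) :
    (homologyFunctor (ModuleCat.{0} R) n).map (Q.map f) ≫ (homologyQIso L n).hom =
      (homologyQIso K n).hom ≫ homologyMap f n :=
  homologyFunctorFactors_hom_naturality f n

lemma homologyQIso_inv_naturality {K L : CochainComplex (ModuleCat.{0} R) ℤ} (f : K ⟶ L) (n : ℤ) :
    homologyMap f n ≫ (homologyQIso L n).inv =
      (homologyQIso K n).inv ≫ (homologyFunctor (ModuleCat.{0} R) n).map (Q.map f) := by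
  rw [Iso.comp_inv_eq, Category.assoc, homologyQIso_naturality, Iso.inv_hom_id_assoc]

lemma homologyQIso_inv_naturality_assoc {K L : CochainComplex (ModuleCat.{0} R) ℤ} (f : K ⟶ L)
    (n : ℤ) {M : ModuleCat.{0} R} (g : (homologyFunctor (ModuleCat.{0} R) n).obj (Q.obj L) ⟶ M) :
    homologyMap f n ≫ (homologyQIso L n).inv ≫ g =
      (homologyQIso K n).inv ≫ (homologyFunctor (ModuleCat.{0} R) n).map (Q.map f) ≫ g := by
  rw [← Category.assoc, homologyQIso_inv_naturality, Category.assoc]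

lemma exists_coprod_desc [DecidableEq J] {Y : DerivedCategory (ModuleCat.{0} R)}
    (g : ∀ j, Q.obj (x j) ⟶ Y) :
    ∃ u : Q.obj (coprod x) ⟶ Y, ∀ j, Q.map (coprodι x j) ≫ u = g j := by
  let y := Q.objPreimage Y
  let e : Q.obj y ≅ Y := Q.objObjPreimageIso Y
  have h (j : J) := right_fac (g j ≫ e.inv)
  choose x' s hs f hf using h
  have hs' := fun j => (isIso_Q_map_iff_quasiIso _ (s j)).1 (hs j)
  have := quasiIso_coprodMap s
  have h3 : IsIso (Q.map (coprodMap s)) := (isIso_Q_map_iff_quasiIso _ _).2 this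
  refine ⟨inv (Q.map (coprodMap s)) ≫ Q.map (coprodDesc x' f) ≫ e.hom, fun j => ?_⟩
  have h1 : Q.map (s j) ≫ Q.map (coprodι x j) ≫ inv (Q.map (coprodMap s)) ≫
      Q.map (coprodDesc x' f) = Q.map (coprodι x' j) ≫ Q.map (coprodDesc x' f) := by
    rw [← Q.map_comp_assoc, ← coprodι_map, Q.map_comp_assoc, IsIso.hom_inv_id_assoc]
  rw [← cancel_mono e.inv, hf j, ← cancel_epi (Q.map (s j)), IsIso.hom_inv_id_assoc]
  simp only [Category.assoc, e.hom_inv_id, Category.comp_id]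
  rw [h1, ← Q.map_comp, coprodι_desc]

lemma exists_prod_lift {Y : DerivedCategory (ModuleCat.{0} R)}
    (g : ∀ j, Y ⟶ Q.obj (x j)) :
    ∃ u : Y ⟶ Q.obj (prod x), ∀ j, u ≫ Q.map (prodπ x j) = g j := by
  let y := Q.objPreimage Y
  let e : Q.obj y ≅ Y := Q.objObjPreimageIso Y
  have h (j : J) := left_fac (e.hom ≫ g j)
  choose x' f s hs hf using h
  have hs' := fun j => (isIso_Q_map_iff_quasiIso _ (s j)).1 (hs j)
  have := quasiIso_prodMap s
  have h3 : IsIso (Q.map (prodMap s)) := (isIso_Q_map_iff_quasiIso _ _).2 this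
  refine ⟨e.inv ≫ Q.map (prodLift x' f) ≫ inv (Q.map (prodMap s)), fun j => ?_⟩
  have h1 : inv (Q.map (prodMap s)) ≫ Q.map (prodπ x j) ≫ Q.map (s j) = Q.map (prodπ x' j) := by
    rw [IsIso.inv_comp_eq, ← Q.map_comp, ← Q.map_comp]; rfl
  rw [← cancel_epi e.hom, hf j, ← cancel_mono (Q.map (s j))]
  simp only [Category.assoc, e.hom_inv_id_assoc, IsIso.inv_hom_id, Category.comp_id, h1]
  rw [← Q.map_comp, prodLift_π]

variable {x} in
lemma isIso_of_coprodι_comp [DecidableEq J] (θ : Q.obj (coprod x) ⟶ Q.obj (coprod x))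
    (h : ∀ j, Q.map (coprodι x j) ≫ θ = Q.map (coprodι x j)) : IsIso θ := by
  rw [DerivedCategory.isIso_iff]
  intro n
  suffices (homologyFunctor (ModuleCat.{0} R) n).map θ = 𝟙 _ by rw [this]; infer_instance
  rw [← cancel_epi (homologyQIso (coprod x) n).inv]
  refine homology_coprod_hom_ext x fun j => ?_
  rw [homologyQIso_inv_naturality_assoc, homologyQIso_inv_naturality_assoc, ← Functor.map_comp, h,
    Category.comp_id]

lemma exists_sum_of_isSmall [DecidableEq J] {P : DerivedCategory (ModuleCat.{0} R)}
    (hP : IsSmall P) (h : P ⟶ Q.obj (coprod x)) :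
    ∃ (s : Finset J) (g : ∀ j, P ⟶ Q.obj (x j)), h = ∑ j ∈ s, g j ≫ Q.map (coprodι x j) := by
  obtain ⟨S, ι, hS, hP⟩ := hP J (fun j => Q.obj (x j))
  obtain ⟨u, hu⟩ := hS _ (fun j => Q.map (coprodι x j))
  obtain ⟨v, hv⟩ := exists_coprod_desc x ι
  have : IsIso (v ≫ u) := isIso_of_coprodι_comp _ fun j => by
    rw [← Category.assoc, hv, hu]
  obtain ⟨s, g, hg⟩ := hP (h ≫ inv (v ≫ u) ≫ v)
  refine ⟨s, g, ?_⟩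
  have := congrArg (· ≫ u) hg
  simpa [Preadditive.sum_comp, hu] using this

end DerivedCategory

namespace CochainComplex.Elements

open HomologicalComplex

variable {R : Type} [Ring R]

lemma quasiIso_of_bijective {K L : CochainComplex (ModuleCat.{0} R) ℤ} (φ : K ⟶ L)
    (h : ∀ n, Function.Bijective (φ.f n)) : QuasiIso φ := by
  have : ∀ n, IsIso (φ.f n) := fun n => (ConcreteCategory.isIso_iff_bijective _).2 (h n)
  have : IsIso φ := Hom.isIso_of_components φ
  infer_instance

end CochainComplex.Elements

namespace DerivedCategory

open CochainComplex.Elements HomologicalComplex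

universe w

variable {R : Type} [Ring R] [HasDerivedCategory.{w} (ModuleCat.{0} R)]

lemma exists_Q_map_eq_of_projective (n : ℤ) (M : ModuleCat.{0} R) [Projective M]
    {y : CochainComplex (ModuleCat.{0} R) ℤ}
    (f : (singleFunctor (ModuleCat.{0} R) n).obj M ⟶ Q.obj y) :
    ∃ g : (single (ModuleCat.{0} R) (ComplexShape.up ℤ) n).obj M ⟶ y, Q.map g = f := by
  let x := (single (ModuleCat.{0} R) (ComplexShape.up ℤ) n).obj M
  have h1 : ∀ k : ℤ, Projective (x.X k) := fun k => by
    by_cases hk : k = n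
    · subst hk
      exact Projective.of_iso (singleObjXSelf (ComplexShape.up ℤ) k M).symm inferInstance
    · exact Projective.of_iso (isZero_single_obj_X (ComplexShape.up ℤ) n M k hk).isoZero.symm
        inferInstance
  have h0 : CochainComplex.IsStrictlyLE x n :=
    inferInstanceAs (((CochainComplex.singleFunctor _ n).obj M).IsStrictlyLE n)
  have : CochainComplex.IsKProjective x := CochainComplex.isKProjective_of_projective x n
  let f' : Q.obj x ⟶ Q.obj y := f
  let q (z : CochainComplex (ModuleCat.{0} R) ℤ) :
    Qh.obj ((HomotopyCategory.quotient _ _).obj z) ≅ Q.obj z := (quotientCompQhIso _).app z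
  obtain ⟨g, hg⟩ := (CochainComplex.IsKProjective.Qh_map_bijective x
    ((HomotopyCategory.quotient _ _).obj y)).2 ((q x).hom ≫ f' ≫ (q y).inv)
  obtain ⟨g, rfl⟩ := (HomotopyCategory.quotient _ _).map_surjective g
  refine ⟨g, ?_⟩
  have h2 : Qh.map ((HomotopyCategory.quotient _ _).map g) ≫ (q y).hom = (q x).hom ≫ Q.map g :=
    quotientCompQhIso_hom_naturality g
  rw [hg, Category.assoc, Category.assoc, Iso.inv_hom_id, cancel_epi, Category.comp_id] at h2
  exact h2.symm

lemma isSmall_singleFunctor_of_projective (n : ℤ) (M : ModuleCat.{0} R) [Projective M]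
    [Module.Finite R M] : IsSmall ((singleFunctor (ModuleCat.{0} R) n).obj M) := by
  classical
  intro J X
  let x (j : J) := Q.objPreimage (X j)
  let e (j : J) : Q.obj (x j) ≅ X j := Q.objObjPreimageIso (X j)
  refine ⟨Q.obj (coprod x), fun j => (e j).inv ≫ Q.map (coprodι x j), fun Y g => ?_, fun h => ?_⟩
  · obtain ⟨u, hu⟩ := exists_coprod_desc x (fun j => (e j).hom ≫ g j)
    exact ⟨u, fun j => by rw [Category.assoc, hu, Iso.inv_hom_id_assoc]⟩
  · obtain ⟨g, rfl⟩ := exists_Q_map_eq_of_projective n M h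
    let i := (singleObjXSelf (ComplexShape.up ℤ) n M)
    obtain ⟨t, ht⟩ := Module.Finite.fg_top (R := R) (M := M)
    choose s hs using fun m : M => exists_support (g.f n (i.inv m))
    refine ⟨t.biUnion s, fun j => Q.map (g ≫ coprodπ x j) ≫ (e j).hom, ?_⟩
    have h1 : g = ∑ j ∈ t.biUnion s, (g ≫ coprodπ x j) ≫ coprodι x j := by
      refine from_single_hom_ext ?_
      rw [← cancel_epi i.inv]
      ext m
      induction (show m ∈ Submodule.span R (t : Set M) from ht ▸ trivial) using
        Submodule.span_induction with
      | mem m hm =>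
        have h2 := sum_π_ι_apply x (t.biUnion s) (g.f n (i.inv m)) fun j hj =>
          hs m j fun hj' => hj (Finset.mem_biUnion.2 ⟨m, hm, hj'⟩)
        have h3 : ∑ j ∈ t.biUnion s, (g ≫ coprodπ x j) ≫ coprodι x j =
          g ≫ ∑ j ∈ t.biUnion s, coprodπ x j ≫ coprodι x j := by
          simp [Preadditive.comp_sum]
        rw [h3]
        exact h2.symm
      | zero => rw [map_zero, map_zero]
      | add a b _ _ ha hb => rw [map_add, map_add, ha, hb]
      | smul r a _ ha => rw [map_smul, map_smul, ha]
    conv_lhs => rw [h1]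
    rw [Functor.map_sum]
    refine Finset.sum_congr rfl fun j _ => ?_
    have h4 : Q.map ((g ≫ coprodπ x j) ≫ coprodι x j) =
        (Q.map (g ≫ coprodπ x j) ≫ (e j).hom) ≫ (e j).inv ≫ Q.map (coprodι x j) := by
      rw [Q.map_comp, Category.assoc, Iso.hom_inv_id_assoc]
    exact h4

lemma exists_lift_homology (n : ℤ) (P : ModuleCat.{0} R) [Projective P]
    {X : DerivedCategory (ModuleCat.{0} R)}
    (φ : P ⟶ (homologyFunctor (ModuleCat.{0} R) n).obj X) :
    ∃ (f : (singleFunctor (ModuleCat.{0} R) n).obj P ⟶ X)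
      (u : P ⟶ (homologyFunctor (ModuleCat.{0} R) n).obj
        ((singleFunctor (ModuleCat.{0} R) n).obj P)),
      u ≫ (homologyFunctor (ModuleCat.{0} R) n).map f = φ := by
  let y := Q.objPreimage X
  let e : Q.obj y ≅ X := Q.objObjPreimageIso X
  let φ' : P ⟶ y.cycles n := Projective.factorThru
    (φ ≫ (homologyFunctor (ModuleCat.{0} R) n).map e.inv ≫ (homologyQIso y n).hom) (y.homologyπ n)
  have hφ' : φ' ≫ y.homologyπ n = φ ≫ (homologyFunctor (ModuleCat.{0} R) n).map e.inv ≫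
    (homologyQIso y n).hom := Projective.factorThru_comp _ _
  let g : (single (ModuleCat.{0} R) (ComplexShape.up ℤ) n).obj P ⟶ y :=
    mkHomFromSingle (φ' ≫ y.iCycles n) (fun k _ => by simp)
  let u : P ⟶ ((single (ModuleCat.{0} R) (ComplexShape.up ℤ) n).obj P).homology n :=
    liftCycles _ (singleObjXSelf (ComplexShape.up ℤ) n P).inv (n + 1) (by simp) (by simp) ≫
      homologyπ _ n
  have hu : u ≫ homologyMap g n = φ' ≫ y.homologyπ n := by
    have : liftCycles _ (singleObjXSelf (ComplexShape.up ℤ) n P).inv (n + 1) (by simp) (by simp) ≫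
      cyclesMap g n = φ' := by
      rw [← cancel_mono (y.iCycles n)]
      simp [g]
    simp only [u, Category.assoc, homologyπ_naturality]
    rw [← Category.assoc, this]
  refine ⟨Q.map g ≫ e.hom, u ≫ (homologyQIso _ n).inv, ?_⟩
  have h1 : (u ≫ (homologyQIso _ n).inv) ≫
      (homologyFunctor (ModuleCat.{0} R) n).map (Q.map g ≫ e.hom) = φ := by
    rw [Functor.map_comp, Category.assoc, ← homologyQIso_inv_naturality_assoc g n,
      ← Category.assoc, hu, hφ', Category.assoc, Category.assoc, Iso.hom_inv_id_assoc,
      ← Functor.map_comp, Iso.inv_hom_id, CategoryTheory.Functor.map_id, Category.comp_id]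
  exact h1

lemma exists_sum_of_quasiIso {J N : Type} [DecidableEq J]
    {x : J → CochainComplex (ModuleCat.{0} R) ℤ} {y : N → CochainComplex (ModuleCat.{0} R) ℤ}
    (can : coprod x ⟶ prod y) [QuasiIso can] {P : DerivedCategory (ModuleCat.{0} R)}
    (hP : IsSmall P) (h : ∀ n, P ⟶ Q.obj (y n)) :
    ∃ (s : Finset J) (g : ∀ j, P ⟶ Q.obj (x j)),
      ∀ n, h n = ∑ j ∈ s, g j ≫ Q.map (coprodι x j ≫ can ≫ prodπ y n) := by
  obtain ⟨u, hu⟩ := exists_prod_lift y h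
  have : IsIso (Q.map can) := inferInstance
  obtain ⟨s, g, hg⟩ := exists_sum_of_isSmall x hP (u ≫ inv (Q.map can))
  refine ⟨s, g, fun n => ?_⟩
  have h1 := congrArg (· ≫ Q.map can ≫ Q.map (prodπ y n)) hg
  simp only [Category.assoc, IsIso.inv_hom_id_assoc, hu, Preadditive.sum_comp] at h1
  simpa using h1

lemma exists_bound_of_isSmall {P : DerivedCategory (ModuleCat.{0} R)} (hP : IsSmall P) :
    ∃ N : ℕ, ∀ i : ℤ, N < i.natAbs → ∀ (M : ModuleCat.{0} R)
      (h : P ⟶ (singleFunctor (ModuleCat.{0} R) i).obj M), h = 0 := by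
  classical
  let J : Type := {i : ℤ // ∃ (M : ModuleCat.{0} R)
      (h : P ⟶ (singleFunctor (ModuleCat.{0} R) i).obj M), h ≠ 0}
  choose M h hh using fun j : J => j.2
  let x (j : J) := (single (ModuleCat.{0} R) (ComplexShape.up ℤ) j.1).obj (M j)
  let can : coprod x ⟶ prod x := prodLift x (coprodπ x)
  have hx : ∀ (j : J) (n : ℤ), n ≠ j.1 → ∀ a : (x j).X n, a = 0 := fun j n hn a => by
    have := ModuleCat.subsingleton_of_isZero
      (isZero_single_obj_X (ComplexShape.up ℤ) j.1 (M j) n hn)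
    exact Subsingleton.elim (α := (x j).X n) _ _
  have : QuasiIso can := by
    refine quasiIso_of_bijective can fun n => ⟨fun a b hab => ?_, fun b => ?_⟩
    · exact coprod_ext fun j => congrFun hab j
    · let s : Finset J := if hn : ∃ M, ∃ (h : P ⟶ (singleFunctor (ModuleCat.{0} R) n).obj M), h ≠ 0
        then {⟨n, hn⟩} else ∅
      refine ⟨coprodMk x s fun j => (prodπ x j).f n b, funext fun j => ?_⟩
      refine (coprodπ_mk x s _ j).trans ?_
      split_ifs with hj
      · rfl
      · have : n ≠ j.1 := by
          rintro rfl
          apply hj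
          simp only [s]
          rw [dif_pos j.2]
          exact Finset.mem_singleton_self _
        exact (hx j n this _).symm
  obtain ⟨s, g, hg⟩ := exists_sum_of_quasiIso can hP h
  have hs : ∀ j : J, j ∈ s := by
    intro j
    by_contra hj
    refine hh j ((hg j).trans (Finset.sum_eq_zero fun l hl => ?_))
    have h0 : coprodι x l ≫ can ≫ prodπ x j = 0 := by
      refine HomologicalComplex.hom_ext _ _ fun n => ModuleCat.hom_ext (LinearMap.ext fun a => ?_)
      refine coprodι_π_ne x ?_ a
      rintro rfl
      exact hj hl
    rw [h0, Functor.map_zero, Limits.comp_zero]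
  refine ⟨s.sup fun j => j.1.natAbs, fun i hi M h => ?_⟩
  by_contra hne
  exact absurd hi (not_lt.2 (Finset.le_sup (f := fun j : J => j.1.natAbs)
    (hs ⟨i, M, h, hne⟩)))

end DerivedCategory

namespace DerivedCategory

open CochainComplex.Elements HomologicalComplex
open scoped ModuleCat

universe w

variable {K : Type} [Field K] {R : Type} [Ring R] [Algebra K R]

/-- The morphism from a coproduct of copies of a complex to a product of copies given by a matrix
of scalars. -/
noncomputable def scalarMatrix {J N : Type} [DecidableEq J] (b : J → N → K)
    (x : CochainComplex (ModuleCat.{0} R) ℤ) : coprod (fun _ : J => x) ⟶ prod (fun _ : N => x) :=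
  coprodDesc _ fun j => prodLift _ fun n => b j n • 𝟙 x

lemma scalarMatrix_comp {J N : Type} [DecidableEq J] (b : J → N → K)
    (x : CochainComplex (ModuleCat.{0} R) ℤ) (j : J) (n : N) :
    coprodι (fun _ : J => x) j ≫ scalarMatrix b x ≫ prodπ (fun _ : N => x) n = b j n • 𝟙 x := by
  rw [scalarMatrix, ← Category.assoc, coprodι_desc, prodLift_π]

lemma scalarMatrix_apply {J N : Type} [DecidableEq J] (b : J → N → K)
    (x : CochainComplex (ModuleCat.{0} R) ℤ) {i : ℤ} (s : Finset J)
    (a : (coprod (fun _ : J => x)).X i)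
    (hs : ∀ j ∉ s, (coprodπ (fun _ : J => x) j).f i a = 0) (n : N) :
    (prodπ (fun _ : N => x) n).f i ((scalarMatrix b x).f i a) =
      ∑ j ∈ s, b j n • (coprodπ (fun _ : J => x) j).f i a := by
  have h1 := sum_π_ι_apply _ s a hs
  have h0 := (eval (ModuleCat.{0} R) (ComplexShape.up ℤ) i).map_sum
      (fun j => coprodπ (fun _ : J => x) j ≫ coprodι (fun _ : J => x) j) s
  have h2 : a = ∑ j ∈ s, (coprodι (fun _ : J => x) j).f i ((coprodπ (fun _ : J => x) j).f i a) :=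
    h1.symm.trans ((ConcreteCategory.congr_hom h0 a).trans (sum_hom_apply _ _ _))
  refine (congrArg (fun t => (prodπ (fun _ : N => x) n).f i ((scalarMatrix b x).f i t)) h2).trans ?_
  rw [map_sum, map_sum]
  refine Finset.sum_congr rfl fun j _ => ?_
  exact ConcreteCategory.congr_hom (HomologicalComplex.congr_hom (scalarMatrix_comp b x j n) i) _

lemma quasiIso_scalarMatrix {J : Type} [DecidableEq J] (b : Module.Basis J K (ℕ → K))
    (x : CochainComplex (ModuleCat.{0} R) ℤ) [∀ i, FiniteDimensional K (x.X i)] :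
    QuasiIso (scalarMatrix (fun j => b j) x) := by
  refine quasiIso_of_bijective _ fun i => ⟨?_, ?_⟩
  · rw [injective_iff_map_eq_zero]
    intro a ha
    obtain ⟨s, hs⟩ := exists_support a
    have h1 := fun n => scalarMatrix_apply (fun j => b j) x s a hs n
    let c := Module.finBasis K (x.X i)
    have h2 : ∀ k, ∑ j ∈ s, c.repr ((coprodπ (fun _ : J => x) j).f i a) k • b j = 0 := by
      intro k
      ext n
      have h3 := congrArg (fun t => c.repr t k) (h1 n)
      rw [ha] at h3
      simpa [mul_comm] using h3.symm
    refine coprod_ext fun j => ?_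
    rw [map_zero]
    by_cases hj : j ∈ s
    · refine c.repr.injective (Finsupp.ext fun k => ?_)
      rw [map_zero]
      exact linearIndependent_iff'.1 b.linearIndependent s _ (h2 k) j hj
    · exact hs j hj
  · intro z
    let c := Module.finBasis K (x.X i)
    let v (k) : ℕ → K := fun n => c.repr ((prodπ (fun _ : ℕ => x) n).f i z) k
    let s := Finset.univ.biUnion fun k => (b.repr (v k)).support
    let m (j : J) : x.X i := ∑ k, b.repr (v k) j • c k
    refine ⟨coprodMk (fun _ : J => x) s m, funext fun n => ?_⟩
    have h0 : ∀ j ∉ s, (coprodπ (fun _ : J => x) j).f i (coprodMk (fun _ : J => x) s m) = 0 :=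
      fun j hj => by rw [coprodπ_mk, if_neg hj]
    refine (scalarMatrix_apply (fun j => b j) x s _ h0 n).trans ?_
    have h2 : ∀ k, ∑ j ∈ s, b.repr (v k) j * b j n = v k n := by
      intro k
      have := b.linearCombination_repr (v k)
      rw [Finsupp.linearCombination_apply, Finsupp.sum_of_support_subset (s := s)] at this
      · simpa using congrFun this n
      · exact Finset.subset_biUnion_of_mem (fun k => (b.repr (v k)).support) (Finset.mem_univ k)
      · simp
    refine (?_ : _ = ∑ k, v k n • c k).trans (c.sum_repr _)
    calc _ = ∑ j ∈ s, ∑ k, (b.repr (v k) j * b j n) • c k := by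
          refine Finset.sum_congr rfl fun j hj => ?_
          rw [coprodπ_mk, if_pos hj, Finset.smul_sum]
          exact Finset.sum_congr rfl fun k _ => by rw [smul_smul, mul_comm]
      _ = _ := by
          rw [Finset.sum_comm]
          exact Finset.sum_congr rfl fun k _ => by rw [← Finset.sum_smul, h2]

variable [HasDerivedCategory.{w} (ModuleCat.{0} R)]

lemma finiteDimensional_hom_of_isSmall {P : DerivedCategory (ModuleCat.{0} R)} (hP : IsSmall P)
    (x : CochainComplex (ModuleCat.{0} R) ℤ) [∀ i, FiniteDimensional K (x.X i)] :
    FiniteDimensional K (P ⟶ Q.obj x) := by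
  classical
  by_contra hne
  let b' := Module.Basis.ofVectorSpace K (P ⟶ Q.obj x)
  have hinf : Infinite (Module.Basis.ofVectorSpaceIndex K (P ⟶ Q.obj x)) := by
    by_contra h
    rw [not_infinite_iff_finite] at h
    exact hne (Module.Finite.of_basis b')
  let e := Infinite.natEmbedding (Module.Basis.ofVectorSpaceIndex K (P ⟶ Q.obj x))
  let b := Module.Basis.ofVectorSpace K (ℕ → K)
  have := quasiIso_scalarMatrix b x
  have hli : LinearIndependent K fun n => b' (e n) := b'.linearIndependent.comp e e.injective
  obtain ⟨s, g, hg⟩ := exists_sum_of_quasiIso (scalarMatrix (fun j => b j) x) hP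
    (fun n => b' (e n))
  have hmem : ∀ n, b' (e n) ∈ Submodule.span K ((s.image g : Finset _) : Set (P ⟶ Q.obj x)) := by
    intro n
    rw [hg n]
    refine Submodule.sum_mem _ fun j hj => ?_
    rw [scalarMatrix_comp, Functor.map_smul, CategoryTheory.Functor.map_id, Linear.comp_smul,
      Category.comp_id]
    exact Submodule.smul_mem _ _ (Submodule.subset_span
      (Finset.mem_coe.2 (Finset.mem_image_of_mem g hj)))
  let W := Submodule.span K ((s.image g : Finset _) : Set (P ⟶ Q.obj x))
  have hli' : LinearIndependent K fun n => (⟨b' (e n), hmem n⟩ : W) :=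
    LinearIndependent.of_comp W.subtype hli
  have : FiniteDimensional K W := inferInstance
  exact not_finite_iff_infinite.2 inferInstance hli'.finite

lemma finiteDimensional_hom_singleFunctor {P : DerivedCategory (ModuleCat.{0} R)}
    (hP : IsSmall P) (n : ℤ) (M : ModuleCat.{0} R) [FiniteDimensional K M] :
    FiniteDimensional K (P ⟶ (singleFunctor (ModuleCat.{0} R) n).obj M) := by
  have : ∀ i, FiniteDimensional K
      (((single (ModuleCat.{0} R) (ComplexShape.up ℤ) n).obj M).X i) := by
    intro i
    by_cases h : i = n
    · subst h
      exact Module.Finite.equiv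
        ((singleObjXSelf (ComplexShape.up ℤ) i M).symm.toLinearEquiv.restrictScalars K)
    · have := ModuleCat.subsingleton_of_isZero (isZero_single_obj_X (ComplexShape.up ℤ) n M i h)
      infer_instance
  exact finiteDimensional_hom_of_isSmall hP ((single (ModuleCat.{0} R) (ComplexShape.up ℤ) n).obj M)

end DerivedCategory

/-- A bounded object: morphisms from a small object to its shifts vanish in almost all
degrees and are finitely generated over the endomorphisms of the small object. -/
def CategoryTheory.IsHomBounded {T : Type*} [Category* T] [Preadditive T] [HasShift T ℤ]
    (X : T) : Prop :=
  ∀ P : T, IsSmall P → (∃ N : ℕ, ∀ i : ℤ, N < i.natAbs → ∀ f : P ⟶ X⟦i⟧, f = 0) ∧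
    ∀ i : ℤ, ∃ (k : ℕ) (h : Fin k → (P ⟶ X⟦i⟧)), ∀ g : P ⟶ X⟦i⟧, ∃ φ : Fin k → (P ⟶ P),
      g = ∑ j, φ j ≫ h j

lemma ModuleCat.subsingleton_of_range_eq_ker {R : Type} [Ring R] {M N P : ModuleCat.{0} R}
    {f : M ⟶ N} {g : N ⟶ P} (h : f.hom.range = g.hom.ker) [Subsingleton M] [Subsingleton P] :
    Subsingleton N := by
  refine subsingleton_of_forall_eq 0 fun y => ?_
  have : y ∈ g.hom.ker := Subsingleton.elim _ _
  rw [← h] at this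
  obtain ⟨x, rfl⟩ := this
  rw [Subsingleton.elim x 0, map_zero]

namespace DerivedCategory

open Pretriangulated HomologySequence

universe w

variable {R : Type} [Ring R] [HasDerivedCategory.{w} (ModuleCat.{0} R)]

/-- Bounded complexes with Noetherian cohomology. -/
def IsBoundedFinite (X : DerivedCategory (ModuleCat.{0} R)) : Prop :=
  (∀ n, IsNoetherian R ((homologyFunctor (ModuleCat.{0} R) n).obj X)) ∧
    ∃ N : ℕ, ∀ n : ℤ, N < n.natAbs → Subsingleton ((homologyFunctor (ModuleCat.{0} R) n).obj X)

lemma IsBoundedFinite.of_iso {X Y : DerivedCategory (ModuleCat.{0} R)} (hX : IsBoundedFinite X)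
    (e : X ≅ Y) : IsBoundedFinite Y := by
  let e' (n : ℤ) := ((homologyFunctor (ModuleCat.{0} R) n).mapIso e).toLinearEquiv
  refine ⟨fun n => ?_, ?_⟩
  · have := hX.1 n
    exact isNoetherian_of_linearEquiv (e' n)
  · obtain ⟨N, hN⟩ := hX.2
    refine ⟨N, fun n hn => ?_⟩
    have := hN n hn
    exact (e' n).symm.toEquiv.subsingleton

/-- Cohomology of a shift. -/
noncomputable def homologyShiftIso (X : DerivedCategory (ModuleCat.{0} R)) (i n m : ℤ)
    (h : i + n = m) : (homologyFunctor (ModuleCat.{0} R) n).obj (X⟦i⟧) ≅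
      (homologyFunctor (ModuleCat.{0} R) m).obj X :=
  ((homologyFunctor (ModuleCat.{0} R) 0).shiftIso i n m h).app X

lemma IsBoundedFinite.shift {X : DerivedCategory (ModuleCat.{0} R)} (hX : IsBoundedFinite X)
    (i : ℤ) : IsBoundedFinite (X⟦i⟧) := by
  refine ⟨fun n => ?_, ?_⟩
  · have := hX.1 (i + n)
    exact isNoetherian_of_linearEquiv (homologyShiftIso X i n _ rfl).symm.toLinearEquiv
  · obtain ⟨N, hN⟩ := hX.2
    refine ⟨N + i.natAbs, fun n hn => ?_⟩
    have := hN (i + n) (by lia)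
    exact (homologyShiftIso X i n _ rfl).toLinearEquiv.toEquiv.subsingleton

section

variable {T : Triangle (DerivedCategory (ModuleCat.{0} R))}

lemma range_eq_ker₂ (hT : T ∈ distTriang _) (n : ℤ) :
    ((homologyFunctor (ModuleCat.{0} R) n).map T.mor₁).hom.range =
    ((homologyFunctor (ModuleCat.{0} R) n).map T.mor₂).hom.ker :=
  (exact₂ T hT n).moduleCat_range_eq_ker

lemma range_eq_ker₃ (hT : T ∈ distTriang _) (n m : ℤ) (h : n + 1 = m) :
    ((homologyFunctor (ModuleCat.{0} R) n).map T.mor₂).hom.range = (δ T n m h).hom.ker :=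
  (exact₃ T hT n m h).moduleCat_range_eq_ker

lemma range_eq_ker₁ (hT : T ∈ distTriang _) (n m : ℤ) (h : n + 1 = m) :
    (δ T n m h).hom.range = ((homologyFunctor (ModuleCat.{0} R) m).map T.mor₁).hom.ker :=
  (exact₁ T hT n m h).moduleCat_range_eq_ker

lemma IsBoundedFinite.of_distTriang (hT : T ∈ distTriang _) (h₁ : IsBoundedFinite T.obj₁)
    (h₃ : IsBoundedFinite T.obj₃) : IsBoundedFinite T.obj₂ := by
  refine ⟨fun n => ?_, ?_⟩
  · have := h₁.1 n
    have := h₃.1 n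
    exact isNoetherian_of_range_eq_ker _ _ (range_eq_ker₂ hT n)
  · obtain ⟨N₁, hN₁⟩ := h₁.2
    obtain ⟨N₃, hN₃⟩ := h₃.2
    refine ⟨max N₁ N₃, fun n hn => ?_⟩
    have := hN₁ n (by lia)
    have := hN₃ n (by lia)
    exact ModuleCat.subsingleton_of_range_eq_ker (range_eq_ker₂ hT n)

end

lemma homology_singleFunctor (n : ℤ) (M : ModuleCat.{0} R) :
    Nonempty ((homologyFunctor (ModuleCat.{0} R) n).obj ((singleFunctor (ModuleCat.{0} R) n).obj M)
      ≅ M) :=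
  ⟨(singleFunctorCompHomologyFunctorIso (ModuleCat.{0} R) n).app M⟩

lemma subsingleton_homology_singleFunctor {n m : ℤ} (h : m ≠ n) (M : ModuleCat.{0} R) :
    Subsingleton
      ((homologyFunctor (ModuleCat.{0} R) m).obj ((singleFunctor (ModuleCat.{0} R) n).obj M)) := by
  rcases lt_or_gt_of_ne h with h | h
  · exact ModuleCat.subsingleton_of_isZero (isZero_of_isGE _ n m h)
  · exact ModuleCat.subsingleton_of_isZero (isZero_of_isLE _ n m h)

lemma isBoundedFinite_singleFunctor (n : ℤ) (M : ModuleCat.{0} R) [IsNoetherian R M] :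
    IsBoundedFinite ((singleFunctor (ModuleCat.{0} R) n).obj M) := by
  refine ⟨fun m => ?_, n.natAbs, fun m hm => ?_⟩
  · by_cases h : m = n
    · subst h
      exact isNoetherian_of_linearEquiv (homology_singleFunctor m M).some.symm.toLinearEquiv
    · have := subsingleton_homology_singleFunctor h M
      infer_instance
  · exact subsingleton_homology_singleFunctor (by rintro rfl; exact hm.false) M

/-- Dévissage for bounded complexes with Noetherian cohomology. -/
lemma IsBoundedFinite.induction (p : DerivedCategory (ModuleCat.{0} R) → Prop)
    (iso : ∀ X Y : DerivedCategory (ModuleCat.{0} R), (X ≅ Y) → p X → p Y)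
    (single : ∀ n (M : ModuleCat.{0} R), IsNoetherian R M →
      p ((singleFunctor (ModuleCat.{0} R) n).obj M))
    (ext : ∀ T ∈ distTriang (DerivedCategory (ModuleCat.{0} R)), IsBoundedFinite T.obj₁ →
      IsBoundedFinite T.obj₃ → p T.obj₁ → p T.obj₃ → p T.obj₂)
    {X : DerivedCategory (ModuleCat.{0} R)} (hX : IsBoundedFinite X) : p X := by
  have key : ∀ (k : ℕ) (a : ℤ) (X : DerivedCategory (ModuleCat.{0} R)), IsBoundedFinite X →
      X.IsGE a → X.IsLE (a + k) → p X := by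
    intro k
    induction k with
    | zero =>
      intro a X hX h1 h2
      rw [Nat.cast_zero, add_zero] at h2
      obtain ⟨M, ⟨e⟩⟩ := exists_iso_singleFunctor_obj_of_isGE_of_isLE X a
      refine iso _ _ e.symm (single a M ?_)
      have := (hX.of_iso e).1 a
      exact isNoetherian_of_linearEquiv (homology_singleFunctor a M).some.toLinearEquiv
    | succ k ih =>
      intro a X hX h1 h2
      obtain ⟨Y, Z, hY, hZ, f, g, h, hT⟩ := TStructure.t.exists_triangle X a (a + 1) rfl
      have hY : Y.IsLE a := ⟨hY⟩
      have hZ : Z.IsGE (a + 1) := ⟨hZ⟩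
      have hY' : Y.IsGE a := by
        rw [isGE_iff]
        intro i hi
        have h3 : Subsingleton ((homologyFunctor (ModuleCat.{0} R) i).obj
            (Triangle.mk f g h).obj₂) :=
          ModuleCat.subsingleton_of_isZero (X.isZero_of_isGE a i hi)
        have h4 : Subsingleton ((homologyFunctor (ModuleCat.{0} R) (i - 1)).obj
            (Triangle.mk f g h).obj₃) :=
          ModuleCat.subsingleton_of_isZero (Z.isZero_of_isGE (a + 1) (i - 1) (by lia))
        rw [ModuleCat.isZero_iff_subsingleton]
        exact ModuleCat.subsingleton_of_range_eq_ker (range_eq_ker₁ hT (i - 1) i (by lia))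
      have hZ' : Z.IsLE (a + (k + 1 : ℕ)) := by
        rw [isLE_iff]
        intro i hi
        have h3 : Subsingleton ((homologyFunctor (ModuleCat.{0} R) i).obj
            (Triangle.mk f g h).obj₂) :=
          ModuleCat.subsingleton_of_isZero (X.isZero_of_isLE (a + (k + 1 : ℕ)) i hi)
        have h4 : Subsingleton ((homologyFunctor (ModuleCat.{0} R) (i + 1)).obj
            (Triangle.mk f g h).obj₁) :=
          ModuleCat.subsingleton_of_isZero (Y.isZero_of_isLE a (i + 1) (by lia))
        rw [ModuleCat.isZero_iff_subsingleton]
        exact ModuleCat.subsingleton_of_range_eq_ker (range_eq_ker₃ hT i (i + 1) rfl)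
      have hYf : IsBoundedFinite Y := by
        refine ⟨fun n => ?_, a.natAbs, fun n hn => ?_⟩
        · by_cases hn : n = a
          · have h4 : Subsingleton ((homologyFunctor (ModuleCat.{0} R) (n - 1)).obj
                (Triangle.mk f g h).obj₃) :=
              ModuleCat.subsingleton_of_isZero (Z.isZero_of_isGE (a + 1) (n - 1) (by lia))
            have h5 : IsNoetherian R ((homologyFunctor (ModuleCat.{0} R) n).obj
                (Triangle.mk f g h).obj₂) := hX.1 n
            exact isNoetherian_of_range_eq_ker _ _ (range_eq_ker₁ hT (n - 1) n (by lia))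
          · rcases lt_or_gt_of_ne hn with h | h
            · have := ModuleCat.subsingleton_of_isZero (Y.isZero_of_isGE a n h)
              infer_instance
            · have := ModuleCat.subsingleton_of_isZero (Y.isZero_of_isLE a n h)
              infer_instance
        · rcases lt_or_gt_of_ne (show n ≠ a by rintro rfl; exact hn.false) with h | h
          · exact ModuleCat.subsingleton_of_isZero (Y.isZero_of_isGE a n h)
          · exact ModuleCat.subsingleton_of_isZero (Y.isZero_of_isLE a n h)
      have hZf : IsBoundedFinite Z :=
        IsBoundedFinite.of_distTriang (rot_of_distTriang _ hT) hX (hYf.shift 1)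
      refine ext _ hT hYf hZf ?_ ?_
      · exact ih a Y hYf hY' (by
          rw [isLE_iff]
          exact fun i hi => Y.isZero_of_isLE a i (by lia))
      · exact ih (a + 1) Z hZf hZ (by
          rw [add_assoc, add_comm (1 : ℤ)]
          exact_mod_cast hZ')
  obtain ⟨N, hN⟩ := hX.2
  refine key (2 * N) (-N) X hX ?_ ?_
  · rw [isGE_iff]
    intro i hi
    have := hN i (by lia)
    exact ModuleCat.isZero_of_subsingleton _
  · rw [isLE_iff]
    intro i hi
    have := hN i (by push_cast at hi; lia)
    exact ModuleCat.isZero_of_subsingleton _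

end DerivedCategory

namespace DerivedCategory

open Pretriangulated
open scoped ModuleCat

universe w

variable {R : Type} [Ring R]

lemma finiteDimensional_of_isNoetherian (K : Type) [Field K] [Algebra K R] [FiniteDimensional K R]
    (M : ModuleCat.{0} R) [IsNoetherian R M] : FiniteDimensional K M :=
  Module.Finite.trans R M

variable [HasDerivedCategory.{w} (ModuleCat.{0} R)]

/-- Shifting an object concentrated in a single degree. -/
noncomputable def singleShiftIso (M : ModuleCat.{0} R) (i n m : ℤ) (h : i + m = n) :
    ((singleFunctor (ModuleCat.{0} R) n).obj M)⟦i⟧ ≅ (singleFunctor (ModuleCat.{0} R) m).obj M :=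
  ((singleFunctors (ModuleCat.{0} R)).shiftIso i m n h).app M

lemma IsBoundedFinite.isHomBounded (K : Type) [Field K] [Algebra K R] [FiniteDimensional K R]
    {X : DerivedCategory (ModuleCat.{0} R)} (hX : IsBoundedFinite X) : IsHomBounded X := by
  intro P hP
  suffices (∃ N : ℕ, ∀ i : ℤ, N < i.natAbs → ∀ f : P ⟶ X⟦i⟧, f = 0) ∧
      ∀ i : ℤ, FiniteDimensional K (P ⟶ X⟦i⟧) by
    refine ⟨this.1, fun i => ?_⟩
    have := this.2 i
    let b := Module.finBasis K (P ⟶ X⟦i⟧)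
    refine ⟨_, b, fun g => ⟨fun j => b.repr g j • 𝟙 P, ?_⟩⟩
    refine (b.sum_repr g).symm.trans (Finset.sum_congr rfl fun j _ => ?_)
    rw [Linear.smul_comp, Category.id_comp]
  refine hX.induction (fun X => (∃ N : ℕ, ∀ i : ℤ, N < i.natAbs → ∀ f : P ⟶ X⟦i⟧, f = 0) ∧
      ∀ i : ℤ, FiniteDimensional K (P ⟶ X⟦i⟧)) ?_ ?_ ?_
  · rintro X Y e ⟨⟨N, hN⟩, h⟩
    refine ⟨⟨N, fun i hi f => ?_⟩, fun i => ?_⟩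
    · rw [← cancel_mono ((shiftFunctor _ i).map e.inv), hN i hi (f ≫ _), Limits.zero_comp]
    · have := h i
      exact Module.Finite.equiv
        (Linear.homCongr K (Iso.refl P) ((shiftFunctor _ i).mapIso e))
  · intro n M hM
    obtain ⟨N, hN⟩ := exists_bound_of_isSmall hP
    refine ⟨⟨N + n.natAbs, fun i hi f => ?_⟩, fun i => ?_⟩
    · rw [← cancel_mono (singleShiftIso M i n (n - i) (by lia)).hom, Limits.zero_comp]
      exact hN _ (by lia) _ _
    · have := finiteDimensional_of_isNoetherian K M
      have := finiteDimensional_hom_singleFunctor (K := K) hP (n - i) M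
      exact Module.Finite.equiv
        (Linear.homCongr K (Iso.refl P) (singleShiftIso M i n (n - i) (by lia)).symm)
  · rintro T hT - - ⟨⟨N₁, hN₁⟩, h₁⟩ ⟨⟨N₃, hN₃⟩, h₃⟩
    have ex (i : ℤ) := Triangle.coyoneda_exact₂ _ (Triangle.shift_distinguished _ hT i) (X := P)
    refine ⟨⟨max N₁ N₃, fun i hi f => ?_⟩, fun i => ?_⟩
    · obtain ⟨g, rfl⟩ := ex i f (hN₃ i (by lia) _)
      exact (congrArg (· ≫ _) (hN₁ i (by lia) g)).trans Limits.zero_comp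
    · have := h₁ i
      have := h₃ i
      let T' := (shiftFunctor (Triangle (DerivedCategory (ModuleCat.{0} R))) i).obj T
      have hT' : T' ∈ distTriang _ := Triangle.shift_distinguished _ hT i
      let F₁ : (P ⟶ T.obj₁⟦i⟧) →ₗ[K] (P ⟶ T.obj₂⟦i⟧) := Linear.rightComp K P T'.mor₁
      let F₂ : (P ⟶ T.obj₂⟦i⟧) →ₗ[K] (P ⟶ T.obj₃⟦i⟧) := Linear.rightComp K P T'.mor₂
      have h : F₁.range = F₂.ker := by
        ext f
        refine ⟨?_, fun hf => ?_⟩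
        · rintro ⟨g, rfl⟩
          exact (Category.assoc _ _ _).trans
            ((congrArg (g ≫ ·) (comp_distTriang_mor_zero₁₂ _ hT')).trans Limits.comp_zero)
        · obtain ⟨g, hg⟩ := ex i f hf
          exact ⟨g, hg.symm⟩
      have := isNoetherian_of_range_eq_ker F₁ F₂ h
      infer_instance

lemma isBoundedFinite_of_isHomBounded [IsNoetherianRing R]
    {X : DerivedCategory (ModuleCat.{0} R)} (hX : IsHomBounded X) : IsBoundedFinite X := by
  let A := ModuleCat.of R R
  let P := (singleFunctor (ModuleCat.{0} R) 0).obj A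
  have hA : Projective A := by
    rw [← IsProjective.iff_projective]
    infer_instance
  have : Module.Finite R A := inferInstanceAs (Module.Finite R R)
  obtain ⟨⟨N, hN⟩, hfin⟩ := hX P (isSmall_singleFunctor_of_projective 0 A)
  have key : ∀ (i : ℤ) (c : (homologyFunctor (ModuleCat.{0} R) 0).obj (X⟦i⟧)),
      ∃ (f : P ⟶ X⟦i⟧) (a : (homologyFunctor (ModuleCat.{0} R) 0).obj P),
        (homologyFunctor (ModuleCat.{0} R) 0).map f a = c := by
    intro i c
    obtain ⟨f, u, hu⟩ := exists_lift_homology 0 A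
      (ModuleCat.ofHom (LinearMap.toSpanSingleton R _ c))
    refine ⟨f, u (1 : R), ?_⟩
    refine (ConcreteCategory.congr_hom hu (1 : R)).trans ?_
    exact one_smul R c
  refine ⟨fun i => ?_, N, fun i hi => ?_⟩
  · obtain ⟨k, h, hk⟩ := hfin i
    have hP : IsNoetherian R ((homologyFunctor (ModuleCat.{0} R) 0).obj P) :=
      (isBoundedFinite_singleFunctor 0 A).1 0
    suffices hY : Module.Finite R ((homologyFunctor (ModuleCat.{0} R) 0).obj (X⟦i⟧)) by
      have := isNoetherian_of_isNoetherianRing_of_finite R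
        ((homologyFunctor (ModuleCat.{0} R) 0).obj (X⟦i⟧))
      exact isNoetherian_of_linearEquiv (homologyShiftIso X i 0 i (by lia)).toLinearEquiv
    let H (j : Fin k) := ((homologyFunctor (ModuleCat.{0} R) 0).map (h j)).hom.range
    have hH : ∀ j, (H j).FG := fun j => by
      simp only [H]
      rw [LinearMap.range_eq_map]
      exact Submodule.FG.map _ (IsNoetherian.noetherian _)
    refine ⟨(?_ : ⨆ j, H j = ⊤) ▸ Submodule.fg_iSup _ hH⟩
    rw [eq_top_iff]
    rintro c -
    obtain ⟨f, a, rfl⟩ := key i c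
    obtain ⟨φ, rfl⟩ := hk f
    rw [Functor.map_sum, CochainComplex.Elements.sum_hom_apply]
    refine Submodule.sum_mem _ fun j _ => Submodule.mem_iSup_of_mem j ?_
    rw [Functor.map_comp]
    exact ⟨(homologyFunctor (ModuleCat.{0} R) 0).map (φ j) a, rfl⟩
  · have : Subsingleton ((homologyFunctor (ModuleCat.{0} R) 0).obj (X⟦i⟧)) := by
      refine subsingleton_of_forall_eq 0 fun c => ?_
      obtain ⟨f, a, rfl⟩ := key i c
      rw [hN i hi f, Functor.map_zero]
      rfl
    exact (homologyShiftIso X i 0 i (by lia)).symm.toLinearEquiv.toEquiv.subsingleton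

end DerivedCategory

namespace CategoryTheory

open Limits Pretriangulated

section Equivalence

universe v₁ v₂ u₁ u₂

variable {T : Type u₁} {T' : Type u₂} [Category.{v₁} T] [Category.{v₂} T'] [Preadditive T]
  [Preadditive T']

lemma IsSmall.of_iso {P P' : T} (hP : IsSmall P) (e : P ≅ P') : IsSmall P' := by
  intro J X
  obtain ⟨S, ι, hS, h⟩ := hP J X
  refine ⟨S, ι, hS, fun f => ?_⟩
  obtain ⟨s, g, hg⟩ := h (e.hom ≫ f)
  refine ⟨s, fun j => e.inv ≫ g j, ?_⟩
  rw [← cancel_epi e.hom, hg, Preadditive.comp_sum]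
  simp

lemma IsSmall.map {P : T} (hP : IsSmall P) (F : T ⥤ T') [F.IsEquivalence] [F.Additive] :
    IsSmall (F.obj P) := by
  intro J X
  obtain ⟨S, ι, hS, h⟩ := hP J fun j => F.objPreimage (X j)
  refine ⟨F.obj S, fun j => (F.objObjPreimageIso (X j)).inv ≫ F.map (ι j), fun Y g => ?_,
    fun f => ?_⟩
  · obtain ⟨u, hu⟩ := hS (F.objPreimage Y) fun j =>
      F.preimage ((F.objObjPreimageIso (X j)).hom ≫ g j ≫ (F.objObjPreimageIso Y).inv)
    refine ⟨F.map u ≫ (F.objObjPreimageIso Y).hom, fun j => ?_⟩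
    rw [Category.assoc, ← F.map_comp_assoc, hu]
    simp
  · obtain ⟨s, g, hg⟩ := h (F.preimage f)
    refine ⟨s, fun j => F.map (g j) ≫ (F.objObjPreimageIso (X j)).hom, ?_⟩
    rw [← F.map_preimage f, hg, F.map_sum]
    simp

lemma isSmall_obj_iff (F : T ⥤ T') [F.IsEquivalence] [F.Additive] (P : T) :
    IsSmall (F.obj P) ↔ IsSmall P :=
  have : F.asEquivalence.functor.Additive := inferInstanceAs F.Additive
  have : F.inv.Additive := F.asEquivalence.inverse_additive
  ⟨fun h => (h.map F.inv).of_iso (F.asEquivalence.unitIso.app P).symm, fun h => h.map F⟩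

variable [HasShift T ℤ] [HasShift T' ℤ]

lemma IsHomBounded.of_iso {X Y : T} (hX : IsHomBounded X) (e : X ≅ Y) : IsHomBounded Y := by
  intro P hP
  obtain ⟨⟨N, hN⟩, h⟩ := hX P hP
  let c (i : ℤ) : X⟦i⟧ ≅ Y⟦i⟧ := (shiftFunctor T i).mapIso e
  refine ⟨⟨N, fun i hi f => ?_⟩, fun i => ?_⟩
  · rw [← cancel_mono (c i).inv, hN i hi (f ≫ _), Limits.zero_comp]
  · obtain ⟨k, h, hk⟩ := h i
    refine ⟨k, fun j => h j ≫ (c i).hom, fun g => ?_⟩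
    obtain ⟨φ, hφ⟩ := hk (g ≫ (c i).inv)
    refine ⟨φ, ?_⟩
    rw [← cancel_mono (c i).inv, hφ, Preadditive.sum_comp]
    simp

lemma isHomBounded_obj_iff (F : T ⥤ T') [F.IsEquivalence] [F.Additive] [F.CommShift ℤ] (X : T) :
    IsHomBounded (F.obj X) ↔ IsHomBounded X := by
  let c (i : ℤ) : F.obj (X⟦i⟧) ≅ (F.obj X)⟦i⟧ := (F.commShiftIso i).app X
  constructor
  · intro h P hP
    obtain ⟨⟨N, hN⟩, h⟩ := h (F.obj P) ((isSmall_obj_iff F P).2 hP)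
    refine ⟨⟨N, fun i hi f => F.map_injective ?_⟩, fun i => ?_⟩
    · rw [← cancel_mono (c i).hom, hN i hi (F.map f ≫ _), F.map_zero, zero_comp]
    · obtain ⟨k, h, hk⟩ := h i
      refine ⟨k, fun j => F.preimage (h j ≫ (c i).inv), fun g => ?_⟩
      obtain ⟨φ, hφ⟩ := hk (F.map g ≫ (c i).hom)
      refine ⟨fun j => F.preimage (φ j), F.map_injective ?_⟩
      rw [← cancel_mono (c i).hom, hφ, F.map_sum, Preadditive.sum_comp]
      simp
  · intro h P' hP'
    let P := F.objPreimage P'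
    let e : F.obj P ≅ P' := F.objObjPreimageIso P'
    obtain ⟨⟨N, hN⟩, h⟩ := h P ((isSmall_obj_iff F P).1 (hP'.of_iso e.symm))
    refine ⟨⟨N, fun i hi f => ?_⟩, fun i => ?_⟩
    · rw [← cancel_epi e.hom, ← cancel_mono (c i).inv, ← F.map_preimage ((e.hom ≫ f) ≫ (c i).inv),
        hN i hi (F.preimage _)]
      simp
    · obtain ⟨k, h, hk⟩ := h i
      refine ⟨k, fun j => e.inv ≫ F.map (h j) ≫ (c i).hom, fun g => ?_⟩
      obtain ⟨φ, hφ⟩ := hk (F.preimage (e.hom ≫ g ≫ (c i).inv))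
      refine ⟨fun j => e.inv ≫ F.map (φ j) ≫ e.hom, ?_⟩
      have h1 := congrArg F.map hφ
      rw [F.map_preimage, F.map_sum] at h1
      rw [← cancel_epi e.hom, ← cancel_mono (c i).inv, Category.assoc, h1, Preadditive.comp_sum,
        Preadditive.sum_comp]
      simp

end Equivalence

section

universe v₁ v₂ u₁ u₂

/-- Additive functions on the bounded objects of a triangulated category which vanish on small
objects. -/
def additiveFunctions (F : Type) [Field F] (T : Type u₁) [Category.{v₁} T] [Preadditive T]
    [HasZeroObject T] [HasShift T ℤ] [∀ n : ℤ, (shiftFunctor T n).Additive] [Pretriangulated T] :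
    Submodule F (T → F) where
  carrier := {f | (∀ X Y : T, (X ≅ Y) → f X = f Y) ∧
    (∀ S ∈ distTriang T, IsHomBounded S.obj₁ → IsHomBounded S.obj₂ → IsHomBounded S.obj₃ →
      f S.obj₂ = f S.obj₁ + f S.obj₃) ∧ (∀ X : T, ¬ IsHomBounded X → f X = 0) ∧
    ∀ X : T, IsHomBounded X → IsSmall X → f X = 0}
  add_mem' := by
    rintro f g ⟨a, b, c, d⟩ ⟨a', b', c', d'⟩
    refine ⟨fun X Y e => ?_, fun S hS h₁ h₂ h₃ => ?_, fun X hX => ?_, fun X hX hX' => ?_⟩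
    · simp only [Pi.add_apply, a X Y e, a' X Y e]
    · simp only [Pi.add_apply, b S hS h₁ h₂ h₃, b' S hS h₁ h₂ h₃]
      ring
    · simp only [Pi.add_apply, c X hX, c' X hX, add_zero]
    · simp only [Pi.add_apply, d X hX hX', d' X hX hX', add_zero]
  zero_mem' := by simp
  smul_mem' := by
    rintro r f ⟨a, b, c, d⟩
    refine ⟨fun X Y e => ?_, fun S hS h₁ h₂ h₃ => ?_, fun X hX => ?_, fun X hX hX' => ?_⟩
    · simp only [Pi.smul_apply, a X Y e]
    · simp only [Pi.smul_apply, b S hS h₁ h₂ h₃, smul_add]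
    · simp only [Pi.smul_apply, c X hX, smul_zero]
    · simp only [Pi.smul_apply, d X hX hX', smul_zero]

lemma finrank_additiveFunctions_le (F : Type) [Field F] {T : Type u₁} {T' : Type u₂}
    [Category.{v₁} T] [Preadditive T] [HasZeroObject T] [HasShift T ℤ]
    [∀ n : ℤ, (shiftFunctor T n).Additive] [Pretriangulated T] [Category.{v₂} T'] [Preadditive T']
    [HasZeroObject T'] [HasShift T' ℤ] [∀ n : ℤ, (shiftFunctor T' n).Additive]
    [Pretriangulated T'] [FiniteDimensional F (additiveFunctions F T)] (G : T ⥤ T')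
    [G.IsEquivalence] [G.CommShift ℤ] [G.IsTriangulated] :
    Module.finrank F (additiveFunctions F T') ≤ Module.finrank F (additiveFunctions F T) := by
  have hmem : ∀ f ∈ additiveFunctions F T', LinearMap.funLeft F F G.obj f ∈
      additiveFunctions F T := by
    rintro f ⟨a, b, c, d⟩
    refine ⟨fun X Y e => a _ _ (G.mapIso e), fun S hS h₁ h₂ h₃ => ?_, fun X hX => ?_,
      fun X hX hX' => ?_⟩
    · exact b _ (G.map_distinguished S hS) ((isHomBounded_obj_iff G _).2 h₁)
        ((isHomBounded_obj_iff G _).2 h₂) ((isHomBounded_obj_iff G _).2 h₃)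
    · exact c _ (mt (isHomBounded_obj_iff G _).1 hX)
    · exact d _ ((isHomBounded_obj_iff G _).2 hX) ((isSmall_obj_iff G _).2 hX')
  refine LinearMap.finrank_le_finrank_of_injective
    (f := (LinearMap.funLeft F F G.obj).restrict hmem) ?_
  rintro ⟨f, hf⟩ ⟨g, hg⟩ h
  refine Subtype.ext (funext fun Y => ?_)
  have := congrFun (congrArg Subtype.val h) (G.objPreimage Y)
  exact (hf.1 _ _ (G.objObjPreimageIso Y)).symm.trans
    (this.trans (hg.1 _ _ (G.objObjPreimageIso Y)))

end

end CategoryTheory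

/-- Additive functions on Noetherian modules which vanish on projective modules. -/
def ModuleCat.additiveFunctions (F : Type) [Field F] (R : Type) [Ring R] :
    Submodule F (ModuleCat.{0} R → F) where
  carrier := {f | (∀ M N : ModuleCat.{0} R, (M ≅ N) → f M = f N) ∧
    (∀ (M : ModuleCat.{0} R) (N : Submodule R M), IsNoetherian R M →
      f M = f (.of R N) + f (.of R (M ⧸ N))) ∧
    (∀ M : ModuleCat.{0} R, ¬ IsNoetherian R M → f M = 0) ∧
    ∀ M : ModuleCat.{0} R, IsNoetherian R M → Projective M → f M = 0}
  add_mem' := by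
    rintro f g ⟨a, b, c, d⟩ ⟨a', b', c', d'⟩
    refine ⟨fun X Y e => ?_, fun M N h => ?_, fun X hX => ?_, fun X hX hX' => ?_⟩
    · simp only [Pi.add_apply, a X Y e, a' X Y e]
    · simp only [Pi.add_apply, b M N h, b' M N h]
      ring
    · simp only [Pi.add_apply, c X hX, c' X hX, add_zero]
    · simp only [Pi.add_apply, d X hX hX', d' X hX hX', add_zero]
  zero_mem' := by simp
  smul_mem' := by
    rintro r f ⟨a, b, c, d⟩
    refine ⟨fun X Y e => ?_, fun M N h => ?_, fun X hX => ?_, fun X hX hX' => ?_⟩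
    · simp only [Pi.smul_apply, a X Y e]
    · simp only [Pi.smul_apply, b M N h, smul_add]
    · simp only [Pi.smul_apply, c X hX, smul_zero]
    · simp only [Pi.smul_apply, d X hX hX', smul_zero]

namespace DerivedCategory

open Pretriangulated
open scoped ZeroObject

universe w

variable {F : Type} [Field F] {R : Type} [Ring R] [HasDerivedCategory.{w} (ModuleCat.{0} R)]

section

variable {f : DerivedCategory (ModuleCat.{0} R) → F}

lemma additiveFunctions_triangle (K : Type) [Field K] [Algebra K R] [FiniteDimensional K R]
    (hf : f ∈ CategoryTheory.additiveFunctions F (DerivedCategory (ModuleCat.{0} R)))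
    {T : Triangle (DerivedCategory (ModuleCat.{0} R))}
    (hT : T ∈ distTriang _) (h₁ : IsBoundedFinite T.obj₁) (h₃ : IsBoundedFinite T.obj₃) :
    f T.obj₂ = f T.obj₁ + f T.obj₃ :=
  hf.2.1 T hT (h₁.isHomBounded K) ((h₁.of_distTriang hT h₃).isHomBounded K) (h₃.isHomBounded K)

lemma additiveFunctions_shift (K : Type) [Field K] [Algebra K R] [FiniteDimensional K R]
    (hf : f ∈ CategoryTheory.additiveFunctions F (DerivedCategory (ModuleCat.{0} R)))
    {X : DerivedCategory (ModuleCat.{0} R)} (hX : IsBoundedFinite X) :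
    f X + f (X⟦(1 : ℤ)⟧) = 0 := by
  have h0 : IsBoundedFinite (0 : DerivedCategory (ModuleCat.{0} R)) := by
    have h : ∀ n, Subsingleton ((homologyFunctor (ModuleCat.{0} R) n).obj
        (0 : DerivedCategory (ModuleCat.{0} R))) := fun n =>
      ModuleCat.subsingleton_of_isZero (Functor.map_isZero _ (Limits.isZero_zero _))
    exact ⟨fun n => have := h n; inferInstance, 0, fun n _ => h n⟩
  have h1 := additiveFunctions_triangle K hf
    (contractible_distinguished₁ (0 : DerivedCategory (ModuleCat.{0} R))) h0 h0
  have h2 := additiveFunctions_triangle K hf (contractible_distinguished₂ X) hX (hX.shift 1)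
  have h1' : f 0 = f 0 + f 0 := h1
  have h2' : f 0 = f X + f (X⟦(1 : ℤ)⟧) := h2
  rw [← h2', left_eq_add.1 h1']

lemma additiveFunctions_eq_zero (K : Type) [Field K] [Algebra K R] [FiniteDimensional K R]
    (hf : f ∈ CategoryTheory.additiveFunctions F (DerivedCategory (ModuleCat.{0} R)))
    (h : ∀ M : ModuleCat.{0} R, f ((singleFunctor (ModuleCat.{0} R) 0).obj M) = 0) : f = 0 := by
  have hs : ∀ (M : ModuleCat.{0} R) (_ : IsNoetherian R M) (n : ℤ),
      f ((singleFunctor (ModuleCat.{0} R) n).obj M) = 0 := by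
    intro M hM n
    have key : ∀ m : ℤ, f ((singleFunctor (ModuleCat.{0} R) (m + 1)).obj M) +
        f ((singleFunctor (ModuleCat.{0} R) m).obj M) = 0 := fun m => by
      rw [← hf.1 _ _ (singleShiftIso M 1 (m + 1) m (add_comm _ _))]
      exact additiveFunctions_shift K hf (isBoundedFinite_singleFunctor _ M)
    induction n with
    | zero => exact h M
    | succ i hi => simpa [hi] using key i
    | pred i hi => simpa [hi] using key (-i - 1)
  funext X
  by_cases hX : IsHomBounded X
  · have : IsNoetherianRing R :=
      isNoetherianRing_iff.2 (isNoetherian_of_tower K inferInstance)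
    refine (isBoundedFinite_of_isHomBounded hX).induction (fun X => f X = 0)
      (fun X Y e hX => (hf.1 X Y e).symm.trans hX) (fun n M hM => hs M hM n) ?_
    intro T hT h₁ h₃ h h'
    rw [additiveFunctions_triangle K hf hT h₁ h₃, h, h', add_zero]
  · exact hf.2.2.1 X hX

lemma additiveFunctions_restrict (K : Type) [Field K] [Algebra K R] [FiniteDimensional K R]
    (hf : f ∈ CategoryTheory.additiveFunctions F (DerivedCategory (ModuleCat.{0} R))) :
    (fun M => f ((singleFunctor (ModuleCat.{0} R) 0).obj M)) ∈
      ModuleCat.additiveFunctions F R := by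
  have hR : IsNoetherianRing R :=
      isNoetherianRing_iff.2 (isNoetherian_of_tower K inferInstance)
  refine ⟨fun M N e => hf.1 _ _ ((singleFunctor _ 0).mapIso e), fun M N hM => ?_,
    fun M hM => hf.2.2.1 _ fun h => hM ?_, fun M hM hP => ?_⟩
  · have hS : (ShortComplex.mk (ModuleCat.ofHom N.subtype) (ModuleCat.ofHom N.mkQ)
        (by ext; simp)).ShortExact := by
      have : Mono (ModuleCat.ofHom N.subtype) :=
        (ModuleCat.mono_iff_injective _).2 N.injective_subtype
      have : Epi (ModuleCat.ofHom N.mkQ) :=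
        (ModuleCat.epi_iff_surjective _).2 N.mkQ_surjective
      exact ⟨ShortComplex.Exact.moduleCat_of_range_eq_ker _ _ (by simp)⟩
    have : IsNoetherian R (ModuleCat.of R N) := inferInstanceAs (IsNoetherian R N)
    have : IsNoetherian R (ModuleCat.of R (M ⧸ N)) := inferInstanceAs (IsNoetherian R (M ⧸ N))
    exact additiveFunctions_triangle K hf hS.singleTriangle_distinguished
      (isBoundedFinite_singleFunctor 0 (ModuleCat.of R N))
      (isBoundedFinite_singleFunctor 0 (ModuleCat.of R (M ⧸ N)))
  · have := (isBoundedFinite_of_isHomBounded h).1 0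
    exact isNoetherian_of_linearEquiv (homology_singleFunctor 0 M).some.toLinearEquiv
  · exact hf.2.2.2 _ ((isBoundedFinite_singleFunctor 0 M).isHomBounded K)
      (isSmall_singleFunctor_of_projective 0 M)

end

variable (F R) in
/-- Restriction of additive functions to modules. -/
noncomputable def restrictAdditiveFunctions (K : Type) [Field K] [Algebra K R]
    [FiniteDimensional K R] :
    CategoryTheory.additiveFunctions F (DerivedCategory (ModuleCat.{0} R)) →ₗ[F]
      ModuleCat.additiveFunctions F R :=
  (LinearMap.funLeft F F (singleFunctor (ModuleCat.{0} R) 0).obj).restrict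
    fun _ hf => additiveFunctions_restrict K hf

lemma restrictAdditiveFunctions_injective (K : Type) [Field K] [Algebra K R]
    [FiniteDimensional K R] :
    Function.Injective (restrictAdditiveFunctions F R K) := by
  refine (injective_iff_map_eq_zero _).2 fun f hf => Subtype.ext ?_
  exact additiveFunctions_eq_zero K f.2 fun M => congrFun (congrArg Subtype.val hf) M

end DerivedCategory

namespace ModuleCat

variable {F : Type} [Field F] {R : Type} [Ring R] {f : ModuleCat.{0} R → F}

lemma additiveFunctions_of_subsingleton (hf : f ∈ additiveFunctions F R) (M : ModuleCat.{0} R)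
    [Subsingleton M] : f M = 0 :=
  hf.2.2.2 M inferInstance (Limits.IsZero.projective (isZero_of_subsingleton M))

lemma additiveFunctions_ker_range (hf : f ∈ additiveFunctions F R) {M N : ModuleCat.{0} R}
    (g : M ⟶ N) [h : IsNoetherian R M] :
    f M = f (.of R g.hom.ker) + f (.of R g.hom.range) := by
  rw [hf.2.1 M g.hom.ker h, hf.1 _ _ g.hom.quotKerEquivRange.toModuleIso]

end ModuleCat

namespace DerivedCategory

open Pretriangulated HomologySequence

universe w

variable {F : Type} [Field F] {R : Type} [Ring R] [HasDerivedCategory.{w} (ModuleCat.{0} R)]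

/-- The Euler characteristic of the cohomology of a complex with respect to a function on
modules. -/
noncomputable def eulerChar (f : ModuleCat.{0} R → F) (X : DerivedCategory (ModuleCat.{0} R)) :
    F :=
  ∑ᶠ n : ℤ, ((n.negOnePow : ℤ) : F) * f ((homologyFunctor (ModuleCat.{0} R) n).obj X)

variable {f : ModuleCat.{0} R → F}

lemma eulerChar_of_iso (hf : f ∈ ModuleCat.additiveFunctions F R)
    {X Y : DerivedCategory (ModuleCat.{0} R)} (e : X ≅ Y) : eulerChar f X = eulerChar f Y :=
  finsum_congr fun n => by rw [hf.1 _ _ ((homologyFunctor (ModuleCat.{0} R) n).mapIso e)]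

lemma eulerChar_singleFunctor (hf : f ∈ ModuleCat.additiveFunctions F R) (n : ℤ)
    (M : ModuleCat.{0} R) : eulerChar f ((singleFunctor (ModuleCat.{0} R) n).obj M) =
      ((n.negOnePow : ℤ) : F) * f M := by
  rw [eulerChar, finsum_eq_single _ n, hf.1 _ _ (homology_singleFunctor n M).some]
  intro m hm
  have := subsingleton_homology_singleFunctor hm M
  rw [ModuleCat.additiveFunctions_of_subsingleton hf, mul_zero]

lemma eulerChar_triangle (hf : f ∈ ModuleCat.additiveFunctions F R)
    {T : Triangle (DerivedCategory (ModuleCat.{0} R))} (hT : T ∈ distTriang _)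
    (h₁ : IsBoundedFinite T.obj₁) (h₃ : IsBoundedFinite T.obj₃) :
    eulerChar f T.obj₂ = eulerChar f T.obj₁ + eulerChar f T.obj₃ := by
  have h₂ := h₁.of_distTriang hT h₃
  let d (n : ℤ) : F := f (.of R (δ T n (n + 1) rfl).hom.range)
  let a (n : ℤ) : F := f (.of R ((homologyFunctor (ModuleCat.{0} R) n).map T.mor₁).hom.range)
  let b (n : ℤ) : F := f (.of R ((homologyFunctor (ModuleCat.{0} R) n).map T.mor₂).hom.range)
  let ε (n : ℤ) : F := ((n.negOnePow : ℤ) : F)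
  have e₁ (n : ℤ) : f ((homologyFunctor (ModuleCat.{0} R) n).obj T.obj₁) = d (n - 1) + a n := by
    have := h₁.1 n
    rw [ModuleCat.additiveFunctions_ker_range hf ((homologyFunctor (ModuleCat.{0} R) n).map T.mor₁)]
    congr 1
    obtain ⟨m, rfl⟩ : ∃ m, n = m + 1 := ⟨n - 1, by ring⟩
    rw [← range_eq_ker₁ hT m (m + 1) rfl, add_sub_cancel_right]
  have e₂ (n : ℤ) : f ((homologyFunctor (ModuleCat.{0} R) n).obj T.obj₂) = a n + b n := by
    have := h₂.1 n
    rw [ModuleCat.additiveFunctions_ker_range hf ((homologyFunctor (ModuleCat.{0} R) n).map T.mor₂),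
      ← range_eq_ker₂ hT n]
  have e₃ (n : ℤ) : f ((homologyFunctor (ModuleCat.{0} R) n).obj T.obj₃) = b n + d n := by
    have := h₃.1 n
    rw [ModuleCat.additiveFunctions_ker_range hf (δ T n (n + 1) rfl), ← range_eq_ker₃ hT n _ rfl]
  have hr : ∀ {M N : ModuleCat.{0} R} (g : M ⟶ N), Subsingleton M →
      f (.of R g.hom.range) = 0 := fun {M N} g hM => by
    have : Subsingleton (ModuleCat.of R g.hom.range) :=
      g.hom.surjective_rangeRestrict.subsingleton
    exact ModuleCat.additiveFunctions_of_subsingleton hf _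
  have fin : ∀ (u : ℤ → F) (X : DerivedCategory (ModuleCat.{0} R)), IsBoundedFinite X →
      (∀ n, Subsingleton ((homologyFunctor (ModuleCat.{0} R) n).obj X) → u n = 0) →
      (Function.support fun n => ε n * u n).Finite := by
    rintro u X ⟨-, N, hN⟩ hu
    refine (Set.finite_Icc (-N : ℤ) N).subset fun n hn => ?_
    by_contra h
    exact hn (by simp only [hu n (hN n (by simp only [Set.mem_Icc, not_and_or] at h; lia)),
      mul_zero])
  have fd := fin d _ h₃ fun n h => hr _ h
  have fa := fin a _ h₁ fun n h => hr _ h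
  have fb := fin b _ h₂ fun n h => hr _ h
  have hd : ∀ n, ε (n + 1) * d (n + 1 - 1) = - (ε n * d n) := fun n => by
    have : ε (n + 1) = - ε n := by
      simp only [ε, Int.negOnePow_succ, Units.val_neg, Int.cast_neg]
    rw [this, add_sub_cancel_right, neg_mul]
  have fd' : (Function.support fun n => ε n * d (n - 1)).Finite := by
    refine (fd.image (· + 1)).subset fun n hn => ⟨n - 1, fun h => hn ?_, by ring⟩
    have := hd (n - 1)
    rw [sub_add_cancel] at this
    exact this.trans (by rw [show ε (n - 1) * d (n - 1) = 0 from h, neg_zero])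
  have sd : ∑ᶠ n, ε n * d (n - 1) = - ∑ᶠ n, ε n * d n := by
    rw [← finsum_comp_equiv (Equiv.addRight (1 : ℤ)), ← finsum_neg_distrib]
    exact finsum_congr hd
  have s₁ : eulerChar f T.obj₁ = ∑ᶠ n, ε n * d (n - 1) + ∑ᶠ n, ε n * a n := by
    rw [← finsum_add_distrib fd' fa]
    exact finsum_congr fun n => by rw [e₁ n, mul_add]
  have s₂ : eulerChar f T.obj₂ = ∑ᶠ n, ε n * a n + ∑ᶠ n, ε n * b n := by
    rw [← finsum_add_distrib fa fb]
    exact finsum_congr fun n => by rw [e₂ n, mul_add]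
  have s₃ : eulerChar f T.obj₃ = ∑ᶠ n, ε n * b n + ∑ᶠ n, ε n * d n := by
    rw [← finsum_add_distrib fb fd]
    exact finsum_congr fun n => by rw [e₃ n, mul_add]
  rw [s₁, s₂, s₃, sd]
  ring

/-- A module without non-trivial self-extensions to other modules is projective. -/
lemma projective_of_hom_eq_zero (n : ℤ) (M : ModuleCat.{0} R)
    (h : ∀ (N : ModuleCat.{0} R) (g : (singleFunctor (ModuleCat.{0} R) n).obj M ⟶
      (singleFunctor (ModuleCat.{0} R) (n - 1)).obj N), g = 0) : Projective M := by
  let S : ShortComplex (ModuleCat.{0} R) :=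
    ShortComplex.mk (Limits.kernel.ι (Projective.π M)) (Projective.π M) (by simp)
  have hS : S.ShortExact := ⟨ShortComplex.exact_kernel _⟩
  have hT := hS.singleTriangle_distinguished
  have hδ : hS.singleδ = 0 := by
    let S₀ := (singleFunctor (ModuleCat.{0} R) 0).obj
    let e₁ : (S₀ M)⟦-n⟧ ≅ (singleFunctor (ModuleCat.{0} R) n).obj M :=
      singleShiftIso M (-n) 0 n (by simp)
    let e₂ : ((S₀ S.X₁)⟦(1 : ℤ)⟧)⟦-n⟧ ≅ (singleFunctor (ModuleCat.{0} R) (n - 1)).obj S.X₁ :=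
      (shiftFunctor _ (-n)).mapIso (singleShiftIso S.X₁ 1 0 (-1) (by simp)) ≪≫
        singleShiftIso S.X₁ (-n) (-1) (n - 1) (by ring)
    refine (shiftFunctor _ (-n)).map_injective ?_
    have h1 := h _ (e₁.inv ≫ (hS.singleδ)⟦-n⟧' ≫ e₂.hom)
    rw [Preadditive.IsIso.comp_left_eq_zero, Preadditive.IsIso.comp_right_eq_zero] at h1
    rw [h1, Functor.map_zero]
  obtain ⟨s, hs⟩ := Triangle.coyoneda_exact₃ _ hT (𝟙 _) (by
    change 𝟙 _ ≫ hS.singleδ = 0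
    rw [hδ, Limits.comp_zero])
  let s' : (singleFunctor (ModuleCat.{0} R) 0).obj M ⟶
      (singleFunctor (ModuleCat.{0} R) 0).obj (Projective.over M) := s
  have hs' : 𝟙 _ = s' ≫ (singleFunctor (ModuleCat.{0} R) 0).map (Projective.π M) := hs
  have r : Retract M (Projective.over M) :=
    { i := (singleFunctor (ModuleCat.{0} R) 0).preimage s'
      r := Projective.π M
      retract := (singleFunctor (ModuleCat.{0} R) 0).map_injective (by simp [← hs']) }
  exact r.projective

lemma hom_singleFunctor_eq_zero {n m : ℤ} (h : n ≠ m) (P M : ModuleCat.{0} R) [Projective P]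
    (g : (singleFunctor (ModuleCat.{0} R) n).obj P ⟶ (singleFunctor (ModuleCat.{0} R) m).obj M) :
    g = 0 := by
  obtain ⟨g, rfl⟩ := exists_Q_map_eq_of_projective n P
    (y := (HomologicalComplex.single (ModuleCat.{0} R) (ComplexShape.up ℤ) m).obj M) g
  have : g = 0 := HomologicalComplex.from_single_hom_ext
    ((HomologicalComplex.isZero_single_obj_X _ _ _ _ h).eq_of_tgt _ _)
  rw [this]
  exact Functor.map_zero _ _ _

lemma eulerChar_eq_zero_aux [IsNoetherianRing R] (hf : f ∈ ModuleCat.additiveFunctions F R)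
    (k : ℕ) (c : ℤ) :
    ∀ X : DerivedCategory (ModuleCat.{0} R), IsBoundedFinite X →
    (∀ n, n < c ∨ c + k < n → Subsingleton ((homologyFunctor (ModuleCat.{0} R) n).obj X)) →
    (∀ i < c, ∀ (M : ModuleCat.{0} R) (h : X ⟶ (singleFunctor (ModuleCat.{0} R) i).obj M), h = 0) →
    eulerChar f X = 0 := by
  induction k with
  | zero =>
    intro X hX h₁ h₂
    have hge : X.IsGE c := by
      rw [isGE_iff]
      intro i hi
      have := h₁ i (Or.inl hi)
      exact ModuleCat.isZero_of_subsingleton _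
    have hle : X.IsLE c := by
      rw [isLE_iff]
      intro i hi
      have := h₁ i (Or.inr (by simpa using hi))
      exact ModuleCat.isZero_of_subsingleton _
    obtain ⟨M, ⟨e⟩⟩ := exists_iso_singleFunctor_obj_of_isGE_of_isLE X c
    have hM : IsNoetherian R M := by
      have := (hX.of_iso e).1 c
      exact isNoetherian_of_linearEquiv (homology_singleFunctor c M).some.toLinearEquiv
    have hP : Projective M := projective_of_hom_eq_zero c M fun N g => by
      rw [← cancel_epi e.hom, h₂ (c - 1) (by lia) N (e.hom ≫ g), Limits.comp_zero]
    rw [eulerChar_of_iso hf e, eulerChar_singleFunctor hf, hf.2.2.2 M hM hP, mul_zero]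
  | succ k ih =>
    intro X hX h₁ h₂
    obtain ⟨b, hb⟩ : ∃ b : ℤ, b = c + (k + 1 : ℕ) := ⟨_, rfl⟩
    have := hX.1 b
    obtain ⟨r, φ, hφ⟩ := Module.Finite.exists_fin' R ((homologyFunctor (ModuleCat.{0} R) b).obj X)
    let P := ModuleCat.of R (Fin r → R)
    have hP : Projective P := (IsProjective.iff_projective (Fin r → R)).1 inferInstance
    have hPn : IsNoetherian R P := inferInstanceAs (IsNoetherian R (Fin r → R))
    obtain ⟨g, u, hg⟩ := exists_lift_homology b P (ModuleCat.ofHom φ)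
    obtain ⟨Y, p, q, hT⟩ := distinguished_cocone_triangle g
    have hT' := rot_of_distTriang _ hT
    have hS := isBoundedFinite_singleFunctor b P
    have hY : IsBoundedFinite Y := by
      have : IsBoundedFinite (((singleFunctor (ModuleCat.{0} R) b).obj P)⟦(1 : ℤ)⟧) := hS.shift 1
      exact IsBoundedFinite.of_distTriang hT' hX this
    have hχ : eulerChar f X =
      eulerChar f ((singleFunctor (ModuleCat.{0} R) b).obj P) + eulerChar f Y :=
      eulerChar_triangle hf hT hS hY
    rw [hχ, eulerChar_singleFunctor hf, hf.2.2.2 P hPn hP, mul_zero, zero_add]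
    refine ih Y hY (fun n hn => ?_) (fun i hi M h => ?_)
    · have hsub : n + 1 ≠ b → Subsingleton ((homologyFunctor (ModuleCat.{0} R) (n + 1)).obj
        ((singleFunctor (ModuleCat.{0} R) b).obj P)) :=
        fun h => subsingleton_homology_singleFunctor h P
      have key : Subsingleton ((homologyFunctor (ModuleCat.{0} R) n).obj X) →
          Subsingleton ((homologyFunctor (ModuleCat.{0} R) n).obj Y) := fun h => by
        have h' := hsub (by lia)
        have : Subsingleton ((homologyFunctor (ModuleCat.{0} R) n).obj
          (Triangle.mk g p q).obj₂) := h
        have : Subsingleton ((homologyFunctor (ModuleCat.{0} R) (n + 1)).obj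
          (Triangle.mk g p q).obj₁) := h'
        exact ModuleCat.subsingleton_of_range_eq_ker (range_eq_ker₃ hT n (n + 1) rfl)
      by_cases hnb : n = b
      · subst hnb
        have := hsub (by lia)
        have h3 : ((homologyFunctor (ModuleCat.{0} R) n).map p).hom.range =
          (δ (Triangle.mk g p q) n (n + 1) rfl).hom.ker := range_eq_ker₃ hT n (n + 1) rfl
        have h4 : ((homologyFunctor (ModuleCat.{0} R) n).map g).hom.range =
          ((homologyFunctor (ModuleCat.{0} R) n).map p).hom.ker := range_eq_ker₂ hT n
        have h5 : ((homologyFunctor (ModuleCat.{0} R) n).map g).hom.range = ⊤ := by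
          rw [LinearMap.range_eq_top]
          intro y
          obtain ⟨x, hx⟩ := hφ y
          exact ⟨u x, (ConcreteCategory.congr_hom hg x).trans hx⟩
        refine subsingleton_of_forall_eq 0 fun y => ?_
        have hy : y ∈ ((homologyFunctor (ModuleCat.{0} R) n).map p).hom.range := by
          rw [h3]
          exact Subsingleton.elim (α := (homologyFunctor (ModuleCat.{0} R) (n + 1)).obj
            ((singleFunctor (ModuleCat.{0} R) n).obj P)) _ _
        obtain ⟨x, rfl⟩ := hy
        have hx : x ∈ ((homologyFunctor (ModuleCat.{0} R) n).map p).hom.ker := by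
          rw [← h4, h5]
          exact Submodule.mem_top
        exact hx
      · exact key (h₁ n (by lia))
    · obtain ⟨t, ht⟩ := Triangle.yoneda_exact₃ _ hT h
        (h₂ i hi M (p ≫ h))
      have hne : i ≠ b - 1 := by lia
      let e : ((singleFunctor (ModuleCat.{0} R) b).obj P)⟦(1 : ℤ)⟧ ≅
        (singleFunctor (ModuleCat.{0} R) (b - 1)).obj P := singleShiftIso P 1 b (b - 1) (by ring)
      let t' : ((singleFunctor (ModuleCat.{0} R) b).obj P)⟦(1 : ℤ)⟧ ⟶
        (singleFunctor (ModuleCat.{0} R) i).obj M := t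
      have ht' : t' = 0 := by
        rw [← cancel_epi e.inv, Limits.comp_zero]
        exact hom_singleFunctor_eq_zero hne.symm P M _
      exact ht.trans ((congrArg (q ≫ ·) ht').trans Limits.comp_zero)

lemma eulerChar_eq_zero [IsNoetherianRing R] (hf : f ∈ ModuleCat.additiveFunctions F R)
    {X : DerivedCategory (ModuleCat.{0} R)} (hX : IsBoundedFinite X) (hX' : IsSmall X) :
    eulerChar f X = 0 := by
  obtain ⟨N, hN⟩ := hX.2
  obtain ⟨N', hN'⟩ := exists_bound_of_isSmall hX'
  refine eulerChar_eq_zero_aux hf (2 * N + N') (-(N + N')) X hX (fun n hn => hN n ?_)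
    (fun i hi => hN' i ?_)
  · push_cast at hn
    lia
  · lia

/-- The function on the derived category defined by the Euler characteristic. -/
noncomputable def eulerFunction (f : ModuleCat.{0} R → F)
    (X : DerivedCategory (ModuleCat.{0} R)) : F :=
  open scoped Classical in if IsHomBounded X then eulerChar f X else 0

lemma eulerFunction_mem [IsNoetherianRing R] (hf : f ∈ ModuleCat.additiveFunctions F R) :
    eulerFunction f ∈
      CategoryTheory.additiveFunctions F (DerivedCategory.{w} (ModuleCat.{0} R)) := by
  have hb : ∀ X : DerivedCategory.{w} (ModuleCat.{0} R), IsHomBounded X →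
      eulerFunction f X = eulerChar f X := fun X hX => if_pos hX
  refine ⟨fun X Y e => ?_, fun T hT h₁ h₂ h₃ => ?_, fun X hX => if_neg hX, fun X hX hX' => ?_⟩
  · have : IsHomBounded X ↔ IsHomBounded Y :=
      ⟨fun h => IsHomBounded.of_iso h e, fun h => IsHomBounded.of_iso h e.symm⟩
    by_cases hX : IsHomBounded X
    · rw [hb X hX, hb Y (this.1 hX), eulerChar_of_iso hf e]
    · exact (if_neg hX).trans (if_neg (mt this.2 hX)).symm
  · rw [hb _ h₁, hb _ h₂, hb _ h₃]
    exact eulerChar_triangle hf hT (isBoundedFinite_of_isHomBounded h₁)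
      (isBoundedFinite_of_isHomBounded h₃)
  · rw [hb _ hX]
    exact eulerChar_eq_zero hf (isBoundedFinite_of_isHomBounded hX) hX'

lemma restrictAdditiveFunctions_surjective (K : Type) [Field K] [Algebra K R]
    [FiniteDimensional K R] :
    Function.Surjective (restrictAdditiveFunctions.{w} F R K) := by
  have : IsNoetherianRing R := isNoetherianRing_iff.2 (isNoetherian_of_tower K inferInstance)
  rintro ⟨f, hf⟩
  refine ⟨⟨eulerFunction f, eulerFunction_mem hf⟩, Subtype.ext (funext fun M => ?_)⟩
  change eulerFunction f ((singleFunctor (ModuleCat.{0} R) 0).obj M) = f M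
  have h1 := eulerChar_singleFunctor hf 0 M
  rw [Int.negOnePow_zero, Units.val_one, Int.cast_one, one_mul] at h1
  by_cases hM : IsNoetherian R M
  · exact (if_pos ((isBoundedFinite_singleFunctor 0 M).isHomBounded K)).trans h1
  · rw [hf.2.2.1 M hM] at h1 ⊢
    simp only [eulerFunction, h1, ite_self]

variable (F R) in
/-- Additive functions on the derived category are determined by additive functions on modules. -/
noncomputable def additiveFunctionsEquiv (K : Type) [Field K] [Algebra K R]
    [FiniteDimensional K R] :
    CategoryTheory.additiveFunctions F (DerivedCategory.{w} (ModuleCat.{0} R)) ≃ₗ[F]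
      ModuleCat.additiveFunctions F R :=
  LinearEquiv.ofBijective (restrictAdditiveFunctions F R K)
    ⟨restrictAdditiveFunctions_injective K, restrictAdditiveFunctions_surjective K⟩

end DerivedCategory

lemma DerivedEquivalent.finrank_additiveFunctions (F K : Type) [Field F] [Field K] {A B : Type}
    [Ring A] [Ring B] [Algebra K A] [Algebra K B] [FiniteDimensional K A] [FiniteDimensional K B]
    [FiniteDimensional F (ModuleCat.additiveFunctions F A)]
    [FiniteDimensional F (ModuleCat.additiveFunctions F B)] (h : DerivedEquivalent A B) :
    Module.finrank F (ModuleCat.additiveFunctions F A) =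
      Module.finrank F (ModuleCat.additiveFunctions F B) := by
  let _ : HasDerivedCategory.{1} (ModuleCat.{0} A) := HasDerivedCategory.standard _
  let _ : HasDerivedCategory.{1} (ModuleCat.{0} B) := HasDerivedCategory.standard _
  obtain ⟨e, h, h'⟩ : ∃ (e : DerivedCategory.{1} (ModuleCat.{0} A) ≌
    DerivedCategory.{1} (ModuleCat.{0} B)) (h : e.functor.CommShift ℤ),
      letI := h
      e.functor.IsTriangulated := h
  let _ : e.inverse.CommShift ℤ := e.commShiftInverse ℤ
  have : e.CommShift ℤ := e.commShift_of_functor ℤ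
  have : e.IsTriangulated := Equivalence.IsTriangulated.mk' e h'
  have eA := DerivedCategory.additiveFunctionsEquiv.{1} F A K
  have eB := DerivedCategory.additiveFunctionsEquiv.{1} F B K
  have := eA.symm.finiteDimensional
  have := eB.symm.finiteDimensional
  rw [← eA.finrank_eq, ← eB.finrank_eq]
  have : e.inverse.IsTriangulated := inferInstance
  exact le_antisymm (finrank_additiveFunctions_le F e.inverse)
    (finrank_additiveFunctions_le F e.functor)

/-- A presentation of an algebra by a quiver with relations: the idempotents of the vertices and
the arrows satisfy the relations of the path algebra, generate, and are universal. -/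
structure QuivRel.Presentation (G : QuivRel) (K R : Type) [Field K] [Ring R] [Algebra K R] where
  /-- the trivial path at a vertex -/
  e : G.V → R
  /-- the arrows -/
  x : G.A → R
  e_mul_self (v : G.V) : e v * e v = e v
  e_mul_of_ne (v w : G.V) (h : v ≠ w) : e v * e w = 0
  sum_e : ∑ v, e v = 1
  e_src_mul_x (a : G.A) : e (G.src a) * x a = x a
  x_mul_e_tgt (a : G.A) : x a * e (G.tgt a) = x a
  x_mul_x_of_rel (a b : G.A) (h : G.rel a b) : x a * x b = 0
  subalgebra_eq_top (S : Subalgebra K R) (he : ∀ v, e v ∈ S) (hx : ∀ a, x a ∈ S) : S = ⊤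
  exists_lift (B : Type) [Ring B] [Algebra K B] (E : G.V → B) (X : G.A → B)
    (h₁ : ∀ v, E v * E v = E v) (h₂ : ∀ v w, v ≠ w → E v * E w = 0) (h₃ : ∑ v, E v = 1)
    (h₄ : ∀ a, E (G.src a) * X a = X a) (h₅ : ∀ a, X a * E (G.tgt a) = X a)
    (h₆ : ∀ a b, G.rel a b → X a * X b = 0) :
    ∃ φ : R →ₐ[K] B, (∀ v, φ (e v) = E v) ∧ ∀ a, φ (x a) = X a

/-- The defining presentation of the path algebra. -/
noncomputable def PathAlgebra.presentation (K : Type) [Field K] (G : QuivRel) :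
    G.Presentation K (PathAlgebra K G) where
  e v := RingQuot.mkAlgHom K (PathAlgRel K G) (FreeAlgebra.ι K (Sum.inl v))
  x a := RingQuot.mkAlgHom K (PathAlgRel K G) (FreeAlgebra.ι K (Sum.inr a))
  e_mul_self v := (map_mul _ _ _).symm.trans (RingQuot.mkAlgHom_rel K (.vertex_idem v))
  e_mul_of_ne v w h := (map_mul _ _ _).symm.trans
    ((RingQuot.mkAlgHom_rel K (.vertex_orth v w h)).trans (map_zero _))
  sum_e := (map_sum _ _ _).symm.trans ((RingQuot.mkAlgHom_rel K .sum_vertices).trans (map_one _))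
  e_src_mul_x a := (map_mul _ _ _).symm.trans (RingQuot.mkAlgHom_rel K (.src_mul a))
  x_mul_e_tgt a := (map_mul _ _ _).symm.trans (RingQuot.mkAlgHom_rel K (.mul_tgt a))
  x_mul_x_of_rel a b h := (map_mul _ _ _).symm.trans
    ((RingQuot.mkAlgHom_rel K (.rel a b h)).trans (map_zero _))
  subalgebra_eq_top S he hx := by
    have h : Subalgebra.comap (RingQuot.mkAlgHom K (PathAlgRel K G)) S = ⊤ := by
      rw [eq_top_iff, ← FreeAlgebra.adjoin_range_ι, Algebra.adjoin_le_iff]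
      rintro _ ⟨v | a, rfl⟩
      exacts [he v, hx a]
    refine eq_top_iff.2 fun r _ => ?_
    obtain ⟨r, rfl⟩ := RingQuot.mkAlgHom_surjective K (PathAlgRel K G) r
    have : r ∈ Subalgebra.comap (RingQuot.mkAlgHom K (PathAlgRel K G)) S := h ▸ Algebra.mem_top
    exact this
  exists_lift B _ _ E X h₁ h₂ h₃ h₄ h₅ h₆ := by
    let φ : PathAlgebra K G →ₐ[K] B :=
      RingQuot.liftAlgHom K ⟨FreeAlgebra.lift K (Sum.elim E X), by
        rintro _ _ (⟨v⟩ | ⟨v, w, h⟩ | _ | ⟨a⟩ | ⟨a⟩ | ⟨a, b, h⟩)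
        · simp [h₁]
        · simp [h₂ v w h]
        · simp [h₃]
        · simp [h₄]
        · simp [h₅]
        · simp [h₆ a b h]⟩
    refine ⟨φ, fun v => (RingQuot.liftAlgHom_mkAlgHom_apply ..).trans ?_,
      fun a => (RingQuot.liftAlgHom_mkAlgHom_apply ..).trans ?_⟩ <;> simp

namespace QuivRel.Presentation

variable {G : QuivRel} {K R : Type} [Field K] [Ring R] [Algebra K R] (P : G.Presentation K R)

lemma e_mul (v w : G.V) : P.e v * P.e w = if v = w then P.e w else 0 := by
  split_ifs with h
  · rw [h, P.e_mul_self]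
  · exact P.e_mul_of_ne v w h

lemma x_mul_e (a : G.A) (v : G.V) : P.x a * P.e v = if G.tgt a = v then P.x a else 0 := by
  split_ifs with h
  · rw [← h, P.x_mul_e_tgt]
  · rw [← P.x_mul_e_tgt, mul_assoc, P.e_mul_of_ne _ _ h, mul_zero]

lemma e_mul_x (a : G.A) (v : G.V) : P.e v * P.x a = if v = G.src a then P.x a else 0 := by
  split_ifs with h
  · rw [h, P.e_src_mul_x]
  · rw [← P.e_src_mul_x, ← mul_assoc, P.e_mul_of_ne _ _ h, zero_mul]

lemma x_mul_x_of_ne {a b : G.A} (h : G.tgt a ≠ G.src b) : P.x a * P.x b = 0 := by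
  rw [← P.x_mul_e_tgt, mul_assoc, P.e_mul_x, if_neg h, mul_zero]

lemma smul_mem {M : Type} [AddCommGroup M] [Module K M] [Module R M]
    [IsScalarTower K R M] (W : Submodule K M)
    (he : ∀ v, ∀ m ∈ W, P.e v • m ∈ W) (hx : ∀ a, ∀ m ∈ W, P.x a • m ∈ W)
    (r : R) {m : M} (hm : m ∈ W) : r • m ∈ W := by
  let S : Subalgebra K R :=
    { carrier := {r | ∀ m ∈ W, r • m ∈ W}
      mul_mem' := fun {r s} hr hs m hm => by
        rw [mul_smul]
        exact hr _ (hs _ hm)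
      add_mem' := fun {r s} hr hs m hm => by
        rw [add_smul]
        exact W.add_mem (hr _ hm) (hs _ hm)
      algebraMap_mem' := fun k m hm => by
        rw [algebraMap_smul]
        exact W.smul_mem k hm }
  have : r ∈ S := by
    rw [P.subalgebra_eq_top S he hx]
    exact Algebra.mem_top
  exact this m hm

end QuivRel.Presentation

namespace QuivRel

variable {G : QuivRel}

lemma isNonzeroPath_nil : G.IsNonzeroPath [] := List.isChain_nil

lemma isNonzeroPathFrom_nil {i j : G.V} : G.IsNonzeroPathFrom i j [] ↔ i = j := by
  simp [IsNonzeroPathFrom, isNonzeroPath_nil]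

lemma isNonzeroPath_cons {a : G.A} {p : List G.A} : G.IsNonzeroPath (a :: p) ↔
    (∀ b ∈ p.head?, G.tgt a = G.src b ∧ ¬ G.rel a b) ∧ G.IsNonzeroPath p := by
  exact List.isChain_cons

lemma isNonzeroPathFrom_cons {i j : G.V} {a : G.A} {p : List G.A} :
    G.IsNonzeroPathFrom i j (a :: p) ↔
      G.src a = i ∧ (∀ b ∈ p.head?, ¬ G.rel a b) ∧ G.IsNonzeroPathFrom (G.tgt a) j p := by
  rw [IsNonzeroPathFrom, isNonzeroPath_cons, IsNonzeroPathFrom]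
  cases p with
  | nil => simp [isNonzeroPath_nil, eq_comm]
  | cons b p => simp; grind

lemma FinDim.finite_isNonzeroPath (h : G.FinDim) : Set.Finite {p | G.IsNonzeroPath p} := by
  obtain ⟨N, hN⟩ := h
  exact (List.finite_length_le G.A N).subset hN

lemma FinDim.finite_isNonzeroPathFrom (h : G.FinDim) (i j : G.V) :
    Finite {p // G.IsNonzeroPathFrom i j p} :=
  (h.finite_isNonzeroPath.subset fun _ hp => hp.1 : Set.Finite {p | G.IsNonzeroPathFrom i j p})

namespace Presentation

variable {K R : Type} [Field K] [Ring R] [Algebra K R] (P : G.Presentation K R)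

/-- The element of the algebra given by a list of arrows ending at `j`. -/
def word (p : List G.A) (j : G.V) : R := (p.map P.x).prod * P.e j

@[simp]
lemma word_nil (j : G.V) : P.word [] j = P.e j := by simp [word]

lemma word_cons (a : G.A) (p : List G.A) (j : G.V) : P.word (a :: p) j = P.x a * P.word p j := by
  simp [word, mul_assoc]

lemma prod_map_x_eq_zero {p : List G.A} (hp : ¬ G.IsNonzeroPath p) : (p.map P.x).prod = 0 := by
  induction p with
  | nil => exact (hp isNonzeroPath_nil).elim
  | cons a p ih =>
    rw [isNonzeroPath_cons, not_and_or] at hp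
    rcases hp with hp | hp
    · push Not at hp
      obtain ⟨b, hb, h⟩ := hp
      obtain ⟨q, rfl⟩ := List.head?_eq_some_iff.1 hb
      have : P.x a * P.x b = 0 := by
        by_cases hab : G.tgt a = G.src b
        · exact P.x_mul_x_of_rel a b (h hab)
        · exact P.x_mul_x_of_ne hab
      simp [← mul_assoc, this]
    · simp [ih hp]

lemma e_mul_word {i j : G.V} {p : List G.A} (hp : G.IsNonzeroPathFrom i j p) (v : G.V) :
    P.e v * P.word p j = if v = i then P.word p j else 0 := by
  cases p with
  | nil =>
    obtain rfl := isNonzeroPathFrom_nil.1 hp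
    simp [e_mul]
  | cons a p =>
    obtain ⟨rfl, -⟩ := isNonzeroPathFrom_cons.1 hp
    rw [word_cons, ← mul_assoc, e_mul_x]
    split_ifs <;> simp

lemma word_mul_e (p : List G.A) (j v : G.V) :
    P.word p j * P.e v = if j = v then P.word p j else 0 := by
  rw [word, mul_assoc, e_mul]
  split_ifs with h
  · rw [h]
  · simp

open scoped Classical in
lemma x_mul_word {i j : G.V} {p : List G.A} (hp : G.IsNonzeroPathFrom i j p) (a : G.A) :
    P.x a * P.word p j =
      if G.tgt a = i ∧ ∀ b ∈ p.head?, ¬ G.rel a b then P.word (a :: p) j else 0 := by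
  split_ifs with h
  · rw [word_cons]
  by_cases h' : G.tgt a = i
  · have : ∃ b ∈ p.head?, G.rel a b := by
      by_contra! H
      exact h ⟨h', H⟩
    obtain ⟨b, hb, hab⟩ := this
    obtain ⟨q, rfl⟩ := List.head?_eq_some_iff.1 hb
    rw [word_cons, ← mul_assoc, P.x_mul_x_of_rel a b hab, zero_mul]
  · have : P.word p j = P.e i * P.word p j := by rw [P.e_mul_word hp, if_pos rfl]
    rw [this, ← mul_assoc, P.x_mul_e, if_neg h', zero_mul]

lemma span_word :
    Submodule.span K {r | ∃ i j p, G.IsNonzeroPathFrom i j p ∧ P.word p j = r} = ⊤ := by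
  set W := Submodule.span K {r | ∃ i j p, G.IsNonzeroPathFrom i j p ∧ P.word p j = r} with hW
  refine eq_top_iff.2 fun r _ => ?_
  have h1 : (1 : R) ∈ W := by
    rw [← P.sum_e]
    exact W.sum_mem fun v _ => Submodule.subset_span
      ⟨v, v, [], isNonzeroPathFrom_nil.2 rfl, P.word_nil v⟩
  rw [← mul_one r]
  refine P.smul_mem W (fun v m hm => ?_) (fun a m hm => ?_) r h1
  · refine (Submodule.span_le (p := W.comap (LinearMap.mulLeft K (P.e v)))).2 ?_ hm
    rintro _ ⟨i, j, p, hp, rfl⟩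
    simp only [Submodule.comap_coe, Set.mem_preimage, LinearMap.mulLeft_apply, P.e_mul_word hp]
    split_ifs
    · exact Submodule.subset_span ⟨i, j, p, hp, rfl⟩
    · exact W.zero_mem
  · refine (Submodule.span_le (p := W.comap (LinearMap.mulLeft K (P.x a)))).2 ?_ hm
    rintro _ ⟨i, j, p, hp, rfl⟩
    simp only [Submodule.comap_coe, Set.mem_preimage, LinearMap.mulLeft_apply, P.x_mul_word hp]
    split_ifs with h
    · obtain ⟨rfl, h⟩ := h
      exact Submodule.subset_span ⟨_, j, a :: p, isNonzeroPathFrom_cons.2 ⟨rfl, h, hp⟩, rfl⟩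
    · exact W.zero_mem

lemma finiteDimensional (P : G.Presentation K R) (h : G.FinDim) : FiniteDimensional K R := by
  refine Module.finite_def.2 ?_
  rw [← P.span_word]
  refine Submodule.fg_span ?_
  refine ((h.finite_isNonzeroPath.prod (Set.finite_univ (α := G.V))).image
    fun t => P.word t.1 t.2).subset ?_
  rintro _ ⟨i, j, p, hp, rfl⟩
  exact ⟨(p, j), ⟨hp.1, trivial⟩, rfl⟩

lemma linearIndependent_word (i j : G.V) :
    LinearIndependent K fun p : {p // G.IsNonzeroPathFrom i j p} => P.word p.1 j := by
  classical
  let B := G.V × List G.A × G.V →₀ K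
  let E (v : G.V) : Module.End K B :=
    Finsupp.linearCombination K fun t => if v = t.1 then Finsupp.single t 1 else 0
  let X (a : G.A) : Module.End K B :=
    Finsupp.linearCombination K fun t => if G.tgt a = t.1 ∧ ∀ b ∈ t.2.1.head?, ¬ G.rel a b then
      Finsupp.single (G.src a, a :: t.2.1, t.2.2) 1 else 0
  have hE : ∀ v t, E v (Finsupp.single t 1) = if v = t.1 then Finsupp.single t 1 else 0 := by
    intro v t
    exact (Finsupp.linearCombination_single K (1 : K) t).trans (one_smul K _)
  have hX : ∀ a t, X a (Finsupp.single t 1) =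
      if G.tgt a = t.1 ∧ ∀ b ∈ t.2.1.head?, ¬ G.rel a b then
        Finsupp.single (G.src a, a :: t.2.1, t.2.2) 1 else 0 := by
    intro a t
    exact (Finsupp.linearCombination_single K (1 : K) t).trans (one_smul K _)
  obtain ⟨φ, hφe, hφx⟩ := P.exists_lift (Module.End K B) E X
    (fun v => Finsupp.lhom_ext' fun t => LinearMap.ext_ring (by
      simp only [LinearMap.comp_apply, Finsupp.lsingle_apply, Module.End.mul_apply, hE]
      split_ifs with h <;> simp [hE, h]))
    (fun v w hvw => Finsupp.lhom_ext' fun t => LinearMap.ext_ring (by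
      simp only [LinearMap.comp_apply, Finsupp.lsingle_apply, Module.End.mul_apply, hE]
      split_ifs with h
      · rw [hE, if_neg (fun h' => hvw (h'.trans h.symm))]
        rfl
      · simp))
    (Finsupp.lhom_ext' fun t => LinearMap.ext_ring (by
      simp [LinearMap.comp_apply, Finsupp.lsingle_apply, LinearMap.sum_apply, hE]))
    (fun a => Finsupp.lhom_ext' fun t => LinearMap.ext_ring (by
      simp only [LinearMap.comp_apply, Finsupp.lsingle_apply, Module.End.mul_apply, hX]
      split_ifs with h <;> simp [hE]))
    (fun a => Finsupp.lhom_ext' fun t => LinearMap.ext_ring (by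
      simp only [LinearMap.comp_apply, Finsupp.lsingle_apply, Module.End.mul_apply, hE, hX]
      split_ifs with h h' h'
      · rw [hX, if_pos h']
      · rw [hX, if_neg h']
      · exact absurd h'.1 h
      · simp))
    (fun a b hab => Finsupp.lhom_ext' fun t => LinearMap.ext_ring (by
      simp only [LinearMap.comp_apply, Finsupp.lsingle_apply, Module.End.mul_apply, hX]
      split_ifs with h
      · simp [hX, hab]
      · simp))
  let m : B := ∑ k, Finsupp.single (k, [], k) 1
  have key : ∀ (p : List G.A) (i j : G.V), G.IsNonzeroPathFrom i j p →
      φ (P.word p j) m = Finsupp.single (i, p, j) 1 := by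
    intro p
    induction p with
    | nil =>
      intro i j hp
      obtain rfl := isNonzeroPathFrom_nil.1 hp
      simp [hφe, m, hE]
    | cons a p ih =>
      intro i j hp
      obtain ⟨rfl, h, hp⟩ := isNonzeroPathFrom_cons.1 hp
      rw [word_cons, map_mul, Module.End.mul_apply, ih _ _ hp, hφx, hX]
      exact if_pos ⟨rfl, h⟩
  refine LinearIndependent.of_comp ((LinearMap.applyₗ m).comp φ.toLinearMap) ?_
  have : ((LinearMap.applyₗ m).comp φ.toLinearMap : R →ₗ[K] B) ∘
      (fun p : {p // G.IsNonzeroPathFrom i j p} => P.word p.1 j) =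
      fun p => Finsupp.single (i, p.1, j) 1 := by
    funext p
    exact key _ _ _ p.2
  rw [this]
  exact (Finsupp.linearIndependent_single_one K (G.V × List G.A × G.V)).comp
    (fun p : {p // G.IsNonzeroPathFrom i j p} => (i, p.1, j)) fun p q h => by
      simpa [Subtype.ext_iff] using h

/-- The space spanned by the paths from `i` to `j`. -/
def corner (i j : G.V) : Submodule K R :=
  LinearMap.range (LinearMap.mulLeft K (P.e i) ∘ₗ LinearMap.mulRight K (P.e j))

variable {P} in
lemma mem_corner {i j : G.V} {r : R} : r ∈ P.corner i j ↔ P.e i * r = r ∧ r * P.e j = r := by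
  constructor
  · rintro ⟨s, rfl⟩
    simp [← mul_assoc, P.e_mul_self]
    simp [mul_assoc, P.e_mul_self]
  · rintro ⟨h₁, h₂⟩
    exact ⟨r, by simp [h₁, h₂]⟩

lemma corner_eq_span (i j : G.V) : P.corner i j =
    Submodule.span K (Set.range fun p : {p // G.IsNonzeroPathFrom i j p} => P.word p.1 j) := by
  apply le_antisymm
  · rw [corner, LinearMap.range_eq_map, ← P.span_word, Submodule.map_span, Submodule.span_le]
    rintro _ ⟨_, ⟨k, l, p, hp, rfl⟩, rfl⟩
    simp only [LinearMap.comp_apply, LinearMap.mulRight_apply, LinearMap.mulLeft_apply,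
      P.word_mul_e]
    split_ifs with h
    · rw [P.e_mul_word hp]
      split_ifs with h'
      · subst h h'
        exact Submodule.subset_span ⟨⟨p, hp⟩, rfl⟩
      · exact Submodule.zero_mem _
    · rw [mul_zero]
      exact Submodule.zero_mem _
  · rw [Submodule.span_le]
    rintro _ ⟨⟨p, hp⟩, rfl⟩
    exact mem_corner.2 ⟨by simp [P.e_mul_word hp], by simp [P.word_mul_e]⟩

lemma finrank_corner (h : G.FinDim) (i j : G.V) :
    (Module.finrank K (P.corner i j) : ℤ) = G.cartan i j := by
  have := h.finite_isNonzeroPathFrom i j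
  have := Fintype.ofFinite {p // G.IsNonzeroPathFrom i j p}
  rw [P.corner_eq_span, finrank_span_eq_card (P.linearIndependent_word i j), cartan,
    Nat.card_eq_fintype_card]

end Presentation

end QuivRel

section homDim

variable (K R : Type) [Field K] [Ring R] [Algebra K R]

/-- The dimension of the space of linear maps between two modules over a `K`-algebra. -/
noncomputable def homDim (X M : Type) [AddCommGroup X] [Module R X] [AddCommGroup M]
    [Module R M] : ℕ :=
  letI : Module K M := Module.compHom M (algebraMap K R)
  haveI : IsScalarTower K R M := ⟨fun k r m => by rw [Algebra.smul_def, mul_smul]; rfl⟩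
  Module.finrank K (X →ₗ[R] M)

variable {X M : Type} [AddCommGroup X] [Module R X] [AddCommGroup M] [Module R M]

lemma homDim_eq_finrank [i : Module K M] [IsScalarTower K R M] :
    homDim K R X M = Module.finrank K (X →ₗ[R] M) := by
  have : i = Module.compHom M (algebraMap K R) := Module.ext' _ _ fun k m =>
    (algebraMap_smul R k m).symm
  subst this
  rfl

variable {K R} in
lemma LinearEquiv.homDim_eq {M' : Type} [AddCommGroup M'] [Module R M'] (e : M ≃ₗ[R] M') :
    homDim K R X M = homDim K R X M' := by
  let _ : Module K M := Module.compHom M (algebraMap K R)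
  have : IsScalarTower K R M := ⟨fun k r m => by rw [Algebra.smul_def, mul_smul]; rfl⟩
  let _ : Module K M' := Module.compHom M' (algebraMap K R)
  have : IsScalarTower K R M' := ⟨fun k r m => by rw [Algebra.smul_def, mul_smul]; rfl⟩
  rw [homDim_eq_finrank, homDim_eq_finrank]
  refine LinearEquiv.finrank_eq (LinearEquiv.ofLinearMap
    { toFun := fun f => e.toLinearMap ∘ₗ f
      map_add' := fun f g => LinearMap.comp_add _ _ _
      map_smul' := fun k f => ?_ }
    { toFun := fun f => e.symm.toLinearMap ∘ₗ f
      map_add' := fun f g => LinearMap.comp_add _ _ _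
      map_smul' := fun k f => ?_ } ?_ ?_)
  · exact LinearMap.ext fun x => LinearMap.map_smul_of_tower e.toLinearMap k (f x)
  · exact LinearMap.ext fun x => LinearMap.map_smul_of_tower e.symm.toLinearMap k (f x)
  · ext; simp
  · ext; simp

variable [FiniteDimensional K R]

lemma finiteDimensional_linearMap [Module.Finite R X] [Module K M] [IsScalarTower K R M]
    [FiniteDimensional K M] : FiniteDimensional K (X →ₗ[R] M) := by
  let _ : Module K X := Module.compHom X (algebraMap K R)
  have : IsScalarTower K R X := ⟨fun k r m => by rw [Algebra.smul_def, mul_smul]; rfl⟩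
  have : FiniteDimensional K X := Module.Finite.trans R X
  exact FiniteDimensional.of_injective (LinearMap.restrictScalarsₗ K R X M K)
    (LinearMap.restrictScalars_injective K)

lemma homDim_eq_add [Module.Finite R X] [Module.Projective R X] [Module.Finite R M]
    (N : Submodule R M) : homDim K R X M = homDim K R X N + homDim K R X (M ⧸ N) := by
  let _ : Module K M := Module.compHom M (algebraMap K R)
  have : IsScalarTower K R M := ⟨fun k r m => by rw [Algebra.smul_def, mul_smul]; rfl⟩
  have : FiniteDimensional K M := Module.Finite.trans R M
  have := finiteDimensional_linearMap K R (X := X) (M := M)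
  rw [homDim_eq_finrank, homDim_eq_finrank, homDim_eq_finrank]
  let φ : (X →ₗ[R] M) →ₗ[K] (X →ₗ[R] M ⧸ N) :=
    { toFun := fun f => N.mkQ ∘ₗ f
      map_add' := fun f g => LinearMap.comp_add _ _ _
      map_smul' := fun k f => LinearMap.ext fun x => LinearMap.map_smul_of_tower N.mkQ k (f x) }
  let ψ : (X →ₗ[R] N) →ₗ[K] (X →ₗ[R] M) :=
    { toFun := fun f => N.subtype ∘ₗ f
      map_add' := fun f g => LinearMap.comp_add _ _ _
      map_smul' := fun k f => LinearMap.ext fun x =>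
        LinearMap.map_smul_of_tower N.subtype k (f x) }
  have hφ : LinearMap.range φ = ⊤ := LinearMap.range_eq_top.2 fun g =>
    Module.projective_lifting_property N.mkQ g N.mkQ_surjective
  have hψ : LinearMap.ker ψ = ⊥ := LinearMap.ker_eq_bot.2 fun f g h =>
    LinearMap.ext fun x => Subtype.ext (LinearMap.congr_fun h x)
  have hφψ : LinearMap.ker φ = LinearMap.range ψ := by
    ext f
    constructor
    · intro hf
      have hf : ∀ x, f x ∈ N := fun x =>
        (Submodule.Quotient.mk_eq_zero N).1 (LinearMap.congr_fun (LinearMap.mem_ker.1 hf) x)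
      exact ⟨f.codRestrict N hf, LinearMap.ext fun x => rfl⟩
    · rintro ⟨g, rfl⟩
      exact LinearMap.mem_ker.2 (LinearMap.ext fun x =>
        (Submodule.Quotient.mk_eq_zero N).2 (g x).2)
  rw [← φ.finrank_range_add_finrank_ker, hφ, finrank_top, hφψ,
    LinearMap.finrank_range_of_inj (LinearMap.ker_eq_bot.1 hψ), add_comm]

end homDim

namespace QuivRel.Presentation

variable {G : QuivRel} {K R : Type} [Field K] [Ring R] [Algebra K R] (P : G.Presentation K R)

/-- The indecomposable projective module at a vertex. -/
def proj (v : G.V) : Submodule R R := Submodule.span R {P.e v}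

variable {P} in
lemma mem_proj {v : G.V} {r : R} : r ∈ P.proj v ↔ r * P.e v = r := by
  rw [proj, Submodule.mem_span_singleton]
  constructor
  · rintro ⟨s, rfl⟩
    simp [mul_assoc, P.e_mul_self]
  · exact fun h => ⟨r, h⟩

instance (v : G.V) : Module.Finite R (P.proj v) :=
  Module.Finite.iff_fg.2 (Submodule.fg_span_singleton _)

instance (v : G.V) : Module.Projective R (P.proj v) :=
  Module.Projective.of_split (P.proj v).subtype
    ((LinearMap.toSpanSingleton R R (P.e v)).codRestrict (P.proj v) fun r =>
      mem_proj.2 (by simp [mul_assoc, P.e_mul_self]))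
    (LinearMap.ext fun r => Subtype.ext (mem_proj.1 r.2))

/-- The part of a module supported at a vertex. -/
def fixed (v : G.V) (M : Type) [AddCommGroup M] [Module R M] [Module K M] [IsScalarTower K R M] :
    Submodule K M :=
  LinearMap.range (Algebra.lsmul K K M (P.e v))

section

variable {M : Type} [AddCommGroup M] [Module R M] [Module K M] [IsScalarTower K R M]

variable {P} in
lemma mem_fixed {v : G.V} {m : M} : m ∈ P.fixed v M ↔ P.e v • m = m := by
  constructor
  · rintro ⟨m, rfl⟩
    simp [← mul_smul, P.e_mul_self]
  · exact fun h => ⟨m, h⟩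

variable (M) in
/-- Maps from an indecomposable projective. -/
def homProjEquiv (v : G.V) : (P.proj v →ₗ[R] M) ≃ₗ[K] P.fixed v M where
  toFun f := ⟨f ⟨P.e v, mem_proj.2 (P.e_mul_self v)⟩, mem_fixed.2 (by
    rw [← map_smul]
    congr 1
    exact Subtype.ext (P.e_mul_self v))⟩
  map_add' f g := rfl
  map_smul' k f := rfl
  invFun m := (LinearMap.toSpanSingleton R M m).domRestrict _
  left_inv f := LinearMap.ext fun r => by
    change r.1 • f ⟨P.e v, _⟩ = f r
    rw [← map_smul]
    congr 1
    exact Subtype.ext (mem_proj.1 r.2)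
  right_inv m := Subtype.ext (mem_fixed.1 m.2)

lemma homDim_proj (v : G.V) : homDim K R (P.proj v) M = Module.finrank K (P.fixed v M) := by
  rw [homDim_eq_finrank, (P.homProjEquiv M v).finrank_eq]

end

lemma exists_character (v : G.V) : ∃ χ : R →ₐ[K] K, (∀ w, χ (P.e w) = if w = v then 1 else 0) ∧
    ∀ a, χ (P.x a) = 0 :=
  P.exists_lift K (fun w => if w = v then 1 else 0) (fun _ => 0) (by simp)
    (fun w w' h => by split_ifs <;> simp_all) (by simp) (by simp) (by simp) (by simp)

/-- The character of the algebra supported at a vertex. -/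
noncomputable def character (v : G.V) : R →ₐ[K] K := (P.exists_character v).choose

lemma character_e (v w : G.V) : P.character v (P.e w) = if w = v then 1 else 0 :=
  (P.exists_character v).choose_spec.1 w

lemma character_x (v : G.V) (a : G.A) : P.character v (P.x a) = 0 :=
  (P.exists_character v).choose_spec.2 a

/-- The simple module at a vertex. -/
def Simple (_ : G.Presentation K R) (_ : G.V) : Type := K

instance (v : G.V) : AddCommGroup (P.Simple v) := inferInstanceAs (AddCommGroup K)

instance (v : G.V) : Module K (P.Simple v) := inferInstanceAs (Module K K)

noncomputable instance (v : G.V) : Module R (P.Simple v) :=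
  Module.compHom (P.Simple v) (P.character v).toRingHom

lemma smul_simple {v : G.V} (r : R) (m : P.Simple v) : r • m = P.character v r • m := rfl

instance (v : G.V) : IsScalarTower K R (P.Simple v) := ⟨fun k r m => by
  simp only [smul_simple, map_smul, smul_assoc]⟩

lemma homDim_proj_simple (v w : G.V) :
    homDim K R (P.proj v) (P.Simple w) = if v = w then 1 else 0 := by
  rw [P.homDim_proj]
  have h : ∀ m : P.Simple w, P.e v • m = if v = w then m else 0 := fun m => by
    rw [smul_simple, character_e]
    split_ifs <;> simp
  split_ifs with hv
  · have : P.fixed v (P.Simple w) = ⊤ := eq_top_iff.2 fun m _ => mem_fixed.2 (by rw [h, if_pos hv])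
    rw [this, finrank_top]
    exact Module.finrank_self K
  · have : P.fixed v (P.Simple w) = ⊥ := eq_bot_iff.2 fun m hm => by
      rw [mem_fixed, h, if_neg hv] at hm
      exact hm.symm
    rw [this, finrank_bot]

/-- Every nonzero module has a nonzero vector spanning a simple submodule. -/
lemma exists_socle (hG : G.FinDim) (M : Type) [AddCommGroup M] [Module R M] [Nontrivial M] :
    ∃ (v : G.V) (y : M), y ≠ 0 ∧ P.e v • y = y ∧ ∀ a, P.x a • y = 0 := by
  classical
  obtain ⟨N, hN⟩ := hG
  have h : ∃ n, ∀ p : List G.A, p.length = n → ∀ m : M, (p.map P.x).prod • m = 0 := by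
    refine ⟨N + 1, fun p hp m => ?_⟩
    rw [P.prod_map_x_eq_zero (fun h => by have := hN p h; omega), zero_smul]
  have h0 : Nat.find h ≠ 0 := by
    intro h0
    obtain ⟨m, hm⟩ := exists_ne (0 : M)
    exact hm (by simpa using Nat.find_spec h [] (by simp [h0]) m)
  obtain ⟨n, hn⟩ := Nat.exists_eq_succ_of_ne_zero h0
  have h1 := Nat.find_min h (m := n) (by omega)
  push Not at h1
  obtain ⟨p, hp, m, hm⟩ := h1
  set y := (p.map P.x).prod • m with hy
  have hxy : ∀ a, P.x a • y = 0 := fun a => by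
    have := Nat.find_spec h (a :: p) (by simp [hp, hn]) m
    rwa [List.map_cons, List.prod_cons, mul_smul] at this
  have : ∃ v, P.e v • y ≠ 0 := by
    by_contra! H
    refine hm ?_
    rw [← one_smul R y, ← P.sum_e, Finset.sum_smul]
    exact Finset.sum_eq_zero fun v _ => H v
  obtain ⟨v, hv⟩ := this
  refine ⟨v, P.e v • y, hv, by rw [← mul_smul, P.e_mul_self], fun a => ?_⟩
  rw [← mul_smul, x_mul_e]
  split_ifs
  · exact hxy a
  · exact zero_smul _ _

/-- The embedding of a simple module given by a vector of the socle. -/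
noncomputable def simpleHom {M : Type} [AddCommGroup M] [Module R M] [Module K M]
    [IsScalarTower K R M] {v : G.V} {y : M} (hv : P.e v • y = y) (hx : ∀ a, P.x a • y = 0) :
    P.Simple v →ₗ[R] M where
  toFun k := (show K from k) • y
  map_add' _ _ := add_smul (R := K) _ _ y
  map_smul' r k := by
    let S : Subalgebra K R :=
      { carrier := {r | r • y = P.character v r • y}
        mul_mem' := fun {r s} hr hs => by
          change (r * s) • y = _
          have hr : r • y = P.character v r • y := hr
          have hs : s • y = P.character v s • y := hs
          rw [mul_smul, hs, smul_comm, hr, map_mul, ← mul_smul, mul_comm]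
        add_mem' := fun {r s} hr hs => by
          change (r + s) • y = _
          have hr : r • y = P.character v r • y := hr
          have hs : s • y = P.character v s • y := hs
          rw [add_smul, hs, hr, map_add, add_smul]
        algebraMap_mem' := fun k => by
          change algebraMap K R k • y = _
          rw [algebraMap_smul, AlgHom.commutes]
          rfl }
    have hr : r ∈ S := by
      rw [P.subalgebra_eq_top S]
      · exact Algebra.mem_top
      · intro w
        change P.e w • y = _
        rw [character_e]
        split_ifs with h
        · rw [h, hv, one_smul]
        · rw [← hv, ← mul_smul, P.e_mul_of_ne _ _ h, zero_smul, zero_smul]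
      · intro a
        change P.x a • y = _
        rw [character_x, hx, zero_smul]
    have hr : r • y = P.character v r • y := hr
    change (P.character v r * (show K from k)) • y = r • (show K from k) • y
    rw [smul_comm, hr, ← mul_smul, mul_comm]

lemma simpleHom_injective {M : Type} [AddCommGroup M] [Module R M] [Module K M]
    [IsScalarTower K R M] {v : G.V} {y : M} (hv : P.e v • y = y) (hx : ∀ a, P.x a • y = 0)
    (hy : y ≠ 0) : Function.Injective (P.simpleHom hv hx) := fun _ _ h =>
  smul_left_injective K hy h

lemma apply_eq_sum_homDim (hG : G.FinDim) {F : Type} [Field F] (f : ModuleCat.{0} R → F)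
    (h₁ : ∀ M N : ModuleCat.{0} R, (M ≅ N) → f M = f N)
    (h₂ : ∀ (M : ModuleCat.{0} R) (N : Submodule R M), IsNoetherian R M →
      f M = f (.of R N) + f (.of R (M ⧸ N)))
    (M : Type) [AddCommGroup M] [Module R M] [Module.Finite R M] :
    f (.of R M) = ∑ v, (homDim K R (P.proj v) M : F) * f (.of R (P.Simple v)) := by
  have hK := P.finiteDimensional hG
  have hR : IsNoetherianRing R := isNoetherianRing_iff.2 (isNoetherian_of_tower K inferInstance)
  suffices H : ∀ (n : ℕ) (M : Type) [AddCommGroup M] [Module R M] [Module K M]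
      [IsScalarTower K R M] [FiniteDimensional K M], Module.finrank K M = n →
      f (.of R M) = ∑ v, (homDim K R (P.proj v) M : F) * f (.of R (P.Simple v)) by
    let _ : Module K M := Module.compHom M (algebraMap K R)
    have : IsScalarTower K R M := ⟨fun k r m => by rw [Algebra.smul_def, mul_smul]; rfl⟩
    have : FiniteDimensional K M := Module.Finite.trans R M
    exact H _ M rfl
  intro n
  induction n using Nat.strong_induction_on with
  | _ n ih =>
    intro M _ _ _ _ _ hn
    have : Module.Finite R M := Module.Finite.of_restrictScalars_finite K R M
    have hM : IsNoetherian R (ModuleCat.of R M) := inferInstanceAs (IsNoetherian R M)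
    rcases subsingleton_or_nontrivial M with hs | hs
    · have h0 := h₂ (.of R M) ⊤ hM
      have e₁ : M ≃ₗ[R] (⊤ : Submodule R M) := LinearEquiv.ofSubsingleton _ _
      have e₂ : M ≃ₗ[R] (M ⧸ (⊤ : Submodule R M)) := LinearEquiv.ofSubsingleton _ _
      rw [← h₁ _ _ e₁.toModuleIso, ← h₁ _ _ e₂.toModuleIso] at h0
      rw [right_eq_add.1 h0, eq_comm]
      refine Finset.sum_eq_zero fun v _ => ?_
      rw [homDim_eq_finrank, Module.finrank_zero_of_subsingleton, Nat.cast_zero, zero_mul]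
    · obtain ⟨v, y, hy, hv, hx⟩ := P.exists_socle hG M
      let e := LinearEquiv.ofInjective _ (P.simpleHom_injective hv hx hy)
      set N : Submodule R M := LinearMap.range (P.simpleHom hv hx) with hN
      have hlt : Module.finrank K (M ⧸ N) < n := by
        have hpos : 0 < Module.finrank K (N.restrictScalars K) :=
          Module.finrank_pos_iff_exists_ne_zero.2 ⟨⟨y, (show K from 1), one_smul K y⟩,
            fun h => hy (congrArg Subtype.val h)⟩
        rw [← (Submodule.Quotient.restrictScalarsEquiv K N).finrank_eq, ← hn,
          ← (N.restrictScalars K).finrank_quotient_add_finrank]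
        exact Nat.lt_add_of_pos_right hpos
      rw [h₂ (.of R M) N hM, ← h₁ _ _ e.toModuleIso, ih _ hlt (M ⧸ N) rfl]
      simp_rw [homDim_eq_add K R N, ← e.homDim_eq, P.homDim_proj_simple]
      simp [add_mul, Finset.sum_add_distrib]

end QuivRel.Presentation

/-- The coinduced module `Hom_K(R, K)`. -/
def Coinduced (K R : Type) [Field K] [Ring R] [Algebra K R] : Type := R →ₗ[K] K

namespace Coinduced

variable {K R : Type} [Field K] [Ring R] [Algebra K R]

instance : AddCommGroup (Coinduced K R) := inferInstanceAs (AddCommGroup (R →ₗ[K] K))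

instance : Module K (Coinduced K R) := inferInstanceAs (Module K (R →ₗ[K] K))

instance [FiniteDimensional K R] : FiniteDimensional K (Coinduced K R) :=
  inferInstanceAs (FiniteDimensional K (R →ₗ[K] K))

/-- The linear form underlying an element of the coinduced module. -/
def form : Coinduced K R →ₗ[K] R →ₗ[K] K := LinearMap.id

@[ext]
lemma ext {φ ψ : Coinduced K R} (h : ∀ q, form φ q = form ψ q) : φ = ψ := LinearMap.ext h

instance : Module R (Coinduced K R) where
  smul r φ := (form φ) ∘ₗ LinearMap.mulRight K r
  one_smul φ := ext fun q => congrArg (form φ) (mul_one q)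
  mul_smul r s φ := ext fun q => congrArg (form φ) (mul_assoc q r s).symm
  smul_zero _ := rfl
  smul_add _ _ _ := rfl
  add_smul r s φ := ext fun q => (congrArg (form φ) (mul_add q r s)).trans (map_add _ _ _)
  zero_smul φ := ext fun q => (congrArg (form φ) (mul_zero q)).trans (map_zero _)

@[simp]
lemma form_smul (r : R) (φ : Coinduced K R) (q : R) : form (r • φ) q = form φ (q * r) := rfl

instance : IsScalarTower K R (Coinduced K R) := ⟨fun k r φ => ext fun q => by
  rw [form_smul, mul_smul_comm, map_smul, map_smul, LinearMap.smul_apply, form_smul]⟩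

end Coinduced

namespace QuivRel.Presentation

open Coinduced

variable {G : QuivRel} {K R : Type} [Field K] [Ring R] [Algebra K R] (P : G.Presentation K R)

/-- The indecomposable injective module at a vertex. -/
def inj (i : G.V) : Submodule R (Coinduced K R) where
  carrier := {φ | ∀ q, form φ (P.e i * q) = form φ q}
  add_mem' hφ hψ q := by simp only [map_add, LinearMap.add_apply, hφ q, hψ q]
  zero_mem' q := by simp
  smul_mem' r φ hφ q := by simp only [form_smul, mul_assoc, hφ (q * r)]

/-- Maps to an indecomposable injective. -/
def homInjEquiv (i : G.V) (M : Type) [AddCommGroup M] [Module R M] [Module K M]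
    [IsScalarTower K R M] : (M →ₗ[R] P.inj i) ≃ₗ[K] Module.Dual K (P.fixed i M) where
  toFun f :=
    { toFun := fun m => form (f m.1).1 1
      map_add' := fun m n => by simp
      map_smul' := fun k m => by
        rw [Submodule.coe_smul, LinearMap.map_smul_of_tower]
        rfl }
  map_add' f g := rfl
  map_smul' k f := rfl
  invFun ψ :=
    { toFun := fun m => ⟨(show Coinduced K R from
        { toFun := fun q => ψ ⟨P.e i • q • m, mem_fixed.2 (by rw [← mul_smul, P.e_mul_self])⟩
          map_add' := fun q r => by
            rw [← map_add]
            congr 1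
            exact Subtype.ext (by simp [add_smul])
          map_smul' := fun k q => by
            rw [RingHom.id_apply, ← map_smul]
            congr 1
            exact Subtype.ext ((congrArg (P.e i • ·) (smul_assoc k q m)).trans
              (smul_comm (P.e i) k (q • m))) }), fun q => congrArg ψ
          (Subtype.ext (by
            change P.e i • (P.e i * q) • m = P.e i • q • m
            rw [← mul_smul, ← mul_smul, ← mul_assoc, P.e_mul_self]))⟩
      map_add' := fun m n => Subtype.ext <| Coinduced.ext fun q =>
        (congrArg ψ (Subtype.ext (by simp))).trans (map_add ψ _ _)
      map_smul' := fun r m => Subtype.ext <| Coinduced.ext fun q =>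
        congrArg ψ (Subtype.ext (by
          change P.e i • q • r • m = P.e i • (q * r) • m
          rw [mul_smul])) }
  left_inv f := LinearMap.ext fun m => Subtype.ext <| Coinduced.ext fun q => by
    change form (f (P.e i • q • m)).1 1 = form (f m).1 q
    rw [map_smul, map_smul, ← mul_smul, Submodule.coe_smul, form_smul, one_mul, (f m).2]
  right_inv ψ := LinearMap.ext fun m => congrArg ψ (Subtype.ext (by
    change P.e i • (1 : R) • m.1 = m.1
    rw [one_smul, mem_fixed.1 m.2]))

/-- The part of an indecomposable injective supported at a vertex. -/
def fixedInjEquiv (i j : G.V) : P.fixed j (P.inj i) ≃ₗ[K] Module.Dual K (P.corner i j) where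
  toFun φ := (form φ.1.1) ∘ₗ (P.corner i j).subtype
  map_add' f g := rfl
  map_smul' k f := rfl
  invFun ψ := ⟨⟨(show Coinduced K R from
    { toFun := fun q => ψ ⟨P.e i * q * P.e j, mem_corner.2
        ⟨by simp only [← mul_assoc, P.e_mul_self], by simp only [mul_assoc, P.e_mul_self]⟩⟩
      map_add' := fun q r => by
        rw [← map_add]
        congr 1
        exact Subtype.ext (by simp [mul_add, add_mul])
      map_smul' := fun k q => by
        rw [RingHom.id_apply, ← map_smul]
        congr 1
        exact Subtype.ext (by simp) }), fun q => congrArg ψ (Subtype.ext (by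
          change P.e i * (P.e i * q) * P.e j = P.e i * q * P.e j
          rw [← mul_assoc, P.e_mul_self]))⟩, mem_fixed.2 (Subtype.ext <| Coinduced.ext fun q =>
            congrArg ψ (Subtype.ext (by
              change P.e i * (q * P.e j) * P.e j = P.e i * q * P.e j
              simp only [mul_assoc, P.e_mul_self])))⟩
  left_inv φ := Subtype.ext <| Subtype.ext <| Coinduced.ext fun q => by
    change form φ.1.1 (P.e i * q * P.e j) = form φ.1.1 q
    rw [mul_assoc, φ.1.2, ← form_smul]
    congr 2
    exact congrArg Subtype.val (mem_fixed.1 φ.2)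
  right_inv ψ := LinearMap.ext fun q => congrArg ψ (Subtype.ext (by
    change P.e i * q.1 * P.e j = q.1
    rw [(mem_corner.1 q.2).1, (mem_corner.1 q.2).2]))

lemma homDim_proj_inj (hG : G.FinDim) (i j : G.V) :
    (homDim K R (P.proj j) (P.inj i) : ℤ) = G.cartan i j := by
  rw [P.homDim_proj, (P.fixedInjEquiv i j).finrank_eq, Subspace.dual_finrank_eq,
    P.finrank_corner hG]

/-- The part of an indecomposable projective supported at a vertex. -/
def fixedProjEquiv (i j : G.V) : P.fixed i (P.proj j) ≃ₗ[K] P.corner i j where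
  toFun r := ⟨r.1.1, mem_corner.2 ⟨congrArg Subtype.val (mem_fixed.1 r.2), mem_proj.1 r.1.2⟩⟩
  map_add' _ _ := rfl
  map_smul' _ _ := rfl
  invFun r := ⟨⟨r.1, mem_proj.2 (mem_corner.1 r.2).2⟩,
    mem_fixed.2 (Subtype.ext (mem_corner.1 r.2).1)⟩
  left_inv _ := rfl
  right_inv _ := rfl

lemma homDim_proj_proj (hG : G.FinDim) (i j : G.V) :
    (homDim K R (P.proj i) (P.proj j) : ℤ) = G.cartan i j := by
  rw [P.homDim_proj, (P.fixedProjEquiv i j).finrank_eq, P.finrank_corner hG]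

lemma homDim_proj_of_projective (hG : G.FinDim) (F : Type) [Field F] (M : Type) [AddCommGroup M]
    [Module R M] [Module.Finite R M] [Module.Projective R M] (i : G.V) :
    (homDim K R (P.proj i) M : F) =
      ∑ j, (G.cartan i j : F) * (homDim K R M (P.Simple j) : F) := by
  have hK := P.finiteDimensional hG
  let _ : Module K M := Module.compHom M (algebraMap K R)
  have : IsScalarTower K R M := ⟨fun k r m => by rw [Algebra.smul_def, mul_smul]; rfl⟩
  have : FiniteDimensional K (P.inj i) :=
    inferInstanceAs (FiniteDimensional K ((P.inj i).restrictScalars K))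
  have : Module.Finite R (P.inj i) := Module.Finite.of_restrictScalars_finite K R _
  rw [P.homDim_proj, ← Subspace.dual_finrank_eq, ← (P.homInjEquiv i M).finrank_eq,
    ← homDim_eq_finrank,
    P.apply_eq_sum_homDim hG (fun N : ModuleCat.{0} R => (homDim K R M N : F))
      (fun N N' e => by rw [e.toLinearEquiv.homDim_eq])
      (fun N N' hN => by rw [homDim_eq_add K R N']; exact Nat.cast_add _ _) (P.inj i)]
  refine Finset.sum_congr rfl fun j _ => ?_
  rw [← P.homDim_proj_inj hG, Int.cast_natCast]

end QuivRel.Presentation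

namespace QuivRel

/-- The kernel of the transposed Cartan matrix over a field. -/
def cartanKer (G : QuivRel) (F : Type) [Field F] : Submodule F (G.V → F) where
  carrier := {v | ∀ j, ∑ i, (G.cartan i j : F) * v i = 0}
  add_mem' hv hw j := by simp only [Pi.add_apply, mul_add, Finset.sum_add_distrib, hv j, hw j,
    add_zero]
  zero_mem' j := by simp
  smul_mem' r v hv j := by
    simp only [Pi.smul_apply, smul_eq_mul, mul_left_comm _ r, ← Finset.mul_sum, hv j, mul_zero]

namespace Presentation

variable {G : QuivRel} {K R : Type} [Field K] [Ring R] [Algebra K R] (P : G.Presentation K R)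

open scoped Classical in
/-- Additive functions vanishing on projectives are determined by their values on simples. -/
noncomputable def additiveFunctionsEquiv (hG : G.FinDim) (F : Type) [Field F] :
    ModuleCat.additiveFunctions F R ≃ₗ[F] G.cartanKer F := by
  have hK := P.finiteDimensional hG
  have hR : IsNoetherianRing R := isNoetherianRing_iff.2 (isNoetherian_of_tower K inferInstance)
  have key : ∀ (f : ModuleCat.additiveFunctions F R) (M : Type) [AddCommGroup M] [Module R M]
      [Module.Finite R M], f.1 (.of R M) =
        ∑ v, (homDim K R (P.proj v) M : F) * f.1 (.of R (P.Simple v)) := fun f M _ _ _ =>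
    P.apply_eq_sum_homDim hG f.1 f.2.1 f.2.2.1 M
  refine
    { toFun := fun f => ⟨fun v => f.1 (.of R (P.Simple v)), fun j => ?_⟩
      map_add' := fun f g => rfl
      map_smul' := fun r f => rfl
      invFun := fun v => ⟨fun M => if IsNoetherian R M then
        ∑ i, (homDim K R (P.proj i) M : F) * v.1 i else 0, ?_, ?_, ?_, ?_⟩
      left_inv := fun f => Subtype.ext (funext fun M => ?_)
      right_inv := fun v => Subtype.ext (funext fun i => ?_) }
  · have h := key f (P.proj j)
    rw [f.2.2.2.2 (.of R (P.proj j)) (inferInstanceAs (IsNoetherian R (P.proj j)))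
      ((IsProjective.iff_projective _).1 inferInstance)] at h
    rw [h]
    refine Finset.sum_congr rfl fun i _ => ?_
    rw [← P.homDim_proj_proj hG, Int.cast_natCast]
  · intro M N e
    have h : IsNoetherian R M ↔ IsNoetherian R N := ⟨fun _ => isNoetherian_of_linearEquiv
      e.toLinearEquiv, fun _ => isNoetherian_of_linearEquiv e.toLinearEquiv.symm⟩
    simp only [e.toLinearEquiv.homDim_eq, h]
  · intro M N hM
    have h1 : IsNoetherian R (ModuleCat.of R N) := inferInstanceAs (IsNoetherian R N)
    have h2 : IsNoetherian R (ModuleCat.of R (M ⧸ N)) := inferInstanceAs (IsNoetherian R (M ⧸ N))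
    simp only [if_pos hM, if_pos h1, if_pos h2, ← Finset.sum_add_distrib]
    refine Finset.sum_congr rfl fun i _ => ?_
    rw [homDim_eq_add K R N, Nat.cast_add, add_mul]
  · intro M hM
    exact if_neg hM
  · intro M hM hM'
    have := (IsProjective.iff_projective M).2 hM'
    simp only [if_pos hM, P.homDim_proj_of_projective hG F M, Finset.sum_mul]
    rw [Finset.sum_comm]
    refine Finset.sum_eq_zero fun j _ => ?_
    simp only [mul_right_comm _ _ (v.1 _), ← Finset.sum_mul, v.2 j, zero_mul]
  · by_cases hM : IsNoetherian R M
    · simp only [if_pos hM]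
      exact (key f M).symm
    · simp only [if_neg hM]
      exact (f.2.2.2.1 M hM).symm
  · have : FiniteDimensional K (P.Simple i) := inferInstanceAs (FiniteDimensional K K)
    have : Module.Finite R (P.Simple i) := Module.Finite.of_restrictScalars_finite K R _
    have hM : IsNoetherian R (P.Simple i) := inferInstance
    have hM : IsNoetherian R (ModuleCat.of R (P.Simple i)) := hM
    simp only [if_pos hM]
    simp [P.homDim_proj_simple]

end Presentation

end QuivRel

lemma DerivedEquivalent.finrank_cartanKer {K : Type} [Field K] {G G' : QuivRel}
    (hG : G.FinDim) (hG' : G'.FinDim)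
    (h : DerivedEquivalent (PathAlgebra K G) (PathAlgebra K G')) (F : Type) [Field F] :
    Module.finrank F (G.cartanKer F) = Module.finrank F (G'.cartanKer F) := by
  let e := (PathAlgebra.presentation K G).additiveFunctionsEquiv hG F
  let e' := (PathAlgebra.presentation K G').additiveFunctionsEquiv hG' F
  have := (PathAlgebra.presentation K G).finiteDimensional hG
  have := (PathAlgebra.presentation K G').finiteDimensional hG'
  have := Module.Finite.equiv e.symm
  have := Module.Finite.equiv e'.symm
  rw [← e.finrank_eq, ← e'.finrank_eq]
  exact DerivedEquivalent.finrank_additiveFunctions F K h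

lemma Nat.card_subtype_list {α : Type} [Fintype α] (P : List α → Prop) [Decidable (P [])]
    [Finite {p // P p}] :
    Nat.card {p // P p} = (if P [] then 1 else 0) + ∑ a, Nat.card {p // P (a :: p)} := by
  classical
  have (a : α) : Finite {p // P (a :: p)} :=
    Finite.of_injective (fun p => (⟨a :: p.1, p.2⟩ : {p // P p})) fun p q h => by
      simpa [Subtype.ext_iff] using h
  let e : {p // P p} ≃ {_u : Unit // P []} ⊕ Σ a, {p // P (a :: p)} :=
    { toFun := fun
        | ⟨[], h⟩ => .inl ⟨(), h⟩
        | ⟨a :: p, h⟩ => .inr ⟨a, p, h⟩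
      invFun := Sum.elim (fun h => ⟨[], h.2⟩) fun p => ⟨p.1 :: p.2.1, p.2.2⟩
      left_inv := by rintro ⟨_ | _, h⟩ <;> rfl
      right_inv := by rintro (_ | _) <;> rfl }
  rw [Nat.card_congr e, Nat.card_sum, Nat.card_sigma]
  congr 1
  split_ifs with h <;> simp [h]

namespace QuivRel

open Module

variable {G : QuivRel}

open scoped Classical in
lemma FinDim.card_cons (i j : G.V) (a : G.A) :
    Nat.card {p // G.IsNonzeroPathFrom i j (a :: p)} = if G.src a = i then
      Nat.card {p // G.IsNonzeroPathFrom (G.src a) j (a :: p)} else 0 := by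
  split_ifs with h
  · rw [h]
  · have : IsEmpty {p // G.IsNonzeroPathFrom i j (a :: p)} :=
      ⟨fun p => h (isNonzeroPathFrom_cons.1 p.2).1⟩
    exact Nat.card_of_isEmpty

open scoped Classical in
lemma FinDim.cartan_eq (hG : G.FinDim) (i j : G.V) :
    G.cartan i j = (if i = j then 1 else 0) + ∑ a, if G.src a = i then
      (Nat.card {p // G.IsNonzeroPathFrom (G.src a) j (a :: p)} : ℤ) else 0 := by
  have := hG.finite_isNonzeroPathFrom i j
  rw [cartan, Nat.card_subtype_list, isNonzeroPathFrom_nil]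
  simp_rw [card_cons i j]
  push_cast
  rfl

open scoped Classical in
lemma FinDim.card_path_eq (hG : G.FinDim) (a : G.A) (j : G.V) :
    Nat.card {p // G.IsNonzeroPathFrom (G.src a) j (a :: p)} = (if G.tgt a = j then 1 else 0) +
      ∑ b, if G.tgt a = G.src b ∧ ¬ G.rel a b then
        Nat.card {p // G.IsNonzeroPathFrom (G.src b) j (b :: p)} else 0 := by
  have := hG.finite_isNonzeroPathFrom (G.src a) j
  have : Finite {p // G.IsNonzeroPathFrom (G.src a) j (a :: p)} :=
    Finite.of_injective (fun p => (⟨a :: p.1, p.2⟩ : {p // G.IsNonzeroPathFrom (G.src a) j p}))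
      fun p q h => by simpa [Subtype.ext_iff] using h
  rw [Nat.card_subtype_list]
  congr 1
  · simp [isNonzeroPathFrom_cons, isNonzeroPathFrom_nil]
  · refine Finset.sum_congr rfl fun b _ => ?_
    split_ifs with h
    · refine Nat.card_congr (Equiv.subtypeEquivRight fun p => ?_)
      simp [isNonzeroPathFrom_cons (a := a), h]
    · have : IsEmpty {p // G.IsNonzeroPathFrom (G.src a) j (a :: b :: p)} := ⟨fun p => h (by
        have := p.2
        simp only [isNonzeroPathFrom_cons] at this
        exact ⟨this.2.2.1.symm, this.2.1 b rfl⟩)⟩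
      exact Nat.card_of_isEmpty

variable (G) in
open scoped Classical in
/-- The functions on arrows which are alternating along the relations. -/
def alternating (F : Type) [Field F] : Submodule F (G.A → F) where
  carrier := {x | ∀ a, x a + ∑ c, (if G.rel c a then x c else 0) = 0}
  add_mem' {x y} hx hy a := by
    simp only [Pi.add_apply, ite_add_zero, Finset.sum_add_distrib]
    linear_combination hx a + hy a
  zero_mem' a := by simp
  smul_mem' r x hx a := by
    have h := congrArg (r * ·) (hx a)
    simpa only [Pi.smul_apply, smul_eq_mul, mul_add, Finset.mul_sum, mul_ite, mul_zero] using h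

variable (G) in
open scoped Classical in
/-- The operator `1 - T`, where `T` sums over the nonzero extensions to the left. -/
noncomputable def pathOperator (F : Type) [Field F] : (G.A → F) →ₗ[F] (G.A → F) where
  toFun x b := x b - ∑ c, if G.tgt c = G.src b ∧ ¬ G.rel c b then x c else 0
  map_add' x y := by
    ext b
    simp only [Pi.add_apply, ite_add_zero, Finset.sum_add_distrib]
    ring
  map_smul' r x := by
    ext b
    simp only [Pi.smul_apply, smul_eq_mul, RingHom.id_apply, mul_sub, Finset.mul_sum, mul_ite,
      mul_zero]

variable {F : Type} [Field F]

open scoped Classical in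
lemma pathOperator_apply (x : G.A → F) (b : G.A) : G.pathOperator F x b =
    x b - ∑ c, if G.tgt c = G.src b ∧ ¬ G.rel c b then x c else 0 := rfl

lemma FinDim.pathOperator_injective (hG : G.FinDim) :
    Function.Injective (G.pathOperator F) := by
  classical
  rw [injective_iff_map_eq_zero]
  intro x hx
  by_contra h0
  have key : ∀ n, ∃ p : List G.A, p.length = n + 1 ∧ G.IsNonzeroPath p ∧
      ∃ a ∈ p.head?, x a ≠ 0 := by
    intro n
    induction n with
    | zero =>
      obtain ⟨a, ha⟩ := Function.ne_iff.1 h0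
      exact ⟨[a], rfl, isNonzeroPath_cons.2 ⟨by simp, isNonzeroPath_nil⟩, a, rfl, ha⟩
    | succ n ih =>
      obtain ⟨p, hp, hp', b, hb, hxb⟩ := ih
      have h := congrFun hx b
      rw [pathOperator_apply, Pi.zero_apply, sub_eq_zero] at h
      rw [h] at hxb
      obtain ⟨c, -, hc⟩ := Finset.exists_ne_zero_of_sum_ne_zero hxb
      rw [ne_eq, ite_eq_right_iff, Classical.not_imp] at hc
      refine ⟨c :: p, by simp [hp], isNonzeroPath_cons.2 ⟨fun b' hb' => ?_, hp'⟩, c, rfl, hc.2⟩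
      obtain rfl : b = b' := Option.some_injective _ (hb.symm.trans hb')
      exact hc.1
  obtain ⟨N, hN⟩ := hG
  obtain ⟨p, hp, hp', -⟩ := key N
  have := hN p hp'
  omega

open scoped Classical in
lemma FinDim.sum_cartan_mul (hG : G.FinDim) (x : G.A → F) (v : G.V → F)
    (h : ∀ a, G.pathOperator F x a = v (G.src a)) (j : G.V) :
    ∑ i, (G.cartan i j : F) * v i = v j + ∑ b, if G.tgt b = j then x b else 0 := by
  set g : G.A → F := fun a => (Nat.card {p // G.IsNonzeroPathFrom (G.src a) j (a :: p)} : F)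
  have hg : ∀ a, g a = (if G.tgt a = j then 1 else 0) +
      ∑ b, if G.tgt a = G.src b ∧ ¬ G.rel a b then g b else 0 := fun a => by
    have := congrArg (Nat.cast : ℕ → F) (hG.card_path_eq a j)
    push_cast at this
    exact this
  have hc : ∀ i, (G.cartan i j : F) =
      (if i = j then 1 else 0) + ∑ a, if G.src a = i then g a else 0 :=
    fun i => by
      have := congrArg (Int.cast : ℤ → F) (hG.cartan_eq i j)
      push_cast at this
      exact this
  calc ∑ i, (G.cartan i j : F) * v i = v j + ∑ a, g a * v (G.src a) := by
        simp only [hc, add_mul, Finset.sum_add_distrib, Finset.sum_mul, ite_mul, zero_mul, one_mul]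
        rw [Finset.sum_comm]
        simp
    _ = v j + ∑ a, (x a * g a - ∑ c, if G.tgt c = G.src a ∧ ¬ G.rel c a then x c * g a else 0) := by
        congr 1
        refine Finset.sum_congr rfl fun a _ => ?_
        rw [← h, pathOperator_apply, mul_comm, sub_mul, Finset.sum_mul]
        simp only [ite_mul, zero_mul]
    _ = v j + ∑ a, x a * (g a - ∑ b, if G.tgt a = G.src b ∧ ¬ G.rel a b then g b else 0) := by
        rw [Finset.sum_sub_distrib, Finset.sum_comm, ← Finset.sum_sub_distrib]
        simp only [mul_sub, Finset.mul_sum, mul_ite, mul_zero]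
    _ = _ := by
        congr 1
        refine Finset.sum_congr rfl fun a _ => ?_
        rw [sub_eq_iff_eq_add.2 (hg a)]
        simp

open scoped Classical in
lemma sum_tgt_eq (x : G.A → F) (b : G.A) :
    ∑ c, (if G.tgt c = G.src b then x c else 0) = ∑ c, (if G.rel c b then x c else 0) +
      ∑ c, if G.tgt c = G.src b ∧ ¬ G.rel c b then x c else 0 := by
  rw [← Finset.sum_add_distrib]
  refine Finset.sum_congr rfl fun c _ => ?_
  by_cases h : G.rel c b
  · simp [h, G.rel_comp c b h]
  · simp [h]

lemma FinDim.finrank_cartanKer (hG : G.FinDim) (F : Type) [Field F] :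
    finrank F (G.cartanKer F) = finrank F (G.alternating F) := by
  classical
  let τ : (G.A → F) →ₗ[F] (G.V → F) :=
    { toFun := fun x j => -∑ b, if G.tgt b = j then x b else 0
      map_add' := fun x y => by
        ext j
        simp only [Pi.add_apply, ite_add_zero, Finset.sum_add_distrib]
        ring
      map_smul' := fun r x => by
        ext j
        simp only [Pi.smul_apply, smul_eq_mul, RingHom.id_apply, Finset.mul_sum, mul_ite,
          mul_zero, mul_neg] }
  have hτ : ∀ x j, τ x j = -∑ b, if G.tgt b = j then x b else 0 := fun x j => rfl
  have key : ∀ x, x ∈ G.alternating F ↔ ∀ a, G.pathOperator F x a = τ x (G.src a) := by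
    refine fun x => forall_congr' fun a => ?_
    rw [hτ, sum_tgt_eq, pathOperator_apply]
    constructor <;> intro h <;> linear_combination h
  symm
  refine LinearEquiv.finrank_eq (LinearEquiv.ofBijective ((τ.domRestrict _).codRestrict
    (G.cartanKer F) fun x j => ?_) ⟨?_, fun v => ?_⟩)
  · exact (hG.sum_cartan_mul x.1 _ ((key x).1 x.2) j).trans (by simp [hτ])
  · rw [injective_iff_map_eq_zero]
    intro x hx
    refine Subtype.ext (hG.pathOperator_injective ?_)
    rw [ZeroMemClass.coe_zero, map_zero]
    have hx : τ x.1 = 0 := congrArg Subtype.val hx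
    ext a
    rw [(key x).1 x.2, hx]
    rfl
  · obtain ⟨x, hx⟩ := LinearMap.injective_iff_surjective.1
      (hG.pathOperator_injective (F := F)) fun a => v.1 (G.src a)
    have h := hG.sum_cartan_mul x v.1 (fun a => congrFun hx a)
    have hv : τ x = v.1 := by
      ext j
      rw [hτ, eq_comm, ← add_eq_zero_iff_eq_neg, ← h, v.2 j]
    exact ⟨⟨x, (key x).2 fun a => by rw [hv, hx]⟩, Subtype.ext hv⟩

end QuivRel

namespace QuivRel

open Module

variable {G : QuivRel}

/-- The periodic sequence of arrows of a cycle. -/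
def cyc {p : List G.A} (hp : p ≠ []) (k : ℕ) : G.A :=
  p[k % p.length]'(Nat.mod_lt _ (List.length_pos_of_ne_nil hp))

lemma cyc_of_lt {p : List G.A} (hp : p ≠ []) {k : ℕ} (hk : k < p.length) : cyc hp k = p[k] := by
  simp only [cyc, Nat.mod_eq_of_lt hk]

lemma IsZeroCycle.rel_cyc {p : List G.A} (hp : G.IsZeroCycle p) (k : ℕ) :
    G.rel (cyc hp.1 k) (cyc hp.1 (k + 1)) := by
  have := hp.2 ⟨k % p.length, Nat.mod_lt _ (List.length_pos_of_ne_nil hp.1)⟩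
  simpa [cyc] using this

lemma cyc_eq_iff {p : List G.A} (hp : p ≠ []) (hn : p.Nodup) {k l : ℕ} :
    cyc hp k = cyc hp l ↔ k ≡ l [MOD p.length] :=
  hn.getElem_inj_iff

lemma exists_cyc_eq {p : List G.A} (hp : p ≠ []) {a : G.A} (ha : a ∈ p) :
    ∃ k, k < p.length ∧ cyc hp k = a := by
  obtain ⟨k, hk, rfl⟩ := List.getElem_of_mem ha
  exact ⟨k, hk, cyc_of_lt hp hk⟩

lemma cyc_mem {p : List G.A} (hp : p ≠ []) (k : ℕ) : cyc hp k ∈ p := List.getElem_mem _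

/-- In a gentle quiver, a minimal cycle with full zero relations is determined up to rotation by
any of its arrows. -/
lemma Gentle.isRotated (hG : G.Gentle) {p q : List G.A} (hp : G.IsMinZeroCycle p)
    (hq : G.IsMinZeroCycle q) {a : G.A} (hap : a ∈ p) (haq : a ∈ q) : p ~r q := by
  obtain ⟨i, hi, hia⟩ := exists_cyc_eq hp.1.1 hap
  obtain ⟨j, hj, hja⟩ := exists_cyc_eq hq.1.1 haq
  have key : ∀ k, cyc hp.1.1 (i + k) = cyc hq.1.1 (j + k) := by
    intro k
    induction k with
    | zero => exact hia.trans hja.symm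
    | succ k ih =>
      exact hG.2.1 _ _ _ (hp.1.rel_cyc (i + k)) (ih ▸ hq.1.rel_cyc (j + k))
  have key' : ∀ k l, k ≡ l [MOD p.length] ↔ k ≡ l [MOD q.length] := fun k l => by
    rw [← Nat.ModEq.add_iff_left (n := p.length) (Nat.ModEq.refl i),
      ← cyc_eq_iff hp.1.1 hp.2, key, key, cyc_eq_iff hq.1.1 hq.2,
      Nat.ModEq.add_iff_left (Nat.ModEq.refl j)]
  have hlen : p.length = q.length := Nat.dvd_antisymm
    ((Nat.modEq_zero_iff_dvd).1 ((key' q.length 0).2 (by simp [Nat.ModEq])))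
    ((Nat.modEq_zero_iff_dvd).1 ((key' p.length 0).1 (by simp [Nat.ModEq])))
  refine ⟨i + q.length - j, List.ext_getElem (by simp [hlen]) fun k h₁ h₂ => ?_⟩
  have h := key (q.length - j + k)
  rw [← cyc_of_lt hq.1.1 h₂, List.getElem_rotate]
  have h' : cyc hq.1.1 k = cyc hq.1.1 (j + (q.length - j + k)) := by
    rw [cyc_eq_iff hq.1.1 hq.2, show j + (q.length - j + k) = q.length + k by omega]
    simp [Nat.ModEq]
  rw [h', ← h, cyc]
  congr 2
  omega

/-- An arrow with an infinite chain of relations to its left lies on a cycle. -/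
lemma Gentle.exists_isMinZeroCycle (hG : G.Gentle) (b : ℕ → G.A)
    (hb : ∀ k, G.rel (b (k + 1)) (b k)) : ∃ p, G.IsMinZeroCycle p ∧ b 0 ∈ p := by
  classical
  have cancel : ∀ m n, b m = b (m + n) → b 0 = b n := by
    intro m
    induction m with
    | zero => intro n h; simpa using h
    | succ m ih =>
      intro n h
      refine ih n (hG.2.1 _ _ _ (hb m) ?_)
      rw [h, Nat.add_right_comm]
      exact hb _
  have hex : ∃ n, 0 < n ∧ b 0 = b n := by
    obtain ⟨m, n, hmn, h⟩ := Finite.exists_ne_map_eq_of_infinite b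
    rcases hmn.lt_or_gt with hlt | hlt
    · exact ⟨n - m, by omega, cancel m _ (by rw [h]; congr 1; omega)⟩
    · exact ⟨m - n, by omega, cancel n _ (by rw [← h]; congr 1; omega)⟩
  obtain ⟨hpos, hN⟩ := Nat.find_spec hex
  have hmin := fun m hm => Nat.find_min hex (m := m) hm
  set N := Nat.find hex
  have hinj : ∀ i j, i < j → j ≤ N → 0 < i → b i ≠ b j := fun i j hij hj hi h =>
    hmin (j - i) (by omega) ⟨by omega, cancel i _ (by rw [h]; congr 1; omega)⟩
  refine ⟨List.ofFn fun k : Fin N => b (N - k), ⟨⟨?_, fun k => ?_⟩, ?_⟩, ?_⟩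
  · simp only [ne_eq, List.ofFn_eq_nil_iff]
    omega
  · obtain ⟨k, hk⟩ := k
    simp only [List.length_ofFn] at hk
    simp only [List.get_eq_getElem, List.getElem_ofFn, List.length_ofFn]
    by_cases hk' : k + 1 = N
    · rw [hk', Nat.mod_self, Nat.sub_zero, ← hN, show N - k = 0 + 1 by omega]
      exact hb 0
    · rw [Nat.mod_eq_of_lt (by omega), show N - k = (N - (k + 1)) + 1 by omega]
      exact hb _
  · rw [List.nodup_ofFn]
    rintro ⟨i, hi⟩ ⟨j, hj⟩ h
    simp only [Fin.mk.injEq]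
    by_contra hij
    rcases Ne.lt_or_gt hij with hlt | hlt
    · exact hinj (N - j) (N - i) (by omega) (by omega) (by omega) h.symm
    · exact hinj (N - i) (N - j) (by omega) (by omega) (by omega) h
  · rw [List.mem_ofFn]
    exact ⟨⟨0, hpos⟩, by simpa using hN.symm⟩

variable {F : Type} [Field F]

lemma Gentle.alternating_rel (hG : G.Gentle) {x : G.A → F} (hx : x ∈ G.alternating F) {a c : G.A}
    (h : G.rel c a) : x a = -x c := by
  classical
  rw [← add_eq_zero_iff_eq_neg, ← hx a]
  congr 1
  rw [Finset.sum_eq_single c, if_pos h]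
  · exact fun b _ hb => if_neg fun h' => hb (hG.2.2 _ _ _ h' h)
  · simp

lemma Gentle.alternating_cyc (hG : G.Gentle) {x : G.A → F} (hx : x ∈ G.alternating F)
    {p : List G.A} (hp : G.IsZeroCycle p) (k : ℕ) :
    x (cyc hp.1 k) = (-1) ^ k * x (cyc hp.1 0) := by
  induction k with
  | zero => simp
  | succ k ih => rw [hG.alternating_rel hx (hp.rel_cyc k), ih, pow_succ]; ring

lemma exists_rel_of_alternating {x : G.A → F} (hx : x ∈ G.alternating F) {a : G.A}
    (ha : x a ≠ 0) : ∃ c, G.rel c a ∧ x c ≠ 0 := by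
  classical
  have h : ∑ c, (if G.rel c a then x c else 0) ≠ 0 := fun h => ha (by simpa [h] using hx a)
  obtain ⟨c, -, hc⟩ := Finset.exists_ne_zero_of_sum_ne_zero h
  rw [ne_eq, ite_eq_right_iff, Classical.not_imp] at hc
  exact ⟨c, hc⟩

lemma Gentle.exists_cycle_of_alternating (hG : G.Gentle) {x : G.A → F}
    (hx : x ∈ G.alternating F) {a : G.A} (ha : x a ≠ 0) :
    ∃ p, G.IsMinZeroCycle p ∧ (-1 : F) ^ p.length = 1 ∧ a ∈ p := by
  let next : {a // x a ≠ 0} → {a // x a ≠ 0} := fun a =>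
    ⟨(exists_rel_of_alternating hx a.2).choose, (exists_rel_of_alternating hx a.2).choose_spec.2⟩
  have hnext : ∀ a, G.rel (next a).1 a.1 := fun a =>
    (exists_rel_of_alternating hx a.2).choose_spec.1
  obtain ⟨p, hp, hap⟩ := hG.exists_isMinZeroCycle (fun k => (next^[k] ⟨a, ha⟩).1) fun k => by
    rw [Function.iterate_succ_apply']
    exact hnext _
  refine ⟨p, hp, ?_, hap⟩
  obtain ⟨k, -, hk⟩ := exists_cyc_eq hp.1.1 hap
  have hk : cyc hp.1.1 k = a := hk
  have h0 : x (cyc hp.1.1 0) ≠ 0 := fun h => ha (by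
    rw [← hk, hG.alternating_cyc hx hp.1, h, mul_zero])
  have := hG.alternating_cyc hx hp.1 p.length
  rw [(cyc_eq_iff hp.1.1 hp.2).2 (show p.length ≡ 0 [MOD p.length] by simp [Nat.ModEq])] at this
  exact (mul_eq_right₀ h0).1 this.symm

variable (G F) in
/-- The minimal cycles supporting an alternating function. -/
def IsBalanced (p : List G.A) : Prop := G.IsMinZeroCycle p ∧ (-1 : F) ^ p.length = 1

variable (F) in
/-- The alternating function supported on a cycle. -/
def signs (p : List G.A) (a : G.A) : F := if a ∈ p then (-1) ^ p.idxOf a else 0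

lemma neg_one_pow_congr {n k l : ℕ} (hn : (-1 : F) ^ n = 1) (h : k ≡ l [MOD n]) :
    (-1 : F) ^ k = (-1) ^ l := by
  rw [← Nat.mod_add_div k n, ← Nat.mod_add_div l n, pow_add, pow_add, pow_mul, pow_mul, hn,
    one_pow, one_pow, h]

lemma IsBalanced.signs_cyc {p : List G.A} (hp : G.IsBalanced F p) (k : ℕ) :
    signs F p (cyc hp.1.1.1 k) = (-1) ^ k := by
  rw [signs, if_pos (cyc_mem _ _)]
  refine neg_one_pow_congr hp.2 ?_
  have : p.idxOf (cyc hp.1.1.1 k) = k % p.length := hp.1.2.idxOf_getElem _ _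
  rw [this]
  exact Nat.mod_modEq _ _

lemma Gentle.signs_mem (hG : G.Gentle) {p : List G.A} (hp : G.IsBalanced F p) :
    signs F p ∈ G.alternating F := by
  classical
  intro a
  have hsucc : ∀ c, c ∈ p → G.rel c a → a ∈ p := fun c hc hca => by
    obtain ⟨k, -, rfl⟩ := exists_cyc_eq hp.1.1.1 hc
    rw [hG.2.1 _ _ _ hca (hp.1.1.rel_cyc k)]
    exact cyc_mem _ _
  by_cases ha : a ∈ p
  · obtain ⟨k, -, hk⟩ := exists_cyc_eq hp.1.1.1 ha
    have hk' : cyc hp.1.1.1 (k + p.length - 1 + 1) = a := by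
      rw [← hk, cyc_eq_iff _ hp.1.2]
      have := List.length_pos_of_ne_nil hp.1.1.1
      rw [Nat.sub_add_cancel (by omega)]
      simp [Nat.ModEq]
    have hrel := hp.1.1.rel_cyc (k + p.length - 1)
    rw [hk'] at hrel
    rw [Finset.sum_eq_single (cyc hp.1.1.1 (k + p.length - 1)), if_pos hrel, ← hk',
      hp.signs_cyc, hp.signs_cyc, pow_succ]
    · ring
    · exact fun b _ hb => if_neg fun h' => hb (hG.2.2 _ _ _ h' hrel)
    · simp
  · rw [signs, if_neg ha, zero_add]
    refine Finset.sum_eq_zero fun c _ => ?_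
    split_ifs with h
    · rw [signs, if_neg fun hc => ha (hsucc c hc h)]
    · rfl

lemma finite_isMinZeroCycle : Set.Finite {p | G.IsMinZeroCycle p} :=
  (List.finite_length_le G.A (Fintype.card G.A)).subset fun _ hp => hp.2.length_le_card

lemma Gentle.finrank_alternating (hG : G.Gentle) (F : Type) [Field F] :
    finrank F (G.alternating F) = Nat.card (Quotient (G.cycleSetoid (G.IsBalanced F))) := by
  classical
  set Q := Quotient (G.cycleSetoid (G.IsBalanced F))
  have : Finite {p // G.IsBalanced F p} :=
    (finite_isMinZeroCycle.subset fun p hp => hp.1 : Set.Finite {p | G.IsBalanced F p})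
  have : Finite Q := Quotient.finite _
  have := Fintype.ofFinite Q
  have hne : ∀ q : Q, q.out.1 ≠ [] := fun q => q.out.2.1.1.1
  have hdisj : ∀ q q' : Q, ∀ a, a ∈ q.out.1 → a ∈ q'.out.1 → q = q' := fun q q' a h h' => by
    rw [← Quotient.out_eq q, ← Quotient.out_eq q']
    exact Quotient.sound (hG.isRotated q.out.2.1 q'.out.2.1 h h')
  let φ : G.alternating F →ₗ[F] (Q → F) :=
    { toFun := fun x q => x.1 (cyc (hne q) 0)
      map_add' := fun x y => rfl
      map_smul' := fun r x => rfl }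
  rw [Nat.card_eq_fintype_card, ← finrank_fintype_fun_eq_card F]
  refine LinearEquiv.finrank_eq (LinearEquiv.ofBijective φ ⟨?_, fun f => ?_⟩)
  · rw [injective_iff_map_eq_zero]
    intro x hx
    refine Subtype.ext (funext fun a => ?_)
    by_contra ha
    obtain ⟨p, hp, hp', hap⟩ := hG.exists_cycle_of_alternating x.2 ha
    let q : Q := Quotient.mk _ ⟨p, hp, hp'⟩
    have hq : q.out.1 ~r p := Quotient.mk_out (s := G.cycleSetoid (G.IsBalanced F)) ⟨p, hp, hp'⟩
    obtain ⟨k, -, hk⟩ := exists_cyc_eq (hne q) (hq.mem_iff.2 hap)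
    refine ha ?_
    rw [← hk, hG.alternating_cyc x.2 q.out.2.1.1]
    exact mul_eq_zero_of_right _ (congrFun hx q)
  · refine ⟨⟨∑ q, f q • signs F q.out.1, Submodule.sum_mem _ fun q _ =>
      Submodule.smul_mem _ _ (hG.signs_mem q.out.2)⟩, funext fun q => ?_⟩
    change (∑ q', f q' • signs F q'.out.1) (cyc (hne q) 0) = f q
    rw [Finset.sum_apply, Finset.sum_eq_single q]
    · rw [Pi.smul_apply, q.out.2.signs_cyc, pow_zero, smul_eq_mul, mul_one]
    · intro q' _ hq'
      rw [Pi.smul_apply, signs, if_neg fun h => hq' (hdisj _ _ _ h (cyc_mem (hne q) 0)), smul_zero]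
    · simp

lemma isBalanced_rat (p : List G.A) :
    G.IsBalanced ℚ p ↔ G.IsMinZeroCycle p ∧ Even p.length := by
  rw [IsBalanced, neg_one_pow_eq_one_iff_even (by norm_num)]

lemma isBalanced_zmod_two (p : List G.A) : G.IsBalanced (ZMod 2) p ↔ G.IsMinZeroCycle p := by
  rw [IsBalanced, CharTwo.neg_eq, one_pow]
  exact and_iff_left rfl

lemma totalCycles_eq_ec_add_oc (G : QuivRel) : G.totalCycles = G.ec + G.oc := by
  have hfin : ∀ P : List G.A → Prop, (∀ p, P p → G.IsMinZeroCycle p) →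
      Finite (Quotient (G.cycleSetoid P)) := fun P hP => by
    have : Finite {p // P p} :=
      (finite_isMinZeroCycle.subset hP : Set.Finite {p | P p})
    exact Quotient.finite _
  have := hfin _ fun p (hp : G.IsMinZeroCycle p ∧ Even p.length) => hp.1
  have := hfin _ fun p (hp : G.IsMinZeroCycle p ∧ Odd p.length) => hp.1
  rw [totalCycles, ec, oc, ← Nat.card_sum]
  symm
  refine Nat.card_congr (Equiv.ofBijective (Sum.elim
    (Quotient.map (fun p => ⟨p.1, p.2.1⟩) fun _ _ h => h)
    (Quotient.map (fun p => ⟨p.1, p.2.1⟩) fun _ _ h => h)) ⟨?_, ?_⟩)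
  · rintro (p | p) (q | q) h <;> obtain ⟨p, rfl⟩ := Quotient.exists_rep p <;>
      obtain ⟨q, rfl⟩ := Quotient.exists_rep q <;>
      replace h : p.1 ~r q.1 := Quotient.exact (s := G.cycleSetoid _)
        (a := ⟨p.1, p.2.1⟩) (b := ⟨q.1, q.2.1⟩) h
    · exact congrArg Sum.inl (Quotient.sound h)
    · exact (Nat.not_odd_iff_even.2 (h.perm.length_eq ▸ p.2.2) q.2.2).elim
    · exact (Nat.not_odd_iff_even.2 (h.perm.length_eq ▸ q.2.2) p.2.2).elim
    · exact congrArg Sum.inr (Quotient.sound h)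
  · rintro ⟨p, hp⟩
    rcases Nat.even_or_odd p.length with h | h
    · exact ⟨.inl (Quotient.mk _ ⟨p, hp, h⟩), rfl⟩
    · exact ⟨.inr (Quotient.mk _ ⟨p, hp, h⟩), rfl⟩

end QuivRel

/-- **Corollary 3.** Let `(Q,I)` and `(Q',I')` be gentle quivers, and let
`A = KQ/I` and `A' = KQ'/I'` be the corresponding (finite-dimensional) gentle
algebras over a field `K`.  If `A` and `A'` are derived equivalent, then
`ec(Q,I) = ec(Q',I')` and `oc(Q,I) = oc(Q',I')`. -/
theorem ec_oc_derived_invariant (K : Type) [Field K] (G G' : QuivRel)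
    (hG : G.Gentle) (hfd : G.FinDim) (hG' : G'.Gentle) (hfd' : G'.FinDim)
    (h : DerivedEquivalent (PathAlgebra K G) (PathAlgebra K G')) :
    G.ec = G'.ec ∧ G.oc = G'.oc := by
  have hcard (F : Type) [Field F] : Nat.card (Quotient (G.cycleSetoid (G.IsBalanced F))) =
      Nat.card (Quotient (G'.cycleSetoid (G'.IsBalanced F))) := by
    rw [← hG.finrank_alternating, ← hG'.finrank_alternating, ← hfd.finrank_cartanKer,
      ← hfd'.finrank_cartanKer, DerivedEquivalent.finrank_cartanKer hfd hfd' h]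
  have hec : G.ec = G'.ec := by
    have := hcard ℚ
    rwa [funext fun p => propext (QuivRel.isBalanced_rat p),
      funext fun p => propext (QuivRel.isBalanced_rat p)] at this
  have htotal : G.totalCycles = G'.totalCycles := by
    have := hcard (ZMod 2)
    rwa [funext fun p => propext (QuivRel.isBalanced_zmod_two p),
      funext fun p => propext (QuivRel.isBalanced_zmod_two p)] at this
  rw [QuivRel.totalCycles_eq_ec_add_oc, QuivRel.totalCycles_eq_ec_add_oc] at htotal
  exact ⟨hec, by omega⟩
end

section
/- Let (Q,I) be a special biserial quiver with I generated by paths of length 2, K a field, and A = KQ/I the corresponding finite-dimensional special biserial algebra. Let α be an arrow in Q which is not a loop, such that either there is no arrow β with s(α) = t(β) and βα ∈ I, or there is no arrow γ with t(α) = s(γ) and αγ ∈ I. Let Q' be the quiver obtained from Q by removing the arrow α, let I' be the corresponding relation ideal (the relations of I not involving α), and A' = KQ'/I'. Then the q-Cartan matrices C_A(q) and C_{A'}(q) are unimodularly equivalent over ℤ[q]. -/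
/-- The quiver with relations `(Q',I')` obtained from `(Q,I)` by removing the
arrow `α` (keeping the relations not involving `α`). -/
def QuivRel.removeArrow (G : QuivRel) (α : G.A) : QuivRel where
  V := G.V
  A := {a : G.A // a ≠ α}
  src a := G.src a.1
  tgt a := G.tgt a.1
  rel a b := G.rel a.1 b.1
  rel_comp _ _ h := G.rel_comp _ _ h

open Polynomial in
/-- The length generating function of a set of words. -/
noncomputable def lengthGF {β : Type*} (S : Set (List β)) : ℤ[X] :=
  ∑ᶠ p ∈ S, X ^ p.length

namespace lengthGF

open Polynomial

variable {β γ : Type*}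

theorem union {S T : Set (List β)} (hS : S.Finite) (hT : T.Finite) (hST : Disjoint S T) :
    lengthGF (S ∪ T) = lengthGF S + lengthGF T :=
  finsum_mem_union hST hS hT

theorem image {S : Set (List β)} {f : List β → List γ} (hf : S.InjOn f)
    (hlen : ∀ p ∈ S, (f p).length = p.length) : lengthGF (f '' S) = lengthGF S := by
  unfold lengthGF
  rw [finsum_mem_image hf]
  exact finsum_mem_congr rfl fun p hp => by rw [hlen p hp]

theorem image2_append {S T : Set (List β)} (hS : S.Finite) (hT : T.Finite)
    (hinj : (S ×ˢ T).InjOn fun x => x.1 ++ x.2) :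
    lengthGF (Set.image2 (· ++ ·) S T) = lengthGF S * lengthGF T := by
  classical
  lift S to Finset (List β) using hS
  lift T to Finset (List β) using hT
  unfold lengthGF
  rw [← Set.image_prod, finsum_mem_image hinj, ← Finset.coe_product]
  simp only [finsum_mem_coe_finset]
  rw [Finset.sum_product, Finset.sum_mul_sum]
  simp [pow_add]

theorem eq_finsum_card {S : Set (List β)} (hS : S.Finite) :
    lengthGF S = ∑ᶠ n : ℕ, (Nat.card {p : List β // p.length = n ∧ p ∈ S} : ℤ[X]) * X ^ n := by
  classical
  lift S to Finset (List β) using hS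
  have hcard (n : ℕ) : Nat.card {p : List β // p.length = n ∧ p ∈ (S : Set (List β))} =
      (S.filter fun p => p.length = n).card := by
    rw [← Nat.card_eq_finsetCard]
    simp only [Finset.mem_filter, Finset.mem_coe, and_comm]
  simp only [hcard]
  rw [finsum_eq_sum_of_support_subset (s := S.image List.length)]
  · unfold lengthGF
    rw [finsum_mem_coe_finset, ← Finset.sum_fiberwise_of_maps_to
      (t := S.image List.length) (g := List.length) (fun p hp => Finset.mem_image_of_mem _ hp)]
    refine Finset.sum_congr rfl fun n _ => ?_
    rw [Finset.sum_congr rfl fun p hp => by rw [(Finset.mem_filter.1 hp).2], Finset.sum_const,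
      nsmul_eq_mul]
  · intro n hn
    obtain ⟨p, hp⟩ : (S.filter fun p => p.length = n).Nonempty := by
      rw [← Finset.card_ne_zero]
      exact fun h => hn (by simp only [h, Nat.cast_zero, zero_mul])
    rw [Finset.mem_filter] at hp
    exact Finset.mem_coe.2 (Finset.mem_image.2 ⟨p, hp⟩)

end lengthGF

namespace UnimodEquiv

open Matrix

variable {n : Type} [Fintype n] [DecidableEq n] {R : Type} [CommRing R]

theorem transpose {C D : Matrix n n R} (h : UnimodEquiv C D) : UnimodEquiv Cᵀ Dᵀ := by
  obtain ⟨P, Q, hP, hQ, rfl⟩ := h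
  exact ⟨Qᵀ, Pᵀ, by rwa [det_transpose], by rwa [det_transpose], by
    simp [transpose_mul, Matrix.mul_assoc]⟩

/-- Subtracting multiples `w y` of the column `i` from the other columns `y`. -/
theorem of_column_operations {C D : Matrix n n R} (i : n) (w : n → R) (hw : w i = 0)
    (h : ∀ x y, C x y = D x y + C x i * w y) : UnimodEquiv C D := by
  refine ⟨1, 1 + replicateCol Unit (Pi.single i (1 : R)) * replicateRow Unit (-w), det_one, ?_, ?_⟩
  · rw [det_one_add_replicateCol_mul_replicateRow]
    simp [hw]
  · ext x y : 2
    rw [Matrix.one_mul, Matrix.mul_add, Matrix.mul_one, ← Matrix.mul_assoc, Matrix.add_apply,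
      Matrix.mul_apply]
    simp [Matrix.mul_apply, Pi.single_apply, h x y]

end UnimodEquiv

namespace QuivRel

variable {G : QuivRel}

theorem isNonzeroPath_iff_isChain {p : List G.A} :
    G.IsNonzeroPath p ↔ p.IsChain fun a b => G.tgt a = G.src b ∧ ¬ G.rel a b :=
  Iff.rfl

theorem FinDim.finite_paths (hfd : G.FinDim) (i j : G.V) :
    {p | G.IsNonzeroPathFrom i j p}.Finite := by
  obtain ⟨N, hN⟩ := hfd
  exact (List.finite_length_le G.A N).subset fun p hp => hN p hp.1

theorem FinDim.qCartan_eq (hfd : G.FinDim) (i j : G.V) :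
    G.qCartan i j = lengthGF {p | G.IsNonzeroPathFrom i j p} :=
  (lengthGF.eq_finsum_card (hfd.finite_paths i j)).symm

theorem isNonzeroPathFrom_map_val {α : G.A} {i j : G.V} {p : List {a : G.A // a ≠ α}} :
    G.IsNonzeroPathFrom i j (p.map Subtype.val) ↔ (G.removeArrow α).IsNonzeroPathFrom i j p := by
  change _ ↔ List.IsChain (fun a b => G.tgt a.1 = G.src b.1 ∧ ¬ G.rel a.1 b.1) p ∧
    (∀ a ∈ p.head?, G.src a.1 = i) ∧ (∀ a ∈ p.getLast?, G.tgt a.1 = j) ∧ (p = [] → i = j)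
  rw [IsNonzeroPathFrom, isNonzeroPath_iff_isChain, List.isChain_map, List.head?_map, List.getLast?_map, List.map_eq_nil_iff]
  simp only [Option.mem_map, forall_exists_index, and_imp, forall_apply_eq_imp_iff₂]

theorem FinDim.removeArrow (hfd : G.FinDim) (α : G.A) : (G.removeArrow α).FinDim := by
  obtain ⟨N, hN⟩ := hfd
  refine ⟨N, fun p hp => ?_⟩
  rw [← List.length_map (as := p) Subtype.val]
  exact hN _ ((List.isChain_map _).2 hp)

theorem removeArrow_qCartan_eq (hfd : G.FinDim) (α : G.A) (i j : G.V) :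
    (G.removeArrow α).qCartan i j = lengthGF {p | G.IsNonzeroPathFrom i j p ∧ α ∉ p} := by
  refine ((hfd.removeArrow α).qCartan_eq i j).trans ((lengthGF.image (f := List.map Subtype.val)
    (List.map_injective_iff.2 Subtype.val_injective).injOn
      fun p _ => List.length_map _).symm.trans (congrArg lengthGF ?_))
  ext p
  simp only [Set.mem_ofPred_eq]
  constructor
  · rintro ⟨q, hq, rfl⟩
    refine ⟨isNonzeroPathFrom_map_val.2 hq, fun h => ?_⟩
    obtain ⟨a, -, ha⟩ := List.mem_map.1 h
    exact a.2 ha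
  · rintro ⟨hp, hαp⟩
    lift p to List {a : G.A // a ≠ α} using fun a ha h => hαp (h ▸ ha)
    exact ⟨p, isNonzeroPathFrom_map_val.1 hp, rfl⟩

theorem isNonzeroPathFrom_append_cons {i j : G.V} {p q : List G.A} {a : G.A}
    (ha : ∀ b, ¬ G.rel b a) :
    G.IsNonzeroPathFrom i j (p ++ a :: q) ↔
      G.IsNonzeroPathFrom i (G.src a) p ∧ G.IsNonzeroPathFrom (G.src a) j (a :: q) := by
  simp only [IsNonzeroPathFrom, isNonzeroPath_iff_isChain]
  rw [List.isChain_append]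
  cases p <;> simp [ha] <;> grind

/-- A nonzero path into the start of `α` can be prolonged by `α` if `α` ends no relation. Hence it
cannot run through `α`, as it would then contain an oriented cycle without relations. -/
theorem FinDim.notMem_of_isNonzeroPathFrom_src (hfd : G.FinDim) {α : G.A}
    (hα : ∀ b, ¬ G.rel b α) {i : G.V} {p : List G.A}
    (hp : G.IsNonzeroPathFrom i (G.src α) p) : α ∉ p := by
  intro hmem
  obtain ⟨s, t, rfl⟩ := List.append_of_mem hmem
  have hc := ((isNonzeroPathFrom_append_cons hα).1 hp).2
  obtain ⟨N, hN⟩ := hfd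
  have hpow := hN (List.replicate (N + 1) (α :: t)).flatten ?_
  · simp only [List.length_flatten, List.map_replicate, List.sum_replicate, List.length_cons,
      smul_eq_mul] at hpow
    nlinarith
  · refine (List.isChain_flatten (by simp)).2
      ⟨fun l hl => List.eq_of_mem_replicate hl ▸ hc.1, List.isChain_replicate_of_rel _ ?_⟩
    intro x hx y hy
    obtain rfl : α = y := by simpa using hy
    exact ⟨hc.2.2.1 x hx, hα x⟩

theorem FinDim.qCartan_eq_removeArrow_add (hfd : G.FinDim) {α : G.A} (hα : ∀ b, ¬ G.rel b α)
    (i j : G.V) :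
    G.qCartan i j = (G.removeArrow α).qCartan i j + G.qCartan i (G.src α) *
      lengthGF {p | G.IsNonzeroPathFrom (G.src α) j p ∧ p.head? = some α} := by
  have hfin := hfd.finite_paths
  rw [removeArrow_qCartan_eq hfd, hfd.qCartan_eq, hfd.qCartan_eq, ← lengthGF.image2_append
    (hfin _ _) ((hfin _ _).subset fun p hp => hp.1), ← lengthGF.union
    ((hfin _ _).subset fun p hp => hp.1)]
  · congr 1
    ext p
    simp only [Set.mem_union, Set.mem_image2, Set.mem_ofPred_eq]
    constructor
    · intro hp
      by_cases hmem : α ∈ p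
      · obtain ⟨s, t, rfl⟩ := List.append_of_mem hmem
        have h := (isNonzeroPathFrom_append_cons hα).1 hp
        exact Or.inr ⟨s, h.1, α :: t, ⟨h.2, rfl⟩, rfl⟩
      · exact Or.inl ⟨hp, hmem⟩
    · rintro (hp | ⟨s, hs, t, ⟨ht, hhead⟩, rfl⟩)
      · exact hp.1
      · obtain ⟨t, rfl⟩ := List.head?_eq_some_iff.1 hhead
        exact (isNonzeroPathFrom_append_cons hα).2 ⟨hs, ht⟩
  · exact (hfin _ _).image2 _ ((hfin _ _).subset fun p hp => hp.1)
  · rw [Set.disjoint_left]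
    rintro _ ⟨-, hp⟩ ⟨s, -, t, ⟨-, ht⟩, rfl⟩
    exact hp (List.mem_append_right _ (List.mem_of_mem_head? ht))
  · rintro ⟨s, t⟩ ⟨hs, -, ht⟩ ⟨s', t'⟩ ⟨hs', -, ht'⟩ h
    have h₁ := hfd.notMem_of_isNonzeroPathFrom_src hα hs
    have h₂ := hfd.notMem_of_isNonzeroPathFrom_src hα hs'
    obtain ⟨t, rfl⟩ := List.head?_eq_some_iff.1 ht
    obtain ⟨t', rfl⟩ := List.head?_eq_some_iff.1 ht'
    rcases List.append_eq_append_iff.1 h with ⟨_ | ⟨b, u⟩, hu, hv⟩ | ⟨_ | ⟨b, u⟩, hu, hv⟩ <;>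
      simp_all

theorem FinDim.unimodEquiv_removeArrow (hfd : G.FinDim) {α : G.A} (hα : ∀ b, ¬ G.rel b α) :
    UnimodEquiv G.qCartan (G.removeArrow α).qCartan := by
  refine UnimodEquiv.of_column_operations (G.src α) _ ?_ (hfd.qCartan_eq_removeArrow_add hα)
  rw [← finsum_mem_empty (f := fun p : List G.A => (Polynomial.X : Polynomial ℤ) ^ p.length)]
  refine congrArg lengthGF (Set.eq_empty_of_forall_notMem fun p hp => ?_)
  exact hfd.notMem_of_isNonzeroPathFrom_src hα hp.1 (List.mem_of_mem_head? hp.2)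

/-- The opposite quiver, with the opposite relations. -/
abbrev op (G : QuivRel) : QuivRel where
  V := G.V
  A := G.A
  src := G.tgt
  tgt := G.src
  rel a b := G.rel b a
  rel_comp a b h := (G.rel_comp b a h).symm

theorem op_isNonzeroPath {p : List G.A} : G.op.IsNonzeroPath p ↔ G.IsNonzeroPath p.reverse := by
  rw [isNonzeroPath_iff_isChain, isNonzeroPath_iff_isChain, List.isChain_reverse]
  simp only [eq_comm]

theorem op_isNonzeroPathFrom {i j : G.V} {p : List G.A} :
    G.op.IsNonzeroPathFrom i j p ↔ G.IsNonzeroPathFrom j i p.reverse := by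
  unfold IsNonzeroPathFrom
  rw [op_isNonzeroPath]
  simp only [List.head?_reverse, List.getLast?_reverse, List.reverse_eq_nil_iff, eq_comm (a := i)]
  tauto

theorem FinDim.op (hfd : G.FinDim) : G.op.FinDim := by
  obtain ⟨N, hN⟩ := hfd
  exact ⟨N, fun p hp => List.length_reverse (as := p) ▸ hN _ (op_isNonzeroPath.1 hp)⟩

theorem FinDim.op_qCartan (hfd : G.FinDim) : G.op.qCartan = G.qCartan.transpose := by
  ext1 i j
  rw [Matrix.transpose_apply, hfd.op.qCartan_eq, hfd.qCartan_eq,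
    ← lengthGF.image (f := List.reverse) List.reverse_injective.injOn fun p _ => List.length_reverse]
  congr 1
  ext p
  constructor
  · rintro ⟨q, hq, rfl⟩
    exact op_isNonzeroPathFrom.1 hq
  · intro hp
    refine ⟨p.reverse, op_isNonzeroPathFrom.2 ?_, List.reverse_reverse p⟩
    rwa [List.reverse_reverse]

end QuivRel

/-- **Lemma (arrow removal).** Let `(Q,I)` be a special biserial quiver with
`I` generated by paths of length `2`, and `A = KQ/I` the corresponding
finite-dimensional special biserial algebra.  Let `α` be an arrow of `Q`, not a
loop, such that there is no arrow `β` with `s(α) = t(β)` and `βα ∈ I`, or no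
arrow `γ` with `t(α) = s(γ)` and `αγ ∈ I`.  Then the `q`-Cartan matrices of `A`
and of the algebra `A' = KQ'/I'` obtained by removing `α` are unimodularly
equivalent over `ℤ[q]`. -/
theorem qCartan_removeArrow_unimodEquiv (G : QuivRel) (hG : G.SpecialBiserial)
    (hfd : G.FinDim) (α : G.A) (hloop : G.src α ≠ G.tgt α)
    (hα : (¬ ∃ β : G.A, G.src α = G.tgt β ∧ G.rel β α) ∨
          (¬ ∃ γ : G.A, G.tgt α = G.src γ ∧ G.rel α γ)) :
    UnimodEquiv G.qCartan (G.removeArrow α).qCartan := by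
  rcases hα with h | h
  · exact hfd.unimodEquiv_removeArrow fun b hb => h ⟨b, (G.rel_comp b α hb).symm, hb⟩
  · have key := (hfd.op.unimodEquiv_removeArrow (α := α)
      fun b hb => h ⟨b, G.rel_comp α b hb, hb⟩).transpose
    have hop : (G.op.removeArrow α).qCartan = (G.removeArrow α).qCartan.transpose :=
      (hfd.removeArrow α).op_qCartan
    rw [hop, hfd.op_qCartan] at key
    exact key
end
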